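/- Every 3-regular simple graph on 14 vertices that is cospectral with some non-isomorphic 3-regular graph on 14 vertices is 3-edge-colorable; that is, among cubic graphs of order 14, all graphs belonging to a cospectral pair have chromatic index 3. -/

import Mathlib

open Matrix Polynomial

/-- The adjacency matrix over `ℝ` of a simple graph on `Fin n`. -/
noncomputable def adjMat {n : ℕ} (G : SimpleGraph (Fin n)) : Matrix (Fin n) (Fin n) ℝ :=
  letI : DecidableRel G.Adj := Classical.decRel G.Adj
  G.adjMatrix ℝ

/-- The chromatic index of a simple graph: the chromatic number of its line graph. -/
noncomputable def chromaticIndex {V : Type*} (G : SimpleGraph V) : ℕ∞ :=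
  G.lineGraph.chromaticNumber

namespace CubicFourteen

/-! ### A verified search for cubic graphs

The definitions below are evaluated by the kernel, so they are written with recursors and with the
natural number operations that the kernel evaluates natively. -/

/-- The image of `x` under the map packed in `p`, four bits per value. -/
def image (p x : ℕ) : ℕ := Nat.mod (Nat.mod (Nat.shiftRight p (Nat.mul 4 x)) 16) 14

/-- Bit `k` of `P`. -/
def hasBit (P k : ℕ) : Bool := Nat.beq (Nat.mod (Nat.shiftRight P k) 2) 1

/-- A graph on fourteen vertices is packed into a mask whose bit `16 * v + w` is set iff `v` and `w`
are adjacent; `addEdge P v w` adds the edge `vw`. -/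
def addEdge (P v w : ℕ) : ℕ :=
  Nat.lor (Nat.lor P (Nat.shiftLeft 1 (Nat.add (Nat.mul 16 v) w)))
    (Nat.shiftLeft 1 (Nat.add (Nat.mul 16 w) v))

/-- The neighbours of `v`, as a bit set. -/
def row (P v : ℕ) : ℕ := Nat.mod (Nat.shiftRight P (Nat.mul 16 v)) 16384

/-- Clear the lowest set bit. -/
def dropBit (x : ℕ) : ℕ := Nat.land x (Nat.sub x 1)

/-- Whether `v` has at least three neighbours. -/
def saturated (P v : ℕ) : Bool := !Nat.beq (dropBit (dropBit (row P v))) 0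

/-- A partial cubic graph: its edges, the vertices that may still receive an edge, split into those
that already have one (`active`) and those that do not (`fresh`). -/
structure State where
  mask : ℕ
  active : List ℕ
  fresh : List ℕ

/-- Prepend `v` to `l` unless it is saturated. -/
def activate (P v : ℕ) (l : List ℕ) : List ℕ :=
  bif saturated P v then l else v :: l

/-- Delete all copies of `v` from `l`. -/
noncomputable def remove (v : ℕ) (l : List ℕ) : List ℕ :=
  List.rec [] (fun u _ r => bif Nat.beq u v then r else u :: r) l

/-- The state obtained by joining `v` to `w`. -/
def extend (P v : ℕ) (U F : List ℕ) (w : ℕ) : State :=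
  ⟨addEdge P v w, activate (addEdge P v w) v (activate (addEdge P v w) w U), F⟩

/-- The states obtained by joining `v` to one further vertex, prepended to `rest`; fresh vertices
are interchangeable, so only the first one is tried. -/
noncomputable def children (P v : ℕ) (U F : List ℕ) (rest : List State) : List State :=
  List.rec (List.rec rest (fun f F' _ => extend P v U F' f :: rest) F)
    (fun u _ r => bif hasBit P (Nat.add (Nat.mul 16 v) u) then r
      else extend P v (remove u U) F u :: r) U

/-- A pattern is a list of 21 edges packed into a number, eight bits per edge; these are the
positions of its edges. Shorter edge lists are padded by repetition. -/
def offsets : List ℕ :=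
  [0, 8, 16, 24, 32, 40, 48, 56, 64, 72, 80, 88, 96, 104, 112, 120, 128, 136, 144, 152, 160]

/-- The vertices. -/
def vertices : List ℕ := [0, 1, 2, 3, 4, 5, 6, 7, 8, 9, 10, 11, 12, 13]

/-- The edge of `q` at offset `k`, packed as `16 * v + w`. -/
def edge (q k : ℕ) : ℕ := Nat.mod (Nat.shiftRight q k) 256

/-- The mask of the graph whose edges are those of `q`. -/
noncomputable def maskOf (q : ℕ) : ℕ :=
  List.rec 0 (fun k _ r => addEdge r (Nat.div (edge q k) 16) (Nat.mod (edge q k) 16)) offsets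

/-- Whether `p` packs a permutation of the vertices. -/
noncomputable def isPerm (p : ℕ) : Bool :=
  Nat.beq (List.rec 0 (fun x _ r => Nat.lor r (Nat.shiftLeft 1 (image p x))) vertices) 16383

/-- Whether the permutation `p` maps every edge of `q` to an edge of `P`. -/
noncomputable def embeds (q p P : ℕ) : Bool :=
  isPerm p && List.rec true (fun k _ r =>
    bif hasBit P (Nat.add (Nat.mul 16 (image p (Nat.div (edge q k) 16)))
      (image p (Nat.mod (edge q k) 16))) then r else false) offsets

/-- Run at most `k` instructions of the script `t` on a stack of states, accepting once the stack is
empty. A hexadecimal digit `v < 14` replaces the top state by its extensions at `v`; any other digit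
discards the top state, because the pattern `find j`, with `j < i` in the next twelve bits, embeds
into it by the permutation in the following 56 bits. -/
noncomputable def run (find : ℕ → ℕ) (i : ℕ) (k : ℕ) : ℕ → List State → Bool :=
  Nat.rec (fun _ _ => false) (fun _ ih t l => List.rec true (fun s ss _ =>
    bif Nat.blt (Nat.mod t 16) 14 then
      bif saturated s.mask (Nat.mod t 16) then false
      else ih (Nat.div t 16) (children s.mask (Nat.mod t 16) (remove (Nat.mod t 16) s.active)
        (remove (Nat.mod t 16) s.fresh) ss)
    else bif Nat.blt (Nat.mod (Nat.div t 16) 4096) i then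
      bif embeds (find (Nat.mod (Nat.div t 16) 4096)) (Nat.shiftRight t 16) s.mask then
        ih (Nat.shiftRight t 72) ss
      else false
    else false) l) k

/-- The state with the edges of the pattern `q`. -/
noncomputable def initial (q : ℕ) : State :=
  let P := maskOf q
  ⟨P, vertices.filter fun v => !(saturated P v) && !Nat.beq (row P v) 0,
   vertices.filter fun v => Nat.beq (row P v) 0⟩

/-- Pattern number `j`: numbers below 576 refer to `leaves`, the others to `lemmas`. -/
def lookup (leaves : List (List ℕ)) (lemmas : List (List (ℕ × ℕ))) (j : ℕ) : ℕ :=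
  bif Nat.blt j 576 then (leaves.getD (j / 32) []).getD (j % 32) 17
  else ((lemmas.getD (j / 32 - 18) []).getD (j % 32) (17, 0)).1

/-- Check consecutive pairs of a pattern and a script, the first of them being number `i`: the
script shows that a graph containing the pattern contains one of lower number. -/
noncomputable def checkFrom (find : ℕ → ℕ) : ℕ → List (ℕ × ℕ) → Bool
  | _, [] => true
  | i, x :: l => run find i 1000 x.2 [initial x.1] && checkFrom find (i + 1) l

/-- Whether the edges of `q` at the offsets in `l` meet every vertex. -/
noncomputable def covers (q : ℕ) (l : List ℕ) : Bool :=
  Nat.beq (List.rec 0 (fun k _ r => Nat.lor r (Nat.lor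
    (Nat.shiftLeft 1 (Nat.div (edge q k) 16)) (Nat.shiftLeft 1 (Nat.mod (edge q k) 16)))) l) 16383

/-- Whether `q` is a graph on the fourteen vertices in which all of them are saturated. -/
noncomputable def isFull (q : ℕ) : Bool :=
  (offsets.all fun k => Nat.blt (Nat.div (edge q k) 16) 14 && Nat.blt (Nat.mod (edge q k) 16) 14) &&
    vertices.all (saturated (maskOf q))

/-- Whether the first, second and third seven edges of `q` are perfect matchings. -/
noncomputable def isColored (q : ℕ) : Bool :=
  covers q (offsets.take 7) && (covers q ((offsets.drop 7).take 7) && covers q (offsets.drop 14))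

/-- Row `i` of a packed matrix. -/
def block (Y i : ℕ) : ℕ := Nat.mod (Nat.shiftRight Y (Nat.mul 192 i)) (2 ^ 192)

/-- Multiply a packed matrix by the adjacency matrix of `q`. -/
noncomputable def step (q Y : ℕ) : ℕ :=
  List.rec 0 (fun k _ r => Nat.add r (Nat.add
    (Nat.shiftLeft (block Y (Nat.mod (edge q k) 16)) (Nat.mul 192 (Nat.div (edge q k) 16)))
    (Nat.shiftLeft (block Y (Nat.div (edge q k) 16)) (Nat.mul 192 (Nat.mod (edge q k) 16)))))
    offsets

/-- The trace of a packed matrix. -/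
noncomputable def packedTrace (Y : ℕ) : ℕ :=
  List.rec 0 (fun i _ r =>
    Nat.add r (Nat.mod (Nat.shiftRight (block Y i) (Nat.mul 12 i)) 4096)) vertices

/-- The traces of the packed matrix `Y` multiplied by the first `n` powers of the adjacency matrix
of `q`, 16 bits each. -/
noncomputable def traces (q n : ℕ) : ℕ → ℕ :=
  Nat.rec (fun _ => 0)
    (fun _ ih Y => Nat.add (packedTrace (step q Y)) (Nat.mul 65536 (ih (step q Y)))) n

/-- The packed identity matrix. -/
def packedOne : ℕ :=
  2145598717320425564049692314408758521201467959509591614848712183496418524794698321537346641687187840217253960254784055538856260940781346424877258569360705666242311423689510466690368264987779028597857174464964662881347550136197883636397392587783933593762882502345703684633435084253376642878399071807030110393312188093171651770360942421087799245517985896354465813430683296549053683803875141582459925402918653384745868382862693542415910983608058006416315092761881949285578786705972185900743028293314968623410530868725978252757928355382840943064319018828203291986725396799534448597381465235729251623117993293348817478755965901119478415076109809488871356048307863661183867952910168037259741739651661870788966655238134023961201718374178952876841151648194659491335306784474009286624525208957780432443670529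

/-- The traces of the first seven powers of the adjacency matrix of `q`. -/
noncomputable def key (q : ℕ) : ℕ :=
  traces q 7 packedOne

/-! ### Masks and lists -/

theorem hasBit_eq_testBit (P k : ℕ) : hasBit P k = P.testBit k := by
  rw [Nat.testBit_eq_decide_div_mod_eq, ← Nat.shiftRight_eq_div_pow]
  refine Bool.eq_iff_iff.mpr ?_
  rw [decide_eq_true_iff]
  exact Nat.beq_eq ▸ Iff.rfl

theorem edge_lt (q k : ℕ) : edge q k < 256 := Nat.mod_lt _ (by norm_num)

theorem image_lt (p x : ℕ) : image p x < 14 := Nat.mod_lt _ (by norm_num)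

theorem testBit_row (P v b : ℕ) :
    (row P v).testBit b = (decide (b < 14) && P.testBit (16 * v + b)) := by
  have h : row P v = (P >>> (16 * v)) % 2 ^ 14 := rfl
  rw [h, Nat.testBit_mod_two_pow, Nat.testBit_shiftRight]

theorem testBit_addEdge (P v w k : ℕ) : (addEdge P v w).testBit k = true ↔
    P.testBit k = true ∨ 16 * v + w = k ∨ 16 * w + v = k := by
  have h : addEdge P v w = (P ||| 1 <<< (16 * v + w)) ||| 1 <<< (16 * w + v) := rfl
  simp [h, Nat.one_shiftLeft, Nat.testBit_or, Nat.testBit_two_pow, or_assoc]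

theorem testBit_addEdge_pair {P v w a b : ℕ} (hv : v < 16) (hw : w < 16) (hb : b < 16) :
    (addEdge P v w).testBit (16 * a + b) = true ↔
      P.testBit (16 * a + b) = true ∨ (a = v ∧ b = w) ∨ (a = w ∧ b = v) := by
  rw [testBit_addEdge]
  refine or_congr_right (or_congr ?_ ?_) <;> omega

theorem exists_testBit_dropBit {x : ℕ} (hx : x ≠ 0) : ∃ m, x.testBit m = true ∧
    ∀ j, (dropBit x).testBit j = true ↔ x.testBit j = true ∧ j ≠ m := by
  obtain ⟨m, y, hy, rfl⟩ := Nat.exists_eq_two_pow_mul_odd hx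
  obtain ⟨z, rfl⟩ := hy
  have h2 : 0 < 2 ^ m := by positivity
  have hd : dropBit (2 ^ m * (2 * z + 1)) =
      (2 ^ m * (2 * z + 1)) &&& (2 ^ m * (2 * z) + (2 ^ m - 1)) := by
    change _ &&& (2 ^ m * (2 * z + 1) - 1) = _
    rw [Nat.mul_add, Nat.mul_one]
    congr 1
    omega
  have hlt : 2 ^ m - 1 < 2 ^ m := by omega
  have hodd : (2 * z + 1).testBit 0 = true := by simp
  refine ⟨m, by rw [Nat.testBit_two_pow_mul]; simp, fun j => ?_⟩
  rw [hd, Nat.testBit_and, Nat.testBit_two_pow_mul_add _ hlt, Nat.testBit_two_pow_mul]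
  rcases lt_trichotomy j m with hj | rfl | hj
  · simp [hj, hj.not_ge]
  · simp
  · obtain ⟨n, rfl⟩ : ∃ n, j = m + (n + 1) := ⟨j - m - 1, by omega⟩
    have h : ¬ m + (n + 1) < m := by omega
    simp [h, Nat.testBit_succ, Nat.mul_add_div]

theorem dropBit_zero : dropBit 0 = 0 := rfl

theorem saturated_iff {P v : ℕ} : saturated P v = true ↔ dropBit (dropBit (row P v)) ≠ 0 := by
  unfold saturated
  rw [Bool.not_eq_true', ← Bool.not_eq_true, Nat.beq_eq]

theorem saturated_iff_exists {P v : ℕ} : saturated P v = true ↔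
    ∃ a b c, a < 14 ∧ b < 14 ∧ c < 14 ∧ a ≠ b ∧ a ≠ c ∧ b ≠ c ∧ P.testBit (16 * v + a) = true ∧
      P.testBit (16 * v + b) = true ∧ P.testBit (16 * v + c) = true := by
  have hrow : ∀ j, (row P v).testBit j = true ↔ j < 14 ∧ P.testBit (16 * v + j) = true := by
    simp [testBit_row]
  rw [saturated_iff]
  constructor
  · intro h
    have h1 : dropBit (row P v) ≠ 0 := fun h0 => h (by simp [h0, dropBit_zero])
    have h0 : row P v ≠ 0 := fun h0 => h1 (by simp [h0, dropBit_zero])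
    obtain ⟨a, ha, ha'⟩ := exists_testBit_dropBit h0
    obtain ⟨b, hb, hb'⟩ := exists_testBit_dropBit h1
    obtain ⟨c, hc⟩ := Nat.exists_testBit_of_ne_zero h
    obtain ⟨hc, hcb⟩ := (hb' c).mp hc
    obtain ⟨hc, hca⟩ := (ha' c).mp hc
    obtain ⟨hb, hba⟩ := (ha' b).mp hb
    rw [hrow] at ha hb hc
    exact ⟨a, b, c, ha.1, hb.1, hc.1, hba.symm, hca.symm, hcb.symm, ha.2, hb.2, hc.2⟩
  · rintro ⟨a, b, c, ha, hb, hc, hab, hac, hbc, hPa, hPb, hPc⟩ h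
    have hPa := (hrow a).mpr ⟨ha, hPa⟩
    have hPb := (hrow b).mpr ⟨hb, hPb⟩
    have hPc := (hrow c).mpr ⟨hc, hPc⟩
    have h0 : row P v ≠ 0 := fun h0 => by simp [h0] at hPa
    obtain ⟨m, -, hm⟩ := exists_testBit_dropBit h0
    have h1 : dropBit (row P v) ≠ 0 := fun h1 => by
      simp only [h1, Nat.zero_testBit, Bool.false_eq_true, false_iff, not_and_not_right] at hm
      exact hab ((hm a hPa).trans (hm b hPb).symm)
    obtain ⟨n, -, hn⟩ := exists_testBit_dropBit h1
    simp only [h, Nat.zero_testBit, Bool.false_eq_true, false_iff, not_and_not_right, hm,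
      and_imp] at hn
    have := hn a hPa
    have := hn b hPb
    have := hn c hPc
    omega

theorem exists_of_not_saturated {P v : ℕ} (h : ¬ saturated P v = true) :
    ∃ m n, ∀ a < 14, P.testBit (16 * v + a) = true → a = m ∨ a = n := by
  by_contra! hc
  obtain ⟨a, ha, hPa, -⟩ := hc 0 0
  obtain ⟨b, hb, hPb, hba, -⟩ := hc a a
  obtain ⟨c, hc', hPc, hca, hcb⟩ := hc a b
  exact h (saturated_iff_exists.mpr
    ⟨a, b, c, ha, hb, hc', hba.symm, hca.symm, hcb.symm, hPa, hPb, hPc⟩)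

theorem saturated_addEdge {P v w x : ℕ} (h : saturated P x = true) :
    saturated (addEdge P v w) x = true := by
  rw [saturated_iff_exists] at h ⊢
  obtain ⟨a, b, c, ha, hb, hc, hab, hac, hbc, hPa, hPb, hPc⟩ := h
  exact ⟨a, b, c, ha, hb, hc, hab, hac, hbc, by simp [testBit_addEdge, hPa],
    by simp [testBit_addEdge, hPb], by simp [testBit_addEdge, hPc]⟩

theorem mem_activate {P v u : ℕ} {l : List ℕ} :
    u ∈ activate P v l ↔ (u = v ∧ ¬ saturated P v = true) ∨ u ∈ l := by
  unfold activate
  cases saturated P v <;> simp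

theorem remove_eq_filter (v : ℕ) (l : List ℕ) : remove v l = l.filter (· ≠ v) := by
  induction l with
  | nil => rfl
  | cons u l ih =>
    have : remove v (u :: l) = bif Nat.beq u v then remove v l else u :: remove v l := rfl
    rw [this, ih]
    cases h : Nat.beq u v
    · simp [Nat.ne_of_beq_eq_false h]
    · simp [Nat.eq_of_beq_eq_true h]

theorem mem_children {P v : ℕ} {U F : List ℕ} {rest : List State} {s : State} :
    s ∈ children P v U F rest ↔
      (∃ u ∈ U, ¬ P.testBit (16 * v + u) = true ∧ s = extend P v (remove u U) F u) ∨
      (∃ f F', F = f :: F' ∧ s = extend P v U F' f) ∨ s ∈ rest := by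
  suffices h : ∀ l : List ℕ,
      s ∈ (List.rec (List.rec rest (fun f F' _ => extend P v U F' f :: rest) F)
      (fun u _ r => bif hasBit P (Nat.add (Nat.mul 16 v) u) then r
        else extend P v (remove u U) F u :: r) l : List State) ↔
      (∃ u ∈ l, ¬ P.testBit (16 * v + u) = true ∧ s = extend P v (remove u U) F u) ∨
      (∃ f F', F = f :: F' ∧ s = extend P v U F' f) ∨ s ∈ rest from h U
  intro l
  induction l with
  | nil => cases F <;> simp
  | cons u l ih =>
    have hu : hasBit P (Nat.add (Nat.mul 16 v) u) = P.testBit (16 * v + u) := hasBit_eq_testBit ..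
    simp only [List.mem_cons, exists_eq_or_imp, or_assoc, ← ih]
    rw [hu]
    cases P.testBit (16 * v + u) <;> simp

/-- The edges of the pattern packed in `q` are symmetric adjacencies of its mask. -/
theorem testBit_maskOf {q a b : ℕ} (hb : b < 16) :
    (maskOf q).testBit (16 * a + b) = true ↔ ∃ k ∈ offsets,
      (a = edge q k / 16 ∧ b = edge q k % 16) ∨ (a = edge q k % 16 ∧ b = edge q k / 16) := by
  unfold maskOf
  induction offsets with
  | nil => simp
  | cons k l ih =>
    have h1 : edge q k / 16 < 16 := Nat.div_lt_of_lt_mul (edge_lt q k)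
    have h2 : edge q k % 16 < 16 := Nat.mod_lt _ (by norm_num)
    simp only [List.mem_cons, exists_eq_or_imp, ← ih]
    rw [or_comm]
    exact testBit_addEdge_pair h1 h2 hb

theorem testBit_maskOf_symm {q a b : ℕ} (ha : a < 16) (hb : b < 16) :
    (maskOf q).testBit (16 * a + b) = true ↔ (maskOf q).testBit (16 * b + a) = true := by
  rw [testBit_maskOf hb, testBit_maskOf ha]
  simp only [and_comm, or_comm]

/-! ### Soundness of the search -/

/-- `σ` labels the vertices by `0, …, 13`. -/
def Labels (σ : ℕ → Fin 14) : Prop := Set.BijOn σ (Set.Iio 14) Set.univ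

/-- Every bit of the mask `P` is an edge of `G` under the labelling `σ`. -/
def Realizes (G : SimpleGraph (Fin 14)) (σ : ℕ → Fin 14) (P : ℕ) : Prop :=
  ∀ a < 14, ∀ b < 14, P.testBit (16 * a + b) = true → G.Adj (σ a) (σ b)

/-- The pattern packed in `q` is a subgraph of `G` under the labelling `σ`. -/
def Embeds (G : SimpleGraph (Fin 14)) (q : ℕ) (σ : ℕ → Fin 14) : Prop :=
  ∀ k ∈ offsets, G.Adj (σ (edge q k / 16)) (σ (edge q k % 16))

/-- No labelling embeds the pattern packed in `q` into `G`. -/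
def Excludes (G : SimpleGraph (Fin 14)) (q : ℕ) : Prop :=
  ∀ σ, Labels σ → ¬ Embeds G q σ

theorem Labels.ne {σ : ℕ → Fin 14} (hσ : Labels σ) {a b : ℕ} (ha : a < 14) (hb : b < 14)
    (h : a ≠ b) : σ a ≠ σ b := fun he => h (hσ.injOn ha hb he)

theorem Labels.exists_eq {σ : ℕ → Fin 14} (hσ : Labels σ) (y : Fin 14) : ∃ a < 14, σ a = y :=
  hσ.surjOn (Set.mem_univ y)

theorem Labels.comp {σ : ℕ → Fin 14} (hσ : Labels σ) {f : ℕ → ℕ}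
    (hf : Set.BijOn f (Set.Iio 14) (Set.Iio 14)) : Labels (σ ∘ f) :=
  Set.BijOn.comp hσ hf

theorem exists_adj_of_not_saturated {G : SimpleGraph (Fin 14)}
    (hG : ∀ v, (G.neighborSet v).ncard = 3) {σ : ℕ → Fin 14} (hσ : Labels σ) {P v : ℕ}
    (h : ¬ saturated P v = true) :
    ∃ x < 14, G.Adj (σ v) (σ x) ∧ ¬ P.testBit (16 * v + x) = true := by
  by_contra! hc
  obtain ⟨m, n, hmn⟩ := exists_of_not_saturated h
  have hsub : G.neighborSet (σ v) ⊆ {σ m, σ n} := by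
    intro y hy
    obtain ⟨x, hx, rfl⟩ := hσ.exists_eq y
    rcases hmn x hx (hc x hx hy) with rfl | rfl <;> simp
  have := (Set.ncard_le_ncard hsub (Set.toFinite _)).trans (Set.ncard_insert_le _ _)
  rw [hG, Set.ncard_singleton] at this
  omega

theorem Realizes.testBit_of_adj {G : SimpleGraph (Fin 14)}
    (hG : ∀ v, (G.neighborSet v).ncard = 3) {σ : ℕ → Fin 14} (hσ : Labels σ) {P v x : ℕ}
    (hr : Realizes G σ P) (hv : v < 14) (hx : x < 14) (h : saturated P v = true)
    (ha : G.Adj (σ v) (σ x)) : P.testBit (16 * v + x) = true := by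
  obtain ⟨a, b, c, ha', hb, hc, hab, hac, hbc, hPa, hPb, hPc⟩ := saturated_iff_exists.mp h
  have hsub : ({σ a, σ b, σ c} : Set (Fin 14)) ⊆ G.neighborSet (σ v) := by
    rintro y (rfl | rfl | rfl)
    exacts [hr v hv a ha' hPa, hr v hv b hb hPb, hr v hv c hc hPc]
  have hcard : ({σ a, σ b, σ c} : Set (Fin 14)).ncard = 3 :=
    Set.ncard_eq_three.mpr
      ⟨_, _, _, hσ.ne ha' hb hab, hσ.ne ha' hc hac, hσ.ne hb hc hbc, rfl⟩
  have heq := Set.eq_of_subset_of_ncard_le hsub (by rw [hG, hcard]) (Set.toFinite _)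
  have hmem : σ x ∈ ({σ a, σ b, σ c} : Set (Fin 14)) := heq ▸ ha
  rcases hmem with hm | hm | hm
  · exact hσ.injOn hx ha' hm ▸ hPa
  · exact hσ.injOn hx hb hm ▸ hPb
  · exact hσ.injOn hx hc hm ▸ hPc

/-- The invariant of the search: `active` and `fresh` list the unsaturated vertices, and those in
`fresh` are isolated. -/
structure Valid (s : State) : Prop where
  symm : ∀ a < 14, ∀ b < 14, s.mask.testBit (16 * a + b) = true →
    s.mask.testBit (16 * b + a) = true
  lt : ∀ x, x ∈ s.active ∨ x ∈ s.fresh → x < 14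
  cover : ∀ x < 14, x ∈ s.active ∨ x ∈ s.fresh ∨ saturated s.mask x = true
  isolated : ∀ x ∈ s.fresh, ∀ b < 14, ¬ s.mask.testBit (16 * x + b) = true
  nodup : s.fresh.Nodup
  disjoint : ∀ x ∈ s.active, x ∉ s.fresh

theorem valid_extend {P v w : ℕ} {U F : List ℕ} (hv : v < 14) (hw : w < 14)
    (symm : ∀ a < 14, ∀ b < 14, P.testBit (16 * a + b) = true → P.testBit (16 * b + a) = true)
    (lt : ∀ x, x ∈ U ∨ x ∈ F → x < 14)
    (cover : ∀ x < 14, x = v ∨ x = w ∨ x ∈ U ∨ x ∈ F ∨ saturated P x = true)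
    (isolated : ∀ x ∈ F, ∀ b < 14, ¬ P.testBit (16 * x + b) = true)
    (nodup : F.Nodup) (hvF : v ∉ F) (hwF : w ∉ F) (disjoint : ∀ x ∈ U, x ∉ F) :
    Valid (extend P v U F w) where
  symm a ha b hb := by
    change (addEdge P v w).testBit _ = true → (addEdge P v w).testBit _ = true
    rw [testBit_addEdge_pair (by omega) (by omega) (by omega),
      testBit_addEdge_pair (by omega) (by omega) (by omega)]
    have := symm a ha b hb
    tauto
  lt x hx := by
    simp only [extend, mem_activate] at hx
    rcases hx with (h | h | h) | h
    exacts [h.1 ▸ hv, h.1 ▸ hw, lt x (.inl h), lt x (.inr h)]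
  cover x hx := by
    simp only [extend, mem_activate]
    rcases cover x hx with h | h | h | h | h
    · subst h
      tauto
    · subst h
      tauto
    · tauto
    · tauto
    · exact .inr (.inr (saturated_addEdge h))
  isolated x hx b hb := by
    change ¬ (addEdge P v w).testBit _ = true
    change x ∈ F at hx
    rw [testBit_addEdge_pair (by omega) (by omega) (by omega)]
    have := isolated x hx b hb
    rintro (h | ⟨rfl, -⟩ | ⟨rfl, -⟩) <;> contradiction
  nodup := nodup
  disjoint x hx := by
    simp only [extend, mem_activate] at hx ⊢
    rcases hx with h | h | h
    exacts [h.1 ▸ hvF, h.1 ▸ hwF, disjoint x h]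

theorem Valid.of_mem_children {s c : State} (hs : Valid s) {v : ℕ} (hv : v < 14)
    {rest : List State} (hrest : ∀ c ∈ rest, Valid c)
    (hc : c ∈ children s.mask v (remove v s.active) (remove v s.fresh) rest) : Valid c := by
  have hmem : ∀ x w l, x ∈ remove w l ↔ x ∈ l ∧ x ≠ w := by simp [remove_eq_filter]
  have hnd : (remove v s.fresh).Nodup := by
    rw [remove_eq_filter]
    exact hs.nodup.filter _
  rcases mem_children.mp hc with ⟨u, hu, -, rfl⟩ | ⟨f, F', hF, rfl⟩ | hc
  · rw [hmem] at hu
    refine valid_extend hv (hs.lt u (.inl hu.1)) hs.symm ?_ ?_ ?_ hnd ?_ ?_ ?_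
    · simp only [hmem]
      exact fun x hx => hs.lt x (by tauto)
    · intro x hx
      have := hs.cover x hx
      simp only [hmem]
      tauto
    · exact fun x hx => hs.isolated x ((hmem _ _ _).mp hx).1
    · simp [hmem]
    · simp only [hmem, not_and]
      exact fun h => absurd h (hs.disjoint u hu.1)
    · simp only [hmem, not_and]
      exact fun x hx h => absurd h (hs.disjoint x hx.1.1)
  · have hF' : ∀ x, x = f ∨ x ∈ F' ↔ x ∈ s.fresh ∧ x ≠ v := by
      intro x
      rw [← hmem, hF, List.mem_cons]
    rw [hF, List.nodup_cons] at hnd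
    have hf := (hF' f).mp (.inl rfl)
    have hsub : ∀ x ∈ F', x ∈ s.fresh ∧ x ≠ v := fun x hx => (hF' x).mp (.inr hx)
    refine valid_extend hv (hs.lt f (.inr hf.1)) hs.symm ?_ ?_ ?_ hnd.2 ?_ hnd.1 ?_
    · simp only [hmem]
      rintro x (hx | hx)
      exacts [hs.lt x (.inl hx.1), hs.lt x (.inr (hsub x hx).1)]
    · intro x hx
      have := hs.cover x hx
      have := hF' x
      simp only [hmem]
      tauto
    · exact fun x hx => hs.isolated x (hsub x hx).1
    · exact fun h => (hsub v h).2 rfl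
    · simp only [hmem]
      exact fun x hx h => hs.disjoint x hx.1 (hsub x h).1
  · exact hrest c hc

theorem realizes_addEdge {G : SimpleGraph (Fin 14)} {σ : ℕ → Fin 14} {P v w : ℕ} (hv : v < 14)
    (hw : w < 14) (hr : Realizes G σ P) (h : G.Adj (σ v) (σ w)) :
    Realizes G σ (addEdge P v w) := by
  intro a ha b hb hbit
  rw [testBit_addEdge_pair (by omega) (by omega) (by omega)] at hbit
  rcases hbit with hbit | ⟨rfl, rfl⟩ | ⟨rfl, rfl⟩
  exacts [hr a ha b hb hbit, h, h.symm]

theorem Valid.exists_mem_children {G : SimpleGraph (Fin 14)}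
    (hG : ∀ v, (G.neighborSet v).ncard = 3) {σ : ℕ → Fin 14} (hσ : Labels σ) {s : State}
    (hs : Valid s) (hr : Realizes G σ s.mask) {v : ℕ} (hv : v < 14)
    (h : ¬ saturated s.mask v = true) (rest : List State) :
    ∃ c ∈ children s.mask v (remove v s.active) (remove v s.fresh) rest,
      ∃ τ, Labels τ ∧ Realizes G τ c.mask := by
  obtain ⟨x, hx, hadj, hbit⟩ := exists_adj_of_not_saturated hG hσ h
  have hxv : x ≠ v := by
    rintro rfl
    exact G.loopless.irrefl _ hadj
  rcases hs.cover x hx with hU | hF | hsat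
  · refine ⟨_, mem_children.mpr (.inl ⟨x, ?_, hbit, rfl⟩), σ, hσ, realizes_addEdge hv hx hr hadj⟩
    simp [remove_eq_filter, hU, hxv]
  · have hxF : x ∈ remove v s.fresh := by simp [remove_eq_filter, hF, hxv]
    obtain ⟨f, F', hfF⟩ := List.exists_cons_of_ne_nil (List.ne_nil_of_mem hxF)
    have hf : f ∈ s.fresh ∧ f ≠ v := by
      have : f ∈ remove v s.fresh := by simp [hfF]
      simpa [remove_eq_filter] using this
    have hf14 := hs.lt f (.inr hf.1)
    have hfix : ∀ a < 14, ∀ b < 14, s.mask.testBit (16 * a + b) = true →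
        Equiv.swap f x a = a := fun a ha b hb hab =>
      Equiv.swap_apply_of_ne_of_ne (fun he => hs.isolated f hf.1 b hb (he ▸ hab))
        (fun he => hs.isolated x hF b hb (he ▸ hab))
    refine ⟨_, mem_children.mpr (.inr (.inl ⟨f, F', hfF, rfl⟩)), σ ∘ Equiv.swap f x,
      hσ.comp ?_, realizes_addEdge hv hf14 ?_ ?_⟩
    · refine ⟨fun a ha => ?_, (Equiv.injective _).injOn,
        fun a ha => ⟨Equiv.swap f x a, ?_, by simp⟩⟩
      all_goals
        simp only [Set.mem_Iio, Equiv.swap_apply_def] at ha ⊢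
        split_ifs <;> omega
    · intro a ha b hb hab
      simp only [Function.comp, hfix a ha b hb hab, hfix b hb a ha (hs.symm a ha b hb hab)]
      exact hr a ha b hb hab
    · simpa [Equiv.swap_apply_of_ne_of_ne hf.2.symm hxv.symm] using hadj
  · exact absurd (hs.symm x hx v hv (hr.testBit_of_adj hG hσ hx hv hsat hadj.symm)) hbit

theorem exists_image_of_isPerm {p : ℕ} (h : isPerm p = true) {t : ℕ} (ht : t < 14) :
    ∃ x < 14, image p x = t := by
  have hmem : ∀ (l : List ℕ) (t : ℕ), (List.rec 0 (fun x _ r => Nat.lor r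
      (Nat.shiftLeft 1 (image p x))) l : ℕ).testBit t = true → ∃ x ∈ l, image p x = t := by
    intro l t
    induction l with
    | nil => simp
    | cons x l ih =>
      intro h
      change (_ ||| 1 <<< image p x : ℕ).testBit t = true at h
      rw [Nat.testBit_or, Nat.one_shiftLeft, Nat.testBit_two_pow, Bool.or_eq_true,
        decide_eq_true_iff] at h
      rcases h with h | h
      · obtain ⟨y, hy, hyt⟩ := ih h
        exact ⟨y, List.mem_cons_of_mem _ hy, hyt⟩
      · exact ⟨x, List.mem_cons_self, h⟩
  obtain ⟨x, hx, hxt⟩ := hmem vertices t (by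
    rw [Nat.eq_of_beq_eq_true h]
    interval_cases t <;> rfl)
  have hlt : ∀ x ∈ vertices, x < 14 := by decide
  exact ⟨x, hlt x hx, hxt⟩

theorem bijOn_image {p : ℕ} (h : isPerm p = true) :
    Set.BijOn (image p) (Set.Iio 14) (Set.Iio 14) := by
  have hmaps : Set.MapsTo (image p) (Finset.Iio 14) (Finset.Iio 14) := fun x _ => by
    simpa using image_lt p x
  have hsurj : Set.SurjOn (image p) (Finset.Iio 14) (Finset.Iio 14) := fun t ht => by
    obtain ⟨x, hx, hxt⟩ := exists_image_of_isPerm h (by simpa using ht : t < 14)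
    exact ⟨x, by simpa using hx, hxt⟩
  have hinj := Finset.injOn_of_surjOn_of_card_le _ hmaps hsurj le_rfl
  rw [Finset.coe_Iio] at hmaps hsurj hinj
  exact ⟨hmaps, hinj, hsurj⟩

theorem Excludes.not_realizes {G : SimpleGraph (Fin 14)} {q p P : ℕ} (hq : Excludes G q)
    (h : embeds q p P = true) {σ : ℕ → Fin 14} (hσ : Labels σ) : ¬ Realizes G σ P := by
  intro hr
  rw [embeds, Bool.and_eq_true] at h
  refine hq _ (hσ.comp (bijOn_image h.1)) ?_
  replace h := h.2
  unfold Embeds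
  generalize offsets = l at h
  induction l with
  | nil => simp
  | cons k l ih =>
    rw [List.forall_mem_cons]
    have hk : hasBit P (16 * image p (edge q k / 16) + image p (edge q k % 16)) = true := by
      by_contra hc
      rw [Bool.not_eq_true] at hc
      change (bif hasBit P (16 * image p (edge q k / 16) + image p (edge q k % 16)) then _
        else false) = true at h
      simp [hc] at h
    change (bif hasBit P (16 * image p (edge q k / 16) + image p (edge q k % 16)) then _
      else false) = true at h
    rw [hk] at h
    rw [hasBit_eq_testBit] at hk
    exact ⟨hr _ (image_lt _ _) _ (image_lt _ _) hk, ih h⟩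

theorem not_realizes_of_run {G : SimpleGraph (Fin 14)} (hG : ∀ v, (G.neighborSet v).ncard = 3)
    {find : ℕ → ℕ} {i : ℕ} (hfind : ∀ j < i, Excludes G (find j)) (k : ℕ) :
    ∀ (t : ℕ) (l : List State), run find i k t l = true → (∀ s ∈ l, Valid s) →
      ∀ s ∈ l, ∀ σ, Labels σ → ¬ Realizes G σ s.mask := by
  induction k with
  | zero => exact fun t l h => absurd h Bool.false_ne_true
  | succ k ih =>
    rintro t (_ | ⟨s, l⟩) h hl
    · simp
    change (bif Nat.blt (t % 16) 14 then
      bif saturated s.mask (t % 16) then false else run find i k (t / 16)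
        (children s.mask (t % 16) (remove (t % 16) s.active) (remove (t % 16) s.fresh) l)
      else bif Nat.blt (t / 16 % 4096) i then
        bif embeds (find (t / 16 % 4096)) (t >>> 16) s.mask then run find i k (t >>> 72) l
        else false else false) = true at h
    rw [List.forall_mem_cons] at hl ⊢
    cases hv : Nat.blt (t % 16) 14
    · simp only [hv, cond_false] at h
      cases hj : Nat.blt (t / 16 % 4096) i
      · simp [hj] at h
      cases he : embeds (find (t / 16 % 4096)) (t >>> 16) s.mask
      · simp [hj, he] at h
      simp only [hj, he, cond_true] at h
      exact ⟨fun σ hσ => (hfind _ (Nat.blt_eq ▸ hj)).not_realizes he hσ, ih _ _ h hl.2⟩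
    · simp only [hv, cond_true] at h
      cases hs : saturated s.mask (t % 16)
      · simp only [hs, cond_false] at h
        have hv' : t % 16 < 14 := Nat.blt_eq ▸ hv
        have key := ih _ _ h fun c hc => hl.1.of_mem_children hv' hl.2 hc
        refine ⟨fun σ hσ hr => ?_, fun c hc => key c (mem_children.mpr (.inr (.inr hc)))⟩
        obtain ⟨c, hc, τ, hτ, hrτ⟩ :=
          hl.1.exists_mem_children hG hσ hr hv' (by simp [hs]) l
        exact key c hc τ hτ hrτ
      · simp [hs] at h

theorem valid_initial (q : ℕ) : Valid (initial q) where
  symm a ha b hb h := (testBit_maskOf_symm (by omega) (by omega)).mp h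
  lt x hx := by
    have hlt : ∀ x ∈ vertices, x < 14 := by decide
    simp only [initial, List.mem_filter] at hx
    exact hlt x (hx.elim And.left And.left)
  cover x hx := by
    have hmem : ∀ x < 14, x ∈ vertices := by decide
    simp only [initial, List.mem_filter, hmem x hx]
    cases saturated (maskOf q) x <;> cases Nat.beq (row (maskOf q) x) 0 <;> simp
  isolated x hx b hb h := by
    simp only [initial, List.mem_filter] at hx
    have hrow := testBit_row (maskOf q) x b
    rw [Nat.eq_of_beq_eq_true hx.2] at hrow
    have : (maskOf q).testBit (16 * x + b) = true := h
    simp [hb, this] at hrow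
  nodup := List.Nodup.filter _ (by decide)
  disjoint x hx := by
    simp only [initial, List.mem_filter] at hx ⊢
    simp_all

theorem Embeds.realizes {G : SimpleGraph (Fin 14)} {q : ℕ} {σ : ℕ → Fin 14}
    (h : Embeds G q σ) : Realizes G σ (maskOf q) := by
  intro a ha b hb hab
  rw [testBit_maskOf (by omega)] at hab
  obtain ⟨k, hk, ⟨rfl, rfl⟩ | ⟨rfl, rfl⟩⟩ := hab
  exacts [h k hk, (h k hk).symm]

theorem run_of_checkFrom {find : ℕ → ℕ} {l : List (ℕ × ℕ)} {i : ℕ}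
    (h : checkFrom find i l = true) (n : ℕ) (hn : n < l.length) :
    run find (i + n) 1000 l[n].2 [initial l[n].1] = true := by
  induction l generalizing i n with
  | nil => simp at hn
  | cons x l ih =>
    rw [checkFrom, Bool.and_eq_true] at h
    cases n with
    | zero => exact h.1
    | succ n =>
      have := ih h.2 n (by simpa using hn)
      rwa [show i + 1 + n = i + (n + 1) by omega] at this

theorem excludes_default (G : SimpleGraph (Fin 14)) : Excludes G 17 :=
  fun _ _ h => G.loopless.irrefl _ (h 0 (by decide))

/-- If no leaf embeds in `G`, then by the lemma table no pattern of the table does. -/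
theorem excludes_lookup {G : SimpleGraph (Fin 14)} (hG : ∀ v, (G.neighborSet v).ncard = 3)
    {leaves : List (List ℕ)} {lemmas : List (List (ℕ × ℕ))}
    (hlemmas : ∀ c, checkFrom (lookup leaves lemmas) (576 + 32 * c) (lemmas.getD c []) = true)
    (hleaves : ∀ q ∈ leaves.flatten, Excludes G q) (j : ℕ) :
    Excludes G (lookup leaves lemmas j) := by
  induction j using Nat.strong_induction_on with
  | _ j ih =>
  by_cases hj : j < 576
  · have hl : lookup leaves lemmas j = (leaves.getD (j / 32) []).getD (j % 32) 17 := by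
      have : Nat.blt j 576 = true := Nat.blt_eq.mpr hj
      simp [lookup, this]
    rw [hl]
    by_cases h1 : j / 32 < leaves.length
    · rw [List.getD_eq_getElem _ _ h1]
      by_cases h2 : j % 32 < leaves[j / 32].length
      · rw [List.getD_eq_getElem _ _ h2]
        exact hleaves _ (List.mem_flatten_of_mem (List.getElem_mem h1) (List.getElem_mem h2))
      · rw [List.getD_eq_default _ _ (by omega)]
        exact excludes_default G
    · rw [List.getD_eq_default _ [] (by omega)]
      exact excludes_default G
  · have hl : lookup leaves lemmas j =
        ((lemmas.getD (j / 32 - 18) []).getD (j % 32) (17, 0)).1 := by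
      have : Nat.blt j 576 = false := by
        rw [← Bool.not_eq_true, Nat.blt_eq]
        exact hj
      simp [lookup, this]
    by_cases hn : j % 32 < (lemmas.getD (j / 32 - 18) []).length
    · have hrun := run_of_checkFrom (hlemmas (j / 32 - 18)) (j % 32) hn
      rw [show 576 + 32 * (j / 32 - 18) + j % 32 = j by omega] at hrun
      rw [hl, List.getD_eq_getElem _ _ hn]
      intro σ hσ he
      exact not_realizes_of_run hG ih 1000 _ _ hrun (by simpa using valid_initial _) _
        List.mem_cons_self σ hσ he.realizes
    · rw [hl, List.getD_eq_default _ _ (by omega)]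
      exact excludes_default G

theorem exists_embeds {G : SimpleGraph (Fin 14)} (hG : ∀ v, (G.neighborSet v).ncard = 3)
    {leaves : List (List ℕ)} {lemmas : List (List (ℕ × ℕ))}
    (hlemmas : ∀ c, checkFrom (lookup leaves lemmas) (576 + 32 * c) (lemmas.getD c []) = true)
    {r : ℕ} (hr : ∀ k ∈ offsets, edge (lookup leaves lemmas r) k = 1) :
    ∃ q ∈ leaves.flatten, ∃ σ, Labels σ ∧ Embeds G q σ := by
  by_contra! hc
  have hex := excludes_lookup hG hlemmas (fun q hq σ hσ => hc q hq σ hσ) r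
  obtain ⟨y, hy⟩ : (G.neighborSet 0).Nonempty := by
    rw [← Set.ncard_pos, hG]
    norm_num
  have hlab : Labels (fun n => Equiv.swap 1 y (Fin.ofNat 14 n)) := by
    refine Set.BijOn.comp (t := Set.univ) (Equiv.bijective _).bijOn_univ
      ⟨Set.mapsTo_univ _ _, fun a ha b hb h => ?_, fun a _ => ⟨a, a.2, by simp⟩⟩
    simpa [Fin.ext_iff, Nat.mod_eq_of_lt ha, Nat.mod_eq_of_lt hb] using h
  refine hex _ hlab fun k hk => ?_
  have hy0 : (0 : Fin 14) ≠ y := fun h => G.loopless.irrefl _ (h ▸ hy : G.Adj 0 0)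
  have h0 : Equiv.swap 1 y (0 : Fin 14) = 0 :=
    Equiv.swap_apply_of_ne_of_ne (by decide) hy0
  have h1 : Equiv.swap 1 y (1 : Fin 14) = y := Equiv.swap_apply_left 1 y
  rw [hr k hk]
  change G.Adj (Equiv.swap 1 y 0) (Equiv.swap 1 y 1)
  rw [h0, h1]
  exact hy

/-! ### Colorings of patterns -/

/-- The head of the edge of `q` at offset `k`, as a vertex. -/
def head (q k : ℕ) : Fin 14 := Fin.ofNat 14 (edge q k / 16)

/-- The tail of the edge of `q` at offset `k`, as a vertex. -/
def tail (q k : ℕ) : Fin 14 := Fin.ofNat 14 (edge q k % 16)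

/-- `e` identifies the pattern packed in `q` with the graph `G`. -/
def Models (q : ℕ) (G : SimpleGraph (Fin 14)) (e : Fin 14 ≃ Fin 14) : Prop :=
  ∀ a b, G.Adj (e a) (e b) ↔
    ∃ k ∈ offsets, (a = head q k ∧ b = tail q k) ∨ (a = tail q k ∧ b = head q k)

theorem lt_of_isFull {q : ℕ} (h : isFull q = true) {k : ℕ} (hk : k ∈ offsets) :
    edge q k / 16 < 14 ∧ edge q k % 16 < 14 := by
  rw [isFull, Bool.and_eq_true, List.all_eq_true] at h
  have := h.1 k hk
  rw [Bool.and_eq_true, Nat.blt_eq, Nat.blt_eq] at this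
  exact this

theorem head_val {q : ℕ} (h : isFull q = true) {k : ℕ} (hk : k ∈ offsets) :
    (head q k : ℕ) = edge q k / 16 := Nat.mod_eq_of_lt (lt_of_isFull h hk).1

theorem tail_val {q : ℕ} (h : isFull q = true) {k : ℕ} (hk : k ∈ offsets) :
    (tail q k : ℕ) = edge q k % 16 := Nat.mod_eq_of_lt (lt_of_isFull h hk).2

theorem exists_models {G : SimpleGraph (Fin 14)} (hG : ∀ v, (G.neighborSet v).ncard = 3)
    {q : ℕ} (hq : isFull q = true) {σ : ℕ → Fin 14} (hσ : Labels σ) (h : Embeds G q σ) :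
    ∃ e, Models q G e := by
  have hinj : Function.Injective fun a : Fin 14 => σ a := fun a b hab =>
    Fin.ext (hσ.injOn a.2 b.2 hab)
  refine ⟨Equiv.ofBijective _ (Finite.injective_iff_bijective.mp hinj), fun a b => ?_⟩
  have hmem : ∀ x < 14, x ∈ vertices := by decide
  have hsat : saturated (maskOf q) a = true := by
    have hq' := hq
    rw [isFull, Bool.and_eq_true] at hq'
    exact List.all_eq_true.mp hq'.2 a (hmem a a.2)
  have hbit : G.Adj (σ a) (σ b) ↔ (maskOf q).testBit (16 * a + b) = true :=
    ⟨h.realizes.testBit_of_adj hG hσ a.2 b.2 hsat, h.realizes a a.2 b b.2⟩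
  rw [Equiv.ofBijective_apply, Equiv.ofBijective_apply, hbit, testBit_maskOf (by omega)]
  refine exists_congr fun k => and_congr_right fun hk => ?_
  simp only [Fin.ext_iff, head_val hq hk, tail_val hq hk]

theorem Models.iso {q : ℕ} {G H : SimpleGraph (Fin 14)} {e f : Fin 14 ≃ Fin 14}
    (hG : Models q G e) (hH : Models q H f) : Nonempty (G ≃g H) :=
  ⟨⟨e.symm.trans f, fun {a b} => by
    have := (hG (e.symm a) (e.symm b)).trans (hH (e.symm a) (e.symm b)).symm
    simpa using this.symm⟩⟩

theorem exists_of_covers {q : ℕ} {l : List ℕ} (h : covers q l = true) {t : ℕ} (ht : t < 14) :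
    ∃ k ∈ l, edge q k / 16 = t ∨ edge q k % 16 = t := by
  have hmem : ∀ (l : List ℕ) (t : ℕ), (List.rec 0 (fun k _ r => Nat.lor r (Nat.lor
      (Nat.shiftLeft 1 (Nat.div (edge q k) 16)) (Nat.shiftLeft 1 (Nat.mod (edge q k) 16)))) l :
        ℕ).testBit t = true → ∃ k ∈ l, edge q k / 16 = t ∨ edge q k % 16 = t := by
    intro l t
    induction l with
    | nil => simp
    | cons x l ih =>
      intro h
      change (_ ||| (1 <<< (edge q x / 16) ||| 1 <<< (edge q x % 16)) : ℕ).testBit t = true at h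
      simp only [Nat.testBit_or, Nat.one_shiftLeft, Nat.testBit_two_pow, Bool.or_eq_true,
        decide_eq_true_iff] at h
      rcases h with h | h
      · obtain ⟨y, hy, hyt⟩ := ih h
        exact ⟨y, List.mem_cons_of_mem _ hy, hyt⟩
      · exact ⟨x, List.mem_cons_self, h⟩
  refine hmem l t ?_
  rw [Nat.eq_of_beq_eq_true h]
  interval_cases t <;> rfl

/-- Seven edges covering all fourteen vertices form a perfect matching. -/
theorem eq_of_covers {q : ℕ} (hq : isFull q = true) {l : List ℕ} (hl : l ⊆ offsets)
    (hlen : l.length = 7) (h : covers q l = true) {x y : ℕ} (hx : x ∈ l) (hy : y ∈ l)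
    {v : Fin 14} (hvx : v = head q x ∨ v = tail q x) (hvy : v = head q y ∨ v = tail q y) :
    x = y := by
  let f : ℕ × Bool → Fin 14 := fun p => bif p.2 then head q p.1 else tail q p.1
  let s : Finset (ℕ × Bool) := l.toFinset ×ˢ Finset.univ
  have hsurj : Set.SurjOn f s (Finset.univ : Finset (Fin 14)) := by
    intro t _
    obtain ⟨k, hk, hkt | hkt⟩ := exists_of_covers h t.2
    · exact ⟨(k, true), by simpa [s] using hk, Fin.ext ((head_val hq (hl hk)).trans hkt)⟩
    · exact ⟨(k, false), by simpa [s] using hk, Fin.ext ((tail_val hq (hl hk)).trans hkt)⟩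
  have hcard : s.card ≤ (Finset.univ : Finset (Fin 14)).card := by
    have := l.toFinset_card_le
    simp only [s, Finset.card_product, Finset.card_univ, Fintype.card_bool, Fintype.card_fin]
    omega
  have hinj := Finset.injOn_of_surjOn_of_card_le f
    (fun _ _ => Finset.mem_coe.mpr (Finset.mem_univ _)) hsurj hcard
  have hex : ∀ z ∈ l, v = head q z ∨ v = tail q z → ∃ b, (z, b) ∈ (s : Set (ℕ × Bool)) ∧
      f (z, b) = v := by
    rintro z hz (hv | hv)
    · exact ⟨true, by simpa [s] using hz, hv.symm⟩
    · exact ⟨false, by simpa [s] using hz, hv.symm⟩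
  obtain ⟨b, hb, hbv⟩ := hex x hx hvx
  obtain ⟨c, hc, hcv⟩ := hex y hy hvy
  exact congrArg Prod.fst (hinj hb hc (hbv.trans hcv.symm))

theorem Models.colorable {q : ℕ} {G : SimpleGraph (Fin 14)} {e : Fin 14 ≃ Fin 14}
    (h : Models q G e) (hq : isFull q = true) (hc : isColored q = true) :
    G.lineGraph.Colorable 3 := by
  have hedge : ∀ x : G.edgeSet, ∃ k ∈ offsets,
      (x : Sym2 (Fin 14)) = s(e (head q k), e (tail q k)) := by
    rintro ⟨x, hx⟩
    induction x with
    | _ a b =>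
    obtain ⟨a, rfl⟩ := e.surjective a
    obtain ⟨b, rfl⟩ := e.surjective b
    obtain ⟨k, hk, ⟨rfl, rfl⟩ | ⟨rfl, rfl⟩⟩ := (h a b).mp hx
    exacts [⟨k, hk, rfl⟩, ⟨k, hk, Sym2.eq_swap⟩]
  choose k hk hek using hedge
  have hv : ∀ (x : G.edgeSet) (v : Fin 14), v ∈ (x : Sym2 (Fin 14)) →
      e.symm v = head q (k x) ∨ e.symm v = tail q (k x) := by
    intro x v hv
    rw [hek x, Sym2.mem_iff] at hv
    simpa [Equiv.symm_apply_eq] using hv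
  let color : ℕ → Fin 3 := fun n => if n < 56 then 0 else if n < 112 then 1 else 2
  have hgroup : ∀ c, ∃ l ⊆ offsets, l.length = 7 ∧ covers q l = true ∧
      ∀ n ∈ offsets, color n = c → n ∈ l := by
    rw [isColored, Bool.and_eq_true, Bool.and_eq_true] at hc
    intro c
    fin_cases c
    · exact ⟨_, by decide, by decide, hc.1, by decide⟩
    · exact ⟨_, by decide, by decide, hc.2.1, by decide⟩
    · exact ⟨_, by decide, by decide, hc.2.2, by decide⟩
  refine ⟨SimpleGraph.Coloring.mk (fun x => color (k x)) ?_⟩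
  intro x y hxy hcol
  obtain ⟨hne, v, hvx, hvy⟩ := SimpleGraph.lineGraph_adj_iff_exists.mp hxy
  obtain ⟨l, hl, hlen, hcov, hmem⟩ := hgroup (color (k x))
  have := eq_of_covers hq hl hlen hcov (hmem _ (hk x) rfl) (hmem _ (hk y) hcol.symm)
    (hv x v hvx) (hv y v hvy)
  exact hne (Subtype.ext ((hek x).trans (this ▸ (hek y).symm)))

theorem three_le_chromaticNumber_lineGraph {V : Type*} {G : SimpleGraph V} {v : V}
    (h : (G.neighborSet v).ncard = 3) : 3 ≤ G.lineGraph.chromaticNumber := by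
  let f : (⊤ : SimpleGraph (G.neighborSet v)) →g G.lineGraph :=
    { toFun := fun w => ⟨s(v, w), w.2⟩
      map_rel' := fun {a b} hab => by
        refine SimpleGraph.lineGraph_adj_iff_exists.mpr ⟨fun he => hab ?_, v, by simp, by simp⟩
        have he' : (a : V) = b ∨ v = b ∧ (a : V) = v := by simpa [Subtype.ext_iff] using he
        exact Subtype.ext (he'.elim id fun h => h.2.trans h.1) }
  have hfin : (G.neighborSet v).Finite := Set.finite_of_ncard_ne_zero (by omega)
  have := hfin.to_subtype
  have hle := SimpleGraph.chromaticNumber_mono_of_hom f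
  rw [SimpleGraph.chromaticNumber_top_eq_enat_card, ENat.card_eq_coe_natCard,
    Nat.card_coe_set_eq, h] at hle
  exact hle

/-! ### Traces of powers of the adjacency matrix -/

theorem sum_mul_pow_lt {B n : ℕ} {f : Fin n → ℕ} (h : ∀ i, f i < B) :
    ∑ i, f i * B ^ (i : ℕ) < B ^ n := by
  induction n with
  | zero => simp
  | succ n ih =>
    rw [Fin.sum_univ_castSucc, pow_succ]
    have h₁ := ih (fun i => h i.castSucc)
    have h₂ := Nat.mul_le_mul_right (B ^ n) (Nat.succ_le_of_lt (h (Fin.last n)))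
    simp only [Fin.val_castSucc, Fin.val_last]
    nlinarith

theorem sum_mul_pow_div_mod {B n : ℕ} {f : Fin n → ℕ} (h : ∀ i, f i < B) (i : Fin n) :
    (∑ j, f j * B ^ (j : ℕ)) / B ^ (i : ℕ) % B = f i := by
  induction n with
  | zero => exact i.elim0
  | succ n ih =>
    have hsum : ∑ j, f j * B ^ (j : ℕ) = f 0 + B * ∑ j : Fin n, f j.succ * B ^ (j : ℕ) := by
      rw [Fin.sum_univ_succ, Finset.mul_sum]
      simp [pow_succ, mul_comm, mul_left_comm]
    have hB : 0 < B := (Nat.zero_le _).trans_lt (h 0)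
    rw [hsum]
    cases i using Fin.cases with
    | zero => simp [Nat.mod_eq_of_lt (h 0)]
    | succ i =>
      rw [Fin.val_succ, pow_succ', ← Nat.div_div_eq_div_mul, Nat.add_mul_div_left _ _ hB,
        Nat.div_eq_of_lt (h 0), zero_add]
      exact ih (fun j => h j.succ) i

/-- A matrix of natural numbers packed row by row, 12 bits per entry and 192 bits per row. -/
def pack (M : Matrix (Fin 14) (Fin 14) ℕ) : ℕ :=
  ∑ i, (∑ j, M i j * 4096 ^ (j : ℕ)) * (2 ^ 192) ^ (i : ℕ)

theorem block_pack {M : Matrix (Fin 14) (Fin 14) ℕ} (h : ∀ i j, M i j < 4096) (i : Fin 14) :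
    block (pack M) i = ∑ j, M i j * 4096 ^ (j : ℕ) := by
  change (pack M >>> (192 * (i : ℕ))) % 2 ^ 192 = _
  rw [Nat.shiftRight_eq_div_pow, pow_mul]
  exact sum_mul_pow_div_mod (f := fun i => ∑ j, M i j * 4096 ^ (j : ℕ))
    (fun i => (sum_mul_pow_lt (h i)).trans (by norm_num)) i

theorem packedTrace_pack {M : Matrix (Fin 14) (Fin 14) ℕ} (h : ∀ i j, M i j < 4096) :
    packedTrace (pack M) = M.trace := by
  have hdigit : ∀ i : Fin 14, Nat.mod (Nat.shiftRight (block (pack M) i) (Nat.mul 12 i)) 4096 =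
      M i i := by
    intro i
    rw [block_pack h]
    change ((∑ j, M i j * 4096 ^ (j : ℕ)) >>> (12 * (i : ℕ))) % 4096 = _
    rw [Nat.shiftRight_eq_div_pow, pow_mul]
    exact sum_mul_pow_div_mod (h i) i
  have hsum : ∀ g : ℕ → ℕ, (List.rec 0 (fun i _ r => Nat.add r (g i)) vertices : ℕ) =
      ∑ i : Fin 14, g i := by
    intro g
    simp only [Fin.sum_univ_succ, vertices]
    simp
    ring
  rw [packedTrace, hsum, Matrix.trace]
  exact Finset.sum_congr rfl fun i _ => hdigit i

/-- The adjacency matrix of the multigraph whose edges sit at the offsets in `l`. -/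
def patternMatrix (q : ℕ) (l : List ℕ) : Matrix (Fin 14) (Fin 14) ℕ :=
  (l.map fun k => Matrix.single (head q k) (tail q k) 1 +
    Matrix.single (tail q k) (head q k) 1).sum

theorem patternMatrix_cons (q k : ℕ) (l : List ℕ) :
    patternMatrix q (k :: l) = (Matrix.single (head q k) (tail q k) 1 +
      Matrix.single (tail q k) (head q k) 1) + patternMatrix q l := by
  simp [patternMatrix]

theorem pack_add (M N : Matrix (Fin 14) (Fin 14) ℕ) : pack (M + N) = pack M + pack N := by
  simp [pack, add_mul, Finset.sum_add_distrib]

theorem pack_single_mul (a b : Fin 14) (M : Matrix (Fin 14) (Fin 14) ℕ) :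
    pack (Matrix.single a b 1 * M) = (∑ j, M b j * 4096 ^ (j : ℕ)) * (2 ^ 192) ^ (a : ℕ) := by
  rw [pack, Finset.sum_eq_single a]
  · simp
  · intro i _ hi
    simp [Matrix.single_mul_apply_of_ne, hi]
  · simp

theorem step_pack {q : ℕ} (hq : isFull q = true) {M : Matrix (Fin 14) (Fin 14) ℕ}
    (h : ∀ i j, M i j < 4096) : step q (pack M) = pack (patternMatrix q offsets * M) := by
  have hrec : ∀ l ⊆ offsets, (List.rec 0 (fun k _ r => Nat.add r (Nat.add
      (Nat.shiftLeft (block (pack M) (Nat.mod (edge q k) 16)) (Nat.mul 192 (Nat.div (edge q k) 16)))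
      (Nat.shiftLeft (block (pack M) (Nat.div (edge q k) 16))
        (Nat.mul 192 (Nat.mod (edge q k) 16))))) l : ℕ) = pack (patternMatrix q l * M) := by
    intro l hl
    induction l with
    | nil => simp [patternMatrix, pack]
    | cons k l ih =>
      have hk : k ∈ offsets := hl List.mem_cons_self
      rw [patternMatrix_cons, add_mul, pack_add, add_mul, pack_add, pack_single_mul,
        pack_single_mul, ← ih (fun _ hx => hl (List.mem_cons_of_mem _ hx)), ← block_pack h,
        ← block_pack h, head_val hq hk, tail_val hq hk, ← pow_mul, ← pow_mul,
        ← Nat.shiftLeft_eq, ← Nat.shiftLeft_eq]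
      exact Nat.add_comm _ _
  exact hrec offsets fun _ hx => hx

theorem sum_patternMatrix (q : ℕ) (l : List ℕ) :
    ∑ a, ∑ b, patternMatrix q l a b = 2 * l.length := by
  have hsingle : ∀ a b : Fin 14, ∑ i, ∑ j, Matrix.single a b (1 : ℕ) i j = 1 := by
    intro a b
    simp [Matrix.single_apply, ite_and]
  induction l with
  | nil => simp [patternMatrix]
  | cons k l ih =>
    simp only [patternMatrix_cons, Matrix.add_apply, Finset.sum_add_distrib, hsingle, ih,
      List.length_cons]
    ring

theorem one_le_patternMatrix {q : ℕ} {a b : Fin 14} {l : List ℕ} {k : ℕ} (hk : k ∈ l)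
    (h : (a = head q k ∧ b = tail q k) ∨ (a = tail q k ∧ b = head q k)) :
    1 ≤ patternMatrix q l a b := by
  induction hk with
  | head l =>
    rw [patternMatrix_cons]
    rcases h with ⟨rfl, rfl⟩ | ⟨rfl, rfl⟩ <;> simp <;> omega
  | tail x _ ih =>
    rw [patternMatrix_cons]
    exact ih.trans (Nat.le_add_left _ _)

open Classical in
theorem sum_ite_adj {G : SimpleGraph (Fin 14)} (hG : ∀ v, (G.neighborSet v).ncard = 3)
    (e : Fin 14 ≃ Fin 14) (a : Fin 14) : ∑ b, (if G.Adj (e a) (e b) then 1 else 0) = 3 := by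
  rw [e.sum_comp (fun b => if G.Adj (e a) b then 1 else 0), ← hG (e a), Finset.sum_boole,
    Set.ncard_eq_toFinset_card', Nat.cast_id]
  congr 1
  ext b
  simp

open Classical in
theorem Models.patternMatrix_apply {q : ℕ} {G : SimpleGraph (Fin 14)} {e : Fin 14 ≃ Fin 14}
    (hG : ∀ v, (G.neighborSet v).ncard = 3) (h : Models q G e) (a b : Fin 14) :
    patternMatrix q offsets a b = if G.Adj (e a) (e b) then 1 else 0 := by
  have hle : ∀ x ∈ (Finset.univ : Finset (Fin 14 × Fin 14)),
      (if G.Adj (e x.1) (e x.2) then 1 else 0) ≤ patternMatrix q offsets x.1 x.2 := by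
    rintro ⟨a, b⟩ _
    split_ifs with hab
    · obtain ⟨k, hk, hkab⟩ := (h a b).mp hab
      exact one_le_patternMatrix hk hkab
    · exact Nat.zero_le _
  have hsum := (Finset.sum_eq_sum_iff_of_le hle).mp (by
    rw [Fintype.sum_prod_type, Fintype.sum_prod_type, sum_patternMatrix]
    simp only [sum_ite_adj hG e]
    rfl)
  exact (hsum (a, b) (Finset.mem_univ _)).symm

theorem Models.pow_lt {q : ℕ} {G : SimpleGraph (Fin 14)} {e : Fin 14 ≃ Fin 14}
    (hG : ∀ v, (G.neighborSet v).ncard = 3) (h : Models q G e) {m : ℕ} (hm : m ≤ 7) (i j : Fin 14) :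
    (patternMatrix q offsets ^ m) i j < 4096 := by
  have hpow : ∀ (m : ℕ) (i : Fin 14), (patternMatrix q offsets ^ m) i j ≤ 3 ^ m := by
    intro m
    induction m with
    | zero => intro i; simp only [pow_zero, Matrix.one_apply]; split_ifs <;> simp
    | succ m ih =>
      intro i
      rw [pow_succ', pow_succ', Matrix.mul_apply]
      refine le_of_le_of_eq (b := ∑ k, patternMatrix q offsets i k * 3 ^ m)
        (Finset.sum_le_sum fun k _ => ?_) ?_
      swap
      · simp only [← Finset.sum_mul, h.patternMatrix_apply hG, sum_ite_adj hG]
      exact Nat.mul_le_mul_left _ (ih k)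
  exact (hpow m i).trans_lt ((Nat.pow_le_pow_right (by norm_num) hm).trans_lt (by norm_num))

theorem pack_one : pack (1 : Matrix (Fin 14) (Fin 14) ℕ) = packedOne := by
  simp [pack, packedOne, Matrix.one_apply, Fin.sum_univ_succ]

theorem traces_zero (q Y : ℕ) : traces q 0 Y = 0 := rfl

theorem traces_succ (q n Y : ℕ) : traces q (n + 1) Y =
    packedTrace (step q Y) + 65536 * traces q n (step q Y) := rfl

theorem Models.step_pack_pow {q : ℕ} {G : SimpleGraph (Fin 14)} {e : Fin 14 ≃ Fin 14}
    (hG : ∀ v, (G.neighborSet v).ncard = 3) (hq : isFull q = true) (h : Models q G e) {m : ℕ}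
    (hm : m ≤ 7) :
    step q (pack (patternMatrix q offsets ^ m)) = pack (patternMatrix q offsets ^ (m + 1)) := by
  rw [step_pack hq (h.pow_lt hG hm), pow_succ']

theorem Models.traces_eq {q r : ℕ} {G H : SimpleGraph (Fin 14)} {e f : Fin 14 ≃ Fin 14}
    (hG : ∀ v, (G.neighborSet v).ncard = 3) (hH : ∀ v, (H.neighborSet v).ncard = 3)
    (hq : isFull q = true) (hr : isFull r = true) (hqG : Models q G e) (hrH : Models r H f)
    (htr : ∀ m, (patternMatrix q offsets ^ m).trace = (patternMatrix r offsets ^ m).trace)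
    (n m : ℕ) (hnm : n + m ≤ 7) : traces q n (pack (patternMatrix q offsets ^ m)) =
      traces r n (pack (patternMatrix r offsets ^ m)) := by
  induction n generalizing m with
  | zero => rw [traces_zero, traces_zero]
  | succ n ih =>
    rw [traces_succ, traces_succ, hqG.step_pack_pow hG hq (by omega),
      hrH.step_pack_pow hH hr (by omega), packedTrace_pack (hqG.pow_lt hG (by omega)),
      packedTrace_pack (hrH.pow_lt hH (by omega)), htr, ih (m + 1) (by omega)]

theorem Models.key_eq {q r : ℕ} {G H : SimpleGraph (Fin 14)} {e f : Fin 14 ≃ Fin 14}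
    (hG : ∀ v, (G.neighborSet v).ncard = 3) (hH : ∀ v, (H.neighborSet v).ncard = 3)
    (hq : isFull q = true) (hr : isFull r = true) (hqG : Models q G e) (hrH : Models r H f)
    (htr : ∀ m, (patternMatrix q offsets ^ m).trace = (patternMatrix r offsets ^ m).trace) :
    key q = key r := by
  have := hqG.traces_eq hG hH hq hr hrH htr 7 0 le_rfl
  rw [pow_zero, pow_zero, pack_one] at this
  exact this

theorem trace_pow_eq_of_charpoly_eq {n : Type*} [Fintype n] [DecidableEq n] {A B : Matrix n n ℝ}
    (hA : A.IsHermitian) (hB : B.IsHermitian) (h : A.charpoly = B.charpoly) (m : ℕ) :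
    (A ^ m).trace = (B ^ m).trace := by
  have htr : ∀ {A : Matrix n n ℝ} (hA : A.IsHermitian),
      (A ^ m).trace = ∑ i, hA.eigenvalues i ^ m := by
    intro A hA
    conv_lhs => rw [hA.spectral_theorem]
    rw [← map_pow, Matrix.diagonal_pow, Unitary.conjStarAlgAut_apply, Matrix.trace_mul_cycle,
      Unitary.coe_star_mul_self, one_mul, Matrix.trace_diagonal]
    rfl
  rw [htr hA, htr hB, (Matrix.IsHermitian.eigenvalues_eq_eigenvalues_iff hA hB).mpr h]

theorem Models.map_patternMatrix {q : ℕ} {G : SimpleGraph (Fin 14)} {e : Fin 14 ≃ Fin 14}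
    (hG : ∀ v, (G.neighborSet v).ncard = 3) (h : Models q G e) :
    (patternMatrix q offsets).map (Nat.castRingHom ℝ) =
      Matrix.reindex e.symm e.symm (adjMat G) := by
  ext a b
  rw [Matrix.map_apply, h.patternMatrix_apply hG]
  simp [adjMat, SimpleGraph.adjMatrix_apply]

theorem Models.trace_pow_eq {q r : ℕ} {G H : SimpleGraph (Fin 14)} {e f : Fin 14 ≃ Fin 14}
    (hG : ∀ v, (G.neighborSet v).ncard = 3) (hH : ∀ v, (H.neighborSet v).ncard = 3)
    (hqG : Models q G e) (hrH : Models r H f)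
    (h : (adjMat G).charpoly = (adjMat H).charpoly) (m : ℕ) :
    (patternMatrix q offsets ^ m).trace = (patternMatrix r offsets ^ m).trace := by
  have hsymm : ∀ (K : SimpleGraph (Fin 14)) (g : Fin 14 ≃ Fin 14),
      (Matrix.reindex g g (adjMat K)).IsHermitian := by
    intro K g
    ext a b
    simp only [adjMat, Matrix.conjTranspose_apply, Matrix.reindex_apply, Matrix.submatrix_apply,
      SimpleGraph.adjMatrix_apply, star_trivial]
    split_ifs with h₁ h₂ h₂
    exacts [rfl, absurd h₁.symm h₂, absurd h₂.symm h₁, rfl]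
  have hcast : ∀ M : Matrix (Fin 14) (Fin 14) ℕ,
      (((M ^ m).trace : ℕ) : ℝ) = (M.map (Nat.castRingHom ℝ) ^ m).trace := by
    intro M
    rw [← RingHom.mapMatrix_apply, ← map_pow]
    simp [Matrix.trace]
  refine Nat.cast_injective (R := ℝ) ?_
  rw [hcast, hcast, hqG.map_patternMatrix hG, hrH.map_patternMatrix hH]
  refine trace_pow_eq_of_charpoly_eq (hsymm _ _) (hsymm _ _) ?_ m
  rw [Matrix.charpoly_reindex, Matrix.charpoly_reindex, h]

/-! ### The certificate -/

/-- Cubic graphs whose first, second and third seven edges are perfect matchings. -/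
def colorable : List (List ℕ) := [
  [300490127550965148984464337815817852664176361939713,
   252277700491357824202315437767813906957167180980993,
   300495814240990774274429589098058380246741420417793,
   300490127550965148984464337815817852664107659240193,
   252277700491357824202315437767813911739974059107073,
   252277700491357824202315437767813906957098478281473,
   277106123654415901148262896972756737537062021178113,
   250810534464746494830268177807337512073083268440833,
   250810534464746494830268177807337511792707803357953,
   277117497034467151096904329078609018979126390104833,
   275661704387907072687306709822732860414994533393153,
   300495814240990773968842234699329150896929371398913,
   300495814240990773948639053258191744810575664063233,
   253727806447892277951885665856124143417801029526273,
   275752290276240361204548698062256839602311079994113,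
   300403757026148097311309433634392101838178497143553,
   300403757026148097311309433634392101557803032060673,
   275752290276240361550695302147038436162129973551873,
   277208082922800440303589168547241607706725100888833,
   300495814327762777839263966068078330586637744284673,
   300490127637737152530362874459918805236865828201473,
   252277700578129828092856481348964728061772831204353,
   252277700578129827748213974411914859529856647242753,
   300495814327762777839263657791994328856129491510273,
   275753026026267058830817252131037019094702622057473,
   300490127637737152530362566183834803506357575427073,
   253733493224689906847096299265806753427312619103233,
   252277700578129827748213666135830857799348394468353,
   275753026026267059152642976719008217932384206922753,
   300587135879350760434178501595604508414319044928513,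
   300587135879350760758696745769021409068435543237633,
   277208818672827137582443777416021777799994190144513],
  [252277700578129828090242572164939467225883802412033,
   300495814327762777856932157002694914028068553434113,
   253727806534664281860020932245618426932810178962433,
   253727806534664281860020932245618426652434713879553,
   275661704474679075601999736960856798000892263867393,
   300490127550965148984464337815817852664176360891393,
   252277700491357824202315437767813906957167179932673,
   300490127550965148984464337815817852664107658191873,
   252277700491357824202315437767813911739974058058753,
   252277700491357824202315437767813906957098477233153,
   300490127550965148965523546938667532990567784195073,
   252277700491357824528017153827713455815474787197953,
   252277700491357824183374646890663587283558603236353,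
   300495814240990774274424638546827058340266719388673,
   277106123654415901148262896972756737537062020129793,
   277117497034467151766065080189075788201430070141953,
   250810534464746494830268177807337512073083267392513,
   250810534464746494830268177807337511792707802309633,
   275753025939495055265978232885869748561251958858753,
   277117497034467151422689914367244332473641663276033,
   277106123654415900804887731150925281809273613263873,
   253727806447892277973356188412479957561677930898433,
   250816221154772119815997285034802987483457127785473,
   250816221154772119795794103593665581397103420449793,
   277117497034467151096904329078609018979126389056513,
   275661704387907072687306709822732860414994532344833,
   300495814240990773968842234699329150896929370350593,
   300495814240990773948639053258191744810575663014913,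
   253727806447892277951885665856124143417801028477953,
   252266327111306573908868710818671554084493067625473,
   250810534464746494830189259129833069045382666068993,
   275644644317830196111724784006429359527317504074753],
  [275752290276240361873867286527732499594803393405953,
   275752290276240361549427961031820041633057924785153,
   277208082922800440952546738216570980112730571482113,
   300586400129324063479842136900241247720742019474433,
   277208082922800440607904231279521111580814387520513,
   300403757026148097676312959367588262161191263347713,
   277025439819624475149017560683917990031996591875073,
   277025439819624475149017560683917989751621126792193,
   277116783584845370648298476270532009679607836255233,
   277025439819624474479856809573451225085676451341313,
   277025439819624474479856809573451220302800870515713,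
   300403757026148097331591533753033950899537834222593,
   277025439819624475148938642006413551262691640026113,
   277025439819624474500059991014588631154442267599873,
   277025439819624474479856809573451225068088560264193,
   275660990938285290920740373589868604514660171195393,
   277116783584845370648298476270532004876953931031553,
   277025439819624474500059991014588626371566686774273,
   277025439819624474479856809573451215499051748631553,
   275752290276240361873867286527732499594730412516353,
   275752290276240361549427961031820041615397052818433,
   275752290276240361549270123676811155630347414479873,
   277208082922800440263103886987462366051187924739073,
   275752290276240361184424435298623881012077523182593,
   277116783584845370648298476270532009679539133555713,
   277116783584845370303498131978473259927861001004033,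
   300495100791368993175514956276697830334593469064193,
   300495100791368993175514956276697830054218003981313,
   300403757026148097676312959367588262161122560648193,
   300403757026148097351794715194171357003410729935873,
   300403757026148097311309433634392101838178496095233,
   300403757026148097311309433634392101557803031012353],
  [275752290276240361550695302147038436162129972503553,
   300403757026148097331591533753033950899469131523073,
   300403757026148097676155122012579376158485031232513,
   300403757026148097351715796516666913993298019689473,
   277208082922800440952546738216570975590374872261633,
   300403757026148097351715796516666913712922554606593,
   300403757026148097311309433634392101820590605018113,
   275752290276240361549427961031820028105701994079233,
   300403757026148097676155122012579371935265163912193,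
   300403757026148097676155122012579371654889698829313,
   275752290276240361873788367850228047558739651535873,
   300403757026148097311309433634392097316995272614913,
   277208082922800440303589168547241607706725099840513,
   277208082922800440263024968309957909548968046830593,
   300398070336122472367411867759428728066938997384193,
   252185643276515147585262967711424782359929816425473,
   300398070336122472367411867759428727505092850557953,
   277025439819624475149017560683917985508541397804033,
   300398070336122472347208686318291321418739143222273,
   300403757026148097311309433634392092515423749481473,
   253732779688296122143099072223244319710919599137793,
   300398070336122472002329423348728124469999431918593,
   252276987041736043084464964620534354491642584835073,
   300398070336122472002408342026232566900678104261633,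
   275752648481279548213720314284919377201857614324993,
   277208441127839627272196584532620447149614077060353,
   253641794128114413328234772653362616495195838227713,
   253641794128114413308031591212225210408842130892033,
   300490127637737152530362874384379388255025214268673,
   252277700578129828092856481273425311079932217271553,
   252277700578129827748213974336375442548016033309953,
   300490127637737152530362566108295386524516961494273],
  [253733493224689906847096299190267336445472005170433,
   252277700578129827748213666060291440817507780535553,
   275753026026267059152642976643468800950543592989953,
   300587135879350760758696745693481992086594929304833,
   277208818672827137582443777340482360818153576211713,
   252277700578129828090242572089400050244043188479233,
   300495814327762777856932156927155497046227939501313,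
   253727806534664281860020932170079009950969565029633,
   253727806534664281860020932170079009670594099946753,
   275661704474679075601999736885317381019051649934593,
   252277700491357824202315437692274489975326565999873,
   252277700491357824202315437692274494758133444125953,
   252277700491357824202315437692274489975257863300353,
   300586778980995862727359266392181157026881005167873,
   275752669127912160796945090523759941653821213910273,
   277117140222884257642941785879234262367187009545473,
   275661347576324177915383683198570852717327119820033,
   277117140222884257642941785879234262367182731355393,
   300495457429407879845797859066992068090382632887553,
   277117140222884256973859953446271936172579651593473,
   275661347576324177915383683198570852717322841629953,
   275752669127912161141666516138314257663101460817153,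
   277208461774472239895748804976231394271599747409153,
   277208461774472239855342442093956582098892332737793,
   275752669127912160776662990405118097059781931181313,
   300489770739382254842479171306330450131184392611073,
   252277343679774930404972778195376372956091395613953,
   252277343679774930060330271258326504424175211652353,
   252277343679774930079266111584245506956601056306433,
   300489770739382254841211830191112042074756414186753,
   253733136326335009482384888768996449938773818746113,
   252277343679774930403705437080157964899663417189633],
  [275661347576324177915304764521066414191027139388673,
   277117140222884256953577853327630087057430126273793,
   253733136326335009137742381831946581406857634784513,
   300489770739382254516535748662686250651619480052993,
   300489770739382254496332567221548844565265772717313,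
   253733136326335009137505625799433252429283177276673,
   252277343679774929714183667173544898858256591758593,
   300586779154539869857037882758502206817082793010433,
   275752669301456167926623706890080991444023001752833,
   277117140396428264103538569812592985962781439436033,
   275661347749868185045062299564891902507524629472513,
   277208461948016246985021058460277631889094120580353,
   300489770912926261970890446557433091864958202029313,
   253733136499879016612063505135317499728975606588673,
   275661347749868185044983380887387463981228927231233,
   300489770912926261626011183587869894355467560559873,
   253733136499879016267184242165754302219484965119233,
   275752267889063441820733562897087637637633976575233,
   277208060535623520534488407530234405065949667665153,
   275752267889063441455808955841395920026839266108673,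
   275752267889063441820891400252096523605091445646593,
   277208060535623520534567326207738848040882317567233,
   275752267889063441820891400252096523605087167456513,
   277208060535623520534567326207738848040878039377153,
   275752267889063441455887874518900363001767637820673,
   300312413087383195045853972466529363124373811373313,
   277025439646080468019338944242057527500761948497153,
   300312413087383194721414646970616900959186799830273,
   276934095880859571869679922791034175127737525871873,
   276934095880859571849397822672392326048858999366913,
   275752267889063442146598066863227380035540695131393,
   276934095880859571849397822672392321265983418541313],
  [275752267889063441820733562897087637637625420195073,
   300312413087383194701132546851975051860529948927233,
   276934095880859572173837148168304788476833584915713,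
   276934095880859572518637492460363533986608742409473,
   276934095880859571849397822672392326030175891629313,
   275752267889063442145251807070504528986587897537793,
   300586377742147143751147738765508838921560393000193,
   276934095880859572173837148168304779469642920109313,
   277208060535623520534488407530234405065941111284993,
   277025439646080468019338944242057523259954190099713,
   300403756852604090546634342925727790865775204771073,
   275569646999520388940659492553219038220843788543233,
   300312413087383194721414646970616900941598908753153,
   300312413087383194701132546851975051862720382248193,
   275752267889063442145330725748008972260583398450433,
   300312413087383194701132546851975047359125049844993,
   300312413087383194680929365410837641271676125848833,
   277208060535623520574973689090013646423519208416513,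
   277208060535623521224010177436847457297503366685953,
   275478303234299492791079389779700133063564052407553,
   275478303234299492750515189542416434905806999397633,
   300586377742147143426708413269596376755278164796673,
   300586377742147143406426313150954527676399638291713,
   275478303234299492791079389779700123774902705857793,
   276934095880859572518637492460363533970043087103233,
   277025439646080468019338944242057527500688967607553,
   276934095880859571849397822672392326048786018477313,
   276934095880859571849397822672392321265910437651713,
   300312413087383194701132546851975051845059510281473,
   276934095880859572518716411137867981185787773592833,
   276934095880859571869679922791034175092488762828033,
   276934095880859571849397822672392326013610236323073],
  [275569646999520388291623004206385236333103773132033,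
   276934095880859571869679922791034170309613182002433,
   276934095880859571849397822672392316444573424690433,
   276934095880859571849397822672392326030094354359553,
   252094299337750244954803980810365882761266217624833,
   300306726397357569716670780739727988976021574788353,
   300306726397357569736952880858369828749746080326913,
   300306726397357569736952880858369828747555647005953,
   300306726397357569716670780739727979668677120500993,
   276934095880859571829194641231254905573145146828033,
   276934095880859571829194641231254919943740647023873,
   300312413087383195045853972466529358883484515706113,
   300312413087383195025571872347887509804605989201153,
   253550091984310324358001676672621273519934596719873,
   253641435749531219513823865484752065282694186280193,
   300306726397357569392389292598824412515508736500993,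
   300306726397357569372107192480182563436630209996033,
   253641435749531219514060621517265403565422664754433,
   300306726397357569737110718213378715015171183748353,
   252185643102971140455584351269564315587887414650113,
   276934095880859572174073904200818103646672368444673,
   300306726397357569372028273802678111418231618282753,
   276934095880859571849555660027401198208585072649473,
   252277700578129827767154744671231561738667393688833,
   275752669301456167926623705685877538312262935520513,
   275661347749868185370837674270777112805789201212673,
   275661303322602360173111884492588366514131513517313,
   300392718244046828563756106937226634599697890026753,
   300392718244046828563756106937226634597507456705793,
   300392718244046828583959288378364036181361048298753,
   253641792734658120786986177125150073229386165134593,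
   230257766624475960028755115839615854204291435078913],
  [230257766624475960008551934398478448117937727743233,
   230257766624475960008551934398478443615437612000513,
   230257766624475960028755115839615845180608095855873,
   228801973977915880929872482709639958556548886045953,
   277208439734383334386079243689475362636572560598273,
   300398427147705366490308305783937290385523075327233,
   253641792734658120786996694779780720485549515089153,
   277025796631207369272071836063435429310774493193473,
   253641792734658120766793513338643314399195807753473,
   252277700578129827748209003242849920158519692502273,
   275752267975835445041009282820702732490911539209473,
   252277700578129827748208694966765918428080142427393,
   300586422256184972512598074139333269202761273517313,
   253727806534664281860094879754057930554066746090753,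
   300312413174155198610851118004698774004523790181633,
   277208818672827138231396375916286202089155843204353,
   300587135879350760758691774599956469977542756279553,
   300587135879350760758691774599956469697167291196673,
   300312413174155198245847592271502613401204260545793,
   275753026026267058828277598731535254324107499939073,
   277117497121239155329631787149959706768413388317953,
   275661704474679075926513009965208759564115975218433,
   300495814327762777856927185833629974937175766476033,
   300312413174155198245847592271502613663991834551553,
   275661704474679075926513009965208768569116206703873,
   300312413174155198286253955153777425556323784140033,
   277106123741187904711829603933640656384420803388673,
   277106123741187904711829603933640656104045338305793,
   275660990851513287355901065331168662636622893229313,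
   250816221241544123702735976376380955972250610574593,
   252277700578129827765877194177466503897982560511233,
   250810534551518498069395559272308967914128643859713],
  [300586377828919147314871976085060521180664035747073,
   275752267975835445708739288357542887049897446941953,
   277116716857174628637991832352724028256929870980353,
   277208060622395523814100763558643989274598858761473,
   275660924210614549559312380663885543217819469423873,
   275660924210614549559312380663885538715319353681153,
   300586756940906957601618553509909631949647463720193,
   300312390960522285993047123962370074389205340333313,
   250718834061486712334997074911848102373362991768833,
   300398427147705366489188284369097121040324791510273,
   277025796631207369270793977293586373980526571037953,
   253641792734658121110158161505844123098363953816833,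
   253641792734658121110158161505844122817988488733953,
   252186000088098041707039384321093180116191191377153,
   300312390960522286010715623173070664361607874159873,
   253641792734658120765515654568794254566447769855233,
   253641792734658121110158161505844118032922474587393,
   253636106044632495476817744401772139822022351267073,
   252186000088098042031478709817005633554563003196673,
   250724520751512337643898166520007623184363793294593,
   253636106044632495456614562960634724450292947363073,
   277117095969162439573617060769398059134162671379713,
   300301017580471035375244940746051028788088336229633,
   277117095969162438924738409777573139025913298953473,
   277208439734383334100847340983493100043582286734593,
   275661303322602359846058958088734653986802897396993,
   275661303322602359846058958088734649484302781654273,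
   277117095969162438924738409777573129721854494647553,
   300495413175686061776473133957155859774333202605313,
   300495413175686061756269952516018458751230541178113,
   275752647087823255001964707853517204395839737701633,
   300586756940906956932378883721938415266399413216513],
  [277117095969162438904535228336435723914781035734273,
   277025796631207369270636139938577492516660156179713,
   277025774417574456002770639570109237881604710737153,
   300404091624098078874708545190829369799407692031233,
   275569981771014376944294369322408154426347900773633,
   277025774417574456002770639570109237880509494076673,
   277025774417574456671852472003071559852987923178753,
   228801973977915881271901388738748568002793915688193,
   275569981771014377593173020314233074813877521622273,
   277025774417574456002770639570109228875509262591233,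
   277008714347497580096270546186768067988994234131713,
   277008714347497580076067364745630661902640526796033,
   277008714347497580076067364745630657119764945970433,
   277025774417574456671852472003071559851892706518273,
   277014423251156117679515980234521054515604676289793,
   227340494641330176884320845441750557631499489125633,
   227340494641330176884320845441750557351124024042753,
   277014423251156117659312798793383648429250968954113,
   275569981771014377268659727896250944133575992616193,
   230252079934450334392801097827602602818595338986753,
   300404091624098078874708545190829369797217258710273,
   300404091624098078874708545190829364733966212801793,
   230252079934450334372597916386465201234741747393793,
   230252079934450334372597916386465196451866166568193,
   253550092071082327577004488377618653258502251160833,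
   253636106044632494807578074613800922878177160078593,
   275569981771014376944294369322408154424157467452673,
   227340494641330176235442194449925637242874651616513,
   227340494641330176235442194449925632740374535873793,
   253550092071082327597207669818756049776914363524353,
   277025774417574456002770639570109228313663115764993,
   275569981771014376944294369322408149360906421544193],
  [230252079934450334372597916386465192211058408170753,
   227340494641330176235442194449925637224191543878913,
   227340494641330176235442194449925627938815847310593,
   250718834061486711341318079627964422945493891818753,
   227340494641330176235442194449925627656249948906753,
   253641346894999569138806655094422543071860080649473,
   253641346894999569118603473653285136985506373313793,
   253641346894999569118603473653285132483006257571073,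
   252276898100432389124094849851868484352913234666753,
   300397981308046814842276103453587994732568195245313,
   300397981308046814842276103453587994171817265079553,
   253732690746992468184070265491866525544520382555393,
   300397981308046814822072922012450588646214487909633,
   252185554248439490039924021964446647441705422693633,
   277025373005181729227566242314906982187822621336833,
   252276898100432389124089898096433704493414989833473,
   253550047643816502380541087959213535501152618423553,
   276934051453593747319633534432038277503530030212353,
   276934051453593747319633534432038277223154565129473,
   253550047643816502400744269400350941268669428540673,
   300306659756458831939244173572043091636868443677953,
   300306659756458831939244173572043091356492978595073,
   252094232696851507157095273524039150153079130039553,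
   300300995366838122795312626151356872384449965597953,
   300312368660117369197971363446379182029450394346753,
   300312368660117369197971363446379181749074929263873,
   253550025343411586235779676968312415013226344293633,
   206782017550313090240209760248523994659876513391873,
   206782017550313090240209760248523994379501048308993,
   206782017550313089915770434752611531933938571683073,
   300300995366838122795312626151356872383354748937473,
   230166043747267254563285389748737515348668641125633],
  [300300995366838122775109444710219466297001041601793,
   276934051453593746346236639266796451415125539562753,
   206782017550313089895567253311474126127960329430273,
   228710251100707175141225820482632794758542586684673,
   230166043747267254240108453612608681100035898090753,
   276934051453593746346236639266796446891751882761473,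
   205326224903753010837090983063773042652925195068673,
   205326224903753010816887801622635636566571487732993,
   206770644170261839297968251536292477027667546612993,
   206770644170261839297968251536292476746196864869633,
   253641794116548805729207078253575262089553831601153,
   253641794116548805709003896812437856003200124265473,
   250810179208598292779117732024053142049084335793153,
   300586758322797642545111726966693803436913838072833,
   253636107426523180420310917858556311312574375601153,
   253636107426523180400107736417418905226220668265473,
   253636107426523180400107736417418900723720552522753,
   277208441116274019328294557172207025664021648253953,
   252186001469988726650532556573673893691012620362753,
   252186001469988726650532556573673898473888201188353,
   252186001469988726630329375132536492387534493852673,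
   253641794116548805730479349377730786786551000343553,
   277014424633046803597742098066519804186903115604993,
   275661304704493045115327197975320029541511898473473,
   230252081316341019662069337714187991899487795028993,
   230252081316341019641866156273050585813134087693313,
   230252081316341019641866156273050581310633971950593,
   230252081316341019662069337714187982875804455805953,
   277105768398267699095834899491503856540618457490433,
   228790601979755315274488794417189972503414812582913,
   228790601979755315254285612976052570919561220989953,
   230246372412682481753038318377799677771645090931713],
  [300495811529284584852167832642124869538365992936193,
   253727803736186088835211263798919862059237651063553,
   277106120942709711362427743805085682173319380804353,
   300495811529284584852162880886690094500131763462913,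
   250816218443065931019954615616049708303052358099713,
   250816218443065931019954615616049708022676893016833,
   275753023227788866149298261316859222062124941779713,
   253727803736186089177313518993726678363685270135553,
   253727803736186089177313518993726678083309805052673,
   277117494322760962306009942798233805974514646196993,
   277106120942709712029048243173309404194039327433473,
   277106120942709712029048243173309403913663862350593,
   253733490426211714165577308451628956394734938825473,
   252277697779651635083095833417135255948340140253953,
   253733490426211714161775285105973740969862650733313,
   253733490426211714161775285105973745752738231558913,
   230252081316341019985246601464491565625475656525313,
   253733490426211714161775285105973745751643014898433,
   252277697779651635083095833417135260712532613341953,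
   252277697779651635083095833417135251707532381856513,
   252277697779651635083095833417135251144591018369793,
   252266324399600384465293650200816205283967812051713,
   253727803736186088852874193497814215620086456460033,
   253727803736186088852874193497814220402962037285633,
   253727803736186089177313518993726678343833964847873,
   252266324399600384465293650200816201025572162577153,
   252266324399600384465293650200816200462630799090433,
   228801953146173652641861574984585548214051754419713,
   277117494322760962646771507712124006782775928890113,
   275661701676200883568092056023285521743665527333633,
   275661701676200883243731649204877502572094273430273,
   228801953146173652641782656307081104941151470167553],
  [230257745792733731680055745113644777807554457052673,
   277117494322760961977689675279161676366048198468353,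
   275661701676200882919213405031460596851445357421313,
   277106120942709711359887492062842625140929218290433,
   275753023227788866149298877869027225523003773559553,
   277117494322760962306010559350401809435393477976833,
   250816218443065930675311800402915842525539877659393,
   250810531753040305711053215731806181220581487551233,
   252266324399600384789732667420644661196440843199233,
   250816218443065931019954307339965701768794715071233,
   250810531753040305711053215731806176436610690065153,
   252186001469988726000222852936341801072618265585153,
   277117494322760962646770891159956003321896560370433,
   275661701676200883568091439471117518282786158813953,
   253727803736186089177233983764054222884330050822913,
   253636107426523179749798031575883354412815469716993,
   277106120942709711684405427960175529408228130956033,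
   277117494322760961977689058726993672905168829948673,
   277117494322760961977689058726993672344417899782913,
   253733490426211714486135690720178307536258622563073,
   253636107426523180742126121179286503200643987482113,
   253636107426523180417607877005869597762556691686913,
   253636107426523180417607877005869602545432272512513,
   252174628089937476030027333708871592174137845949953,
   252277697779651635082937994857922916778685460128513,
   300490124839258959540647569410014400320507629544193,
   253733490426211714161775283901770292585721080849153,
   253733490426211713796692839491069688989876732044033,
   253733490426211713816896020932207090573730323636993,
   252277697779651635083095832212931807546610679292673,
   253636107426523179768650000264659686080686092396033,
   252277697779651634758498669362010454613498448585473],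
  [253733490426211713817053858287215976558779961975553,
   225867598879318081297799276942978528949006696392193,
   252277697779651635083095832212931807544420245971713,
   230252081316341019658029940579647982159848787092993,
   253636040785624442621177029693595364310119798482433,
   253733490426211714141572102460632881993581607789313,
   253733490426211714141572102460632872988581376303873,
   300490124839258959540647569410014391032941499654913,
   300490124839258959520523306646381428218392859910913,
   252277697779651634758498669362010445325932318696193,
   225867598879318080973281339841442172372391273375233,
   225867598879318080648762788596144718353207569884673,
   275661701676200883568091129990830063402926173856513,
   225867598879318081622159066005015092072197576402433,
   300490124839258959845040934267630330194501560705793,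
   275644641345128765659845500978711097068154790683393,
   225878972265150149664097535491450901877860428489473,
   252185998682396910929890242099264405184189457245953,
   253727803475190847175409219977484527989255085564673,
   253727803475190847195691320096126376786662930326273,
   277106120681714470027143944157067253820704359523073,
   300495811268289343517041562073031316135194204381953,
   277117494061765720665306837893448585801244814680833,
   228801593548018450224232993760215478712459352090113]]

/-- The remaining cubic graphs. -/
def uncolorable : List (List ℕ) := [
  [300691042490329083862513197468822153755711622021633,
   275753477988786377983642671568935681526751394202113,
   300691042490329083862513216816634258392184575427073,
   300691042577778910628532323700247932737680721510913,
   300691042572333068742380791507440334166155730289153,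
   300690685586528261211802541937909355008858639237633,
   277300972786320475143402739652913200864712355676673,
   300691042577778910303934541888751674582670447411713,
   300691042571992791243158929767308329934210017198593,
   300691042572334392453481936076989351287709407314433,
   300690685586186659676881753816732075500348975022593,
   300684998896161034367980662208572550168164950016513,
   300691042398430164537024835671625634121765190042113,
   300691042490307727641377147187782053404906558259713,
   300690685586506993239351429634960900278477423575553,
   300684976595737498627822981406956006104992172933633,
   300691041177837314411980204994666852025553410785793,
   300690706579887332887793773775732237405029927158273,
   300684997676228794980029787278478338927017058304513,
   300690661978057993072216054226360478368928085770753,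
   277300971391483119602679146830458697370610646057473,
   300691042577778910628537275455387560152206296678913,
   300691042572333063529964931449129191301424812851713,
   300690707974044128866853346682604105880529841357313,
   277300972786320469930986879594602057999981438239233,
   275753477988786377983642671568935677024251278459393,
   300691042572333063529964931449128038099549035889153,
   300690707974044128866853346682602952678654064394753,
   277300972786320469930986879594600904798105661276673,
   300691042572333063529964912106314996323076278518273,
   277300972786320469930986860251787863021632903905793,
   275753478076240270277457962639152439751657979576833],
  [277209270548235500033717554081499750592654650573313,
   300691040912055429583517001999419523544871570964993,
   277300972786320475143407691408051670571567798289153,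
   275753477988786377983642671568934519316581145903873]]

/-- Patterns with the scripts that exclude them; the last pattern is a single edge. -/
def lemmas : List (List (ℕ × ℕ)) := [
  [(228888350542926425227503140588190419974344090518017, 354697649022571080605110512500206832400098990608074976294395066),
   (225953884510327438053438651343391164457289290809857, 279807108487710156492068482698409),
   (201010923233213439791739453241718527963337295331841, 1452841570396451149081536015550359502880182518099901303027754900137),
   (202478156249514267799143569477332952397014848700929, 95213425157501822315393885193006827732732837942038752246706366099278761),
   (228888350542926425226235799472972011917916112093697, 354697649022571080609291922168219039317751435697310702783749306),
   (152592233695286114879430979308679891400808988869121, 196487233599231168485134016027564493498994686264782753316890423722120831186120625096286285937048196552156340062673175941445207474247836810459535109811210906044057718835948444114947455519379068404047895236358056165324254190281584856455189207247526800847084083094918983726132870777588520523309223508862579694946352556300270705879942942699143),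
   (127649272418172038408754778795989315955018988454401, 5482969495894926849408311959000299753420192335346582024744430692251127174351019072011067249062302944911443662221516358845701378743561644602401211781611540284565690509538795903486385150254648566074400349907869495735794377267617953581190),
   (227421117526628255330022600500960638850953747038721, 28937092064232690577335815498001949368140615935874130155267804074),
   (227421117526626936506902942258394662528833376420353, 354697649022571080613473311892943531156789386332198983393139898),
   (227421117526628338427054746661854365762842265846273, 1146089916365660801027541302151662776),
   (228888350542929166434379634734954525858926275265025, 432560550945670231146728233780744212999854972355283272314315423304843956566043259314790705422397229899981192550230648030208764649797125515330546882917247089679801511996574317371273867007579281807692802706715035135861523535893707064643759164639782581155452406320040),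
   (179002427988701019377630298784376711122566284247553, 569977146423592127285484142617692465386230779713465213843102196601043003716329140656739068914628452412743005621929621895833),
   (176067961956099363322415703430873050082503762838017, 1931157688811084525996937043094530233298652156428582906729261940960950370952039850316058411728467831431),
   (225953884510307494135781072756926419702543452144129, 3437018313),
   (230355583558186457024110776149608082962890627416577, 18792048335283297892316786034576157972166083275963),
   (230355583558526739391031714613071457570322395628033, 1321351710791033061680310171403791495063441753697533130),
   (227421117526608316950809102295198951268131132342785, 1385537691494418286831446916450519096089736112139186046033081),
   (205412622282115913145325432959204534890220134531585, 42883337810497098263647909294625739161870216291645164750322409349805467149721844264837322008201663308323174077722946530721500513757963060733922201),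
   (202478156249514267515269373882659471759044774134273, 45158241986264997332728176608459612437178085274027496400347879158502721411741683753634778179205334665985626609748239734905515933647666535353934978107880),
   (206879855298416746344947179567132323516800473170433, 5806330702142756603541264190624692818101527601573618374045884810162179818060103379210985),
   (129116505434472866436441615329191051772341692596737, 525164143947666618938802475979896094218670191802185165126260684308758628064619963494389482870021985626525649261065144838218873495546691008620304506715913597536837784139794013690738464754737911451981315462409390071093755252524182468096586498878789885349267766809078432862855414429033580006),
   (126182039401871210381067942262787580137696284312065, 307651169316618019879665110840827029038974693),
   (179002427988701019335876748872720136446068362772993, 2246623366948883520943682237485676562731316873243476566584956159936188640259624109249894119811292702976746970579510278849220262735237941039064812110423101098361875119017),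
   (227421117526605585781031916342832911299324204483073, 972150449148787597123666868992866912500970548049893041104711909256991804808378),
   (227421117526628255349116279400259075446297579422209, 279807108487710156517357250137255),
   (202478156249514267818158330908052765614463036621313, 6314351145018154575304880059601378926018910180924521494304594673910233291422654082544147311972273978891526321812458540559609766200787781737828748121819769755831393669789159794684999498796283593530465943832262648304585421851957736609939685620346746197737),
   (228888350542906398191263047370312779717565518905857, 114730745866746303095897036194192054437189716952429611314896058),
   (228888350542906403383559905905140408248061848125953, 352768914550698877049197538356800745483637436502212741409070250),
   (203945389265815012404011747324346736353096050606593, 1146089916365660801113109489198550185),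
   (203945389265815017596308605859174364883592379826689, 4986731706499019162232317587901701895516121774306071370752254720199338439794278443252567682561745245623597916522754240015724901277403081520903613337396614344908346909304313839991155995540700119806213392110547731746830572521),
   (203945389265815095480761483881588792841037318128129, 408938547191613976874010015049359942283205831616614376741831770044074487909763991),
   (203945389265815017636873425066477705731486882398721, 2293511489243545000651010542954229761946781145567803993425597468672706262180515431437897428636263448772998170604746877128866680852576960834750421387689020900553168396197911359585496027140808157150079812554216093200129613035)],
  [(203945389265815095521326303088892133688931820700161, 1452841570396451149623913642376540987115017555974010963101401373927),
   (228888350542906413829000851785750676580896260424193, 33952310932657805783052084348883042218743669692362997218041286635298018330410821316165569317402415369617446235430889),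
   (155526699727887770934804033414508453311056238019073, 32813969161601354642288215990420375094475588905343107596057551642230512848526866221943366281165958125947513446029596297564510848737065506047686529684193679423825002069940917376293016981118104427696551284546996072684848722821985518031077065272446127606226456761826916504405549795267205608),
   (152592233695286114879430981735976263595806628708865, 12122073279741390296659438376733949479204908055731111696331164159740277564862287053192399093143553201928873783047433469767653776095369077160028621191222204191974),
   (205412622282113187208569000044017635665128575926785, 543572565482704283830591341635979205428662473604712532517470076590873371089129009363784647968912644911404497621902058),
   (202478156249514200034504510799218380148073776218625, 53354701713314523274668350318631285833356161920720853540951431641927322996118549039976297362899415354354787416413091561437183435822288654803854776380956922908313042078026408285852904),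
   (277307038593779835701877401028892002726051160719873, 1042362706689946936159947),
   (202478156249514267799143588825145057033487802106369, 95213425157501822507329972220399646174586518418812807002100930915912617),
   (228888350542926425226235818820784116554389065499137, 354697649022571081324309565096107143793240994262830656881745082),
   (152592233695286114879430998656491996037281942274561, 273863233203788713692746742664185701580236497750935939883087690272504498566016686180971779028648491675261488148287799232108070613622611310662547040609145441610983144563030188787901491815983527190865557737228798359773978819873689805105590211206497447803963803519853151705796338915210860155837696679742067461820715604277323824069375835065630085044260641696949223430024544599129368967),
   (227421117526628255330022309164281835493468091384321, 90802598149778196820093679329897394907786457944349594211205368746),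
   (177535194972400191350022709770946077245049367888385, 6543016755065823630318302920470029236339280795550596686723572541324928081559530152),
   (275839807053280896385982037096956956096510906532353, 204),
   (227421117526626936506902650921715859171347720765953, 354697649022571081329884751395739799578624928442680964692106426),
   (227421117526628338427054455325175562405356610191873, 21141627372656529037395629033758527413554512051451645624),
   (228888350542929166434379343398275722501440619610625, 432560550945670232025839256611624200494542677892948548250255702043693864516972944743021993730318280711965467695549979850222021497268099110717325259786500081225261256089993782059918162746012729308078153218707651328339564764351955521364568764148118168453684138986408),
   (179002427988701019377630007447697907765080628593153, 569977146423592127368354698078271221176873692617205746282051116551081641913986170218501133843750116510333197965166094629529),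
   (176067961956099363322415412094194246725018107183617, 307651169316618019913515033790036645930757095),
   (250896845787441420390832419542808275304411769799169, 99838512497952631040976908289299074667488073509628460231099668547966905994424),
   (202478156249514267494907444779814733640018323243521, 4269517646602022652390198154),
   (179002427988701019377709235610212172102674172543489, 55306239501284818361945372129624599746829148823655841215628338613949236767165491169438552647409885944802948345015812270352075891356676682387462308733995291585536904836882876808282409502146966447908484520555822966490735929321897454860991845218163113464807529382581025940808031870489959947557888469220812772431856240198116308642474713274430788011557024746),
   (177535194972400191350101937933460341582642911838721, 307651169316618019918350737068495162629581799),
   (225953884510307494135780781420247616345057796489729, 3437018313),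
   (253831310420077544004648375473390312589844252131841, 15549472542065497032699595),
   (230355583558526739391031423276392654212836739973633, 1372843033737369116374775923854213088380703008924910644607486218044537001013976024370804717),
   (227421117526608316950808810958520147910645476688385, 1385537691494418287054672149150654728121747180430545201716409),
   (205412622282115913145325141622525731532734478877185, 1051496383569226119789746522775769862677712041548236965587058271726363672006184845869118716879625586782934807906096089096232590682478838302121073595167752977911309533772573038140328655303119299226225561),
   (202478156249514267515269082545980668401559118479873, 833022532739275690666146690614640891075579572385529084010981908073201405444963946584892970901965750705264803835352304611201594290585617160701271562814721706985119908262888),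
   (228888350542228585416588680639521187322362278904321, 1321351710791033064375090759979585012507073491937185210),
   (225953884510310162976366068321648681020171015619073, 483163056062302074272004203654921637097851537920105494793411429946938594075172745493064069550349388597963443881),
   (206879855298416746344946888230453520159314817516033, 5806344934256999846894105344645302963827189277571249180139148756627555187380870323535337),
   (101239078124757133910391721118040870704709795774977, 2151072333609642471536801579979894165496980669471453742898243814059882188581787299765707607311661117603229158201029545005010605915186306060995883481762274694600765564895679072514254366390134358547335529346526081329323635516583429624814408011164412077632319389812221648594611836457801293387365)],
  [(76296116847643057439715499973016311973088149570049, 65147669168121683541988),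
   (202478156249514267799148540580284684448013377274369, 95213425157501822514064571765220446821669103698699615940886705120005033),
   (227421117526626926426787714140073345931130748207617, 3437018314),
   (228888350542926420013819958762472973689658148061697, 90802598149778196825446021195755374768480774417488303136908827835),
   (252364078798275128763596642221325927914248534688257, 68642399689441796945617857964),
   (228888350542927749241815743678345877496718428406273, 24500248623832054745513124261954489832741093019616362014976195657612821740),
   (227421117526628255654783499055946249738191028552193, 307651169316618019938902476001943858599592681),
   (151125000678985286851744163327198565728014391509505, 170422680900347715180269497455804159770575552265364754971262443809082048246811378456598211092045768938490538287186302674432114469905276126420691029580124048732087634926662473011608664869127079083256507173574684591340026505003308933651543387089916538233979046518085359494883865753230586108005076547708195221902048662288519),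
   (225953884510327515916262569831938206609534032740865, 6662895314598980739340056348895788311947548557094572897313999274),
   (202478156249514267799143588824849909409783425991169, 95213425157501822321754340318670917232755279595265182911115152847588265),
   (228888350542926425226235818820488968930684689383937, 354697649022571080632986463941657826405633155961665165200252090),
   (177535194972400191350101937923720460993199245296129, 162530430247461878627163784098354543126498607727107246739674672546450246921959524918467947348353103085353289250211991696139590456623267445044426082978738656521831206185735989855880896794489226038799472131923983605460382053597015127001241785408160359956243205485088692854951464185631945699775755094043659471747063432),
   (275839807058725409064420504661739081655177101640193, 204),
   (201010923233213439487503639228396069576595002819073, 1756377686261734672120430180520766156766102727484458589879679734122635498139804554905840553),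
   (228888350542926424901638347693483618769633024344577, 90802598149778196643828752298921979903813884804896776269058596027),
   (228888350542927754129634132609356522576693304689153, 90802598149778196644185569665287112613308955838349343444844731562),
   (227421117526628260542601887986956894818165904835073, 279807108487710156578929901292713),
   (179002427988701019377630318131893668135334861537793, 7287995607319518781962580454328071787070208597759305808935522393038028768541678089665898571441880685957747486479160704809165618587262995175962754825338004715130897791165065600673903922770870613555194225899080072606983199457524219820775298502653848754451682608751346617832),
   (176067961956099363322415722778390007095272340128257, 11024961422427977867208247699272290864077131642683376478446692298836859723082614827587459724913963900517783941194539977062890744880049481331599125127),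
   (275839807052919341199272858057575451515006895718913, 204),
   (228888350542905146889552937898542099894810219577857, 354697649022571080644136836540923137976401024321363581814496442),
   (202478156249514262322972534695348800241317022204417, 21141627372656529040635622273484259853757541760885145273),
   (252364078798255184867325406273267957926460886548993, 900539),
   (205412622282115907953028593771893863372492382601729, 9238785324183816023430142920507764133591175413188688562023731390263251435835728110458634640752061217892062645192244345271052233808040584016504369271996201258941090932746896283931228463948166908014171056493691618762301828863393320488763780953045298587394694414354254072674478944697441530166525028373737),
   (201010923233213439507944505157076268675729342005761, 1452841570396451149943617048979221327713866265057557192811185608168),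
   (252364078803698378702361495307636676368805226807809, 90802598149778196646326441564566839292608586349456988335235718297),
   (252364078798255190059622264808095586456957215769089, 900539),
   (205412622282115913145325452306721491902988711821825, 9238785324183816023575359415476297635817548713408034034673430152110423543448569167445363407807993143091841617269477931755655695373945770741265067931805138925863262728217868629357882198734063477818766944620846682328102932134484326659985548293861169434666262906037537071821044486104288385949638122969578),
   (202478156249514267515269393230176428771813351424513, 7543584721918298932046957312168244406098108481573741116266253208432326780908743142592334658183271912),
   (228888350542909150150430868250643696907480048271873, 33952923340326813167129359605571239007533039693077962264262248321010985962466758739924969550752228682626524313197545),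
   (154059466711586942907117835189398584230900270301697, 2480014979762733241245552680777823357317769186970551920280643611644931227488814981416329411318437858539100685010786149896890772226893405676054372714833478433759072514935851864765463280623534977222464985544816783262210797344518638695582638250385331300342186884834556161279106158373494568982157492232326213702375),
   (102706311141057961938078557655983420030450831393281, 168227560767028470882743014997720052832561620029740454766291277864569920555351748730459530643454903981744997184539889383019948513592328388640357)],
  [(101239078124757133910391721118040870986184772485633, 65147669168121683550180),
   (228888350542926425227503140588190415471843974775297, 10514222547939279404018240948309750498613590511975202155850775659531814259606130366496310492140457193556307263728487212844600627419872246632122),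
   (225953884510327438053438651343391159954789175067137, 1523414802520029161062991725682789949154734460338123031300434990971210921),
   (201010923233213439791739453241718523460837179589121, 322582093660403062926771706941639035380768901792820913442561759913),
   (275839807058725414561032405372403428407509151580673, 204),
   (227421117526628255654620071627965984509505296335361, 6662895316023747357465180819417359334745523600468376025824086954),
   (228888350542926425226235799472972007415415996350977, 354697649022571080659468598864912941386206843315943682018696378),
   (230355583559228577269259613927117442788063956894209, 2758373427862723902284527262424596909778018535653665640240347044560109990237407980882579605508076701098112293636594558882896017964699294930834535088940440490),
   (201010923233213439791739144965634521730397629514241, 106606319148800814927263648569570519052601229817311043492387789481),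
   (227421117526628255654619763351881982779065746260481, 6638702604375452084828174372488086963822384705338124137545976746),
   (228888350542926425226235491196888005684976446276097, 354697649022571080663649988589637433225244793950831962628086970),
   (177535194972400191350101610300119497747491002188289, 178704097924520436677308721841860655528229993743463284093929120040065839246136904548051767228341334338153974365295035722293575468015775253835512187790357576904787926498466992670957419946010294469361832640459011191871726309164800140181200182768120626109993353419874678039871795657020699648098833370476601754842471399817036409224),
   (227421117526628255330022600500960634348453631296001, 90802598149778196650964827744241149002379430664477365536610438058),
   (177535194972400191350023001107624876100034907800065, 6543016755065823632015229495207522967311592762419985293992791639837532497926400680),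
   (227421117526626936506902942258394658026333260677633, 354697649022571080669225174889270089010628728130680071431969978),
   (227421117526628343619351605196681989790838479323649, 43628930157353622236528281707452561232596997443877888074466162004789550458208564824777576439423233490735193563881471983540475252586425549086346673363280512964532393617333462060438769374304217197827181657322974966845632858627721044267872670015807596019304800054110149681449364055918986092634750302555026594793333433491959017),
   (179002427988701019377630298784376706620066168504833, 449632687683004077234257031027275522152598127351015930629328989651008057413878636092442065561),
   (203945389265815085117638907119938435530095214133761, 90802598149778196652748887360123598853702289602028760353853000618),
   (275839807052920675599203844394593087575754017014273, 204),
   (203945389265815090309935765654766064060591543353857, 1841695488749584695748751451083909175232905943905247478517382818925714844842505203337029778878137),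
   (227421117526608322122744323063860640534586550583809, 90802598149778196653819491591052341810452386132141035439799458986),
   (205412622282115918317260653727866224156675552772609, 432560550945670231226957783437154619625583753249011947982255604082952588942147521868435114258265752983793349699415130739996382265003214367725068404689780857840865684237070754442813219824483358098558336057555350486392781479248500545016381232730271606958196597312425),
   (179002427988701019377709526946890970957659712455169, 569977146423592127525136830030717515915927377880427109422104929549278441650469156518030059747874291818403218563483017460360),
   (177535194972400191350102229270139140437628451750401, 307651169316618019998139841163060688160206311),
   (225953884510307494135781072756926415200043336401409, 3437018313),
   (230355583558526739391031714613071453067822279885313, 1321351710791033061924348123754928393604375093787344074),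
   (227421117526608316950809102295198946765631016600065, 1385537691494418287408565810748430730123622833050384715275449),
   (205412622282115913145325432959204530387720018788865, 1051496383552452697264232679093681419084035660158645803682977334137718249234942962640393096921536556267583953469555788105664604153666815741536340367266809934591918953531274939348098570476132126780410777),
   (202478156249514267515269373882659467256544658391553, 45158241986264997351537967813375220444558053998098013142595775203201564874806269361635457229146084604585966520865735389401041019525731563156203343361000),
   (228888350542228585416588971976199986177347818816001, 1321351710791033061939903533326750854726270713041178042),
   (225953884510310162976366359658327479875156555530753, 8106130954777351359530883794984356254355561376031953931674800998270334066181756412797877607458737504033316666379681449),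
   (180469661005001847405396052786157065815284517110273, 19474249804515135541964163015638553854722501521689992017238869937293553350846705581770146006442946014510207082017328251637000164560768368462968589788547620786491320157805399451289697978828179412745372039776599470288058344)],
  [(129116505434472866436441615329191047269841576854017, 20425653069819982543725019791425055030753852126806623829242669101132721897529840309572386174548184411826113165584228784621480107659934593212179174221992443365077234187048039414603624676999221407032029895636694791470637612853366),
   (126182039401871210381067942262787575635196168569345, 896461335417352802804304175706149507205532059715026682922013075088280441020862952627236250474152551612712955042037403195489127266278914906943857136669689840864888978325201278509931583046101450450222166333440193763048789604522720283338924856276965768757875798875069703706959663791773589314184166536258031645556573621662498491101147362405395435251580333213226744852493272408311584348701407715850277920609684359432386151664291872465108156722671777188580549008239341421534812547996791496074231600272968983495954650879890406836480280677),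
   (176067961956099363321147435078995726068737959461377, 469855930385260895026223900227289411468909782023382465661324008105),
   (275839807058725409063152216962344800628642720973313, 204),
   (202478156249514267493560239602101948646144631570945, 3646015114534144338564713409096578016566308305789971880876038876009647001),
   (228888350542926424900370059994089337743098643677697, 354697649022571080695707309812525203991202415484958588250414266),
   (228888350542927754128365844909962241550158924022273, 90802598149778196658458046592346711423891815532855553807740624042),
   (179002427988701019376362030432499387108800480870913, 273863233203788713208477007953336465447091475013297079469122332926618486103073068695886512622821087423824576541644903007657799729716265276497684628915418692696795540845003074681900095011343374441249842176319662113970526948506714173678057620550353888498508291792053921750773164997294284901431149272874789265364617964087070488782700994852208298177194147610298642498750933968671914648),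
   (152592233695286114879430672250966437748237788185089, 52063908296204730682377928234613789057980601077027312491467518051171682367660807509345806926660290165229542841087450364387251858476754100609615428407629102355045566038759),
   (228888350542906476095998025511369052251388867969537, 354697649022571080701282496112157859776586349664804498047818938),
   (228888350542927748936227442700163141694849682702849, 106799016907105283324671309578569779783398617335154154584988856),
   (202478156249514267493718695927130477321331719471617, 279807108487710156643801050696601),
   (230355583558526744561777895192370091663105670185473, 1231555680035637388965563459531796048945643081004072138),
   (227421117526608322121555282874497585360914406900225, 1385537691494418287512011650292396023016489578383178268990649),
   (228888350542905146888284650199147818868275838910977, 354697649022571080705463885836882351615624300299690579650731194),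
   (202478156249514262321704246995954519214782641537537, 1146089916365660801631023652219309241),
   (205412622282115907951760306072499582345958001934849, 4986731706499019163368858515974205340888023125175975251730074269941256120156151934170045913206888646210011830474526799670360940568872672049102405297714969328178287159246623882343955570123371738868929270588346005981904424681),
   (225953884510307494134512804405049095688777648767489, 3437018313),
   (250896845782294649610246886033892148472266923115009, 204),
   (225953884510308823362508589320921999495837929112065, 90802598149778196662026154936405097652291615501398475504739998907),
   (230355583558526739389763446261194133556556592251393, 1321351710791033062023001764067090118546454529142799562),
   (230355583558867021756684384724657508163988360462849, 1321351710791033062033364876780377752039819646986014138),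
   (205412622282115913144057164607327210876454331154945, 1276603316863748909093175780186554549841715173703672933569449313295754683000077326739461304806988748739089047653221053744216853409295664610666236319447679822079456638043101348440430164679505605659939819506734304411585396003817),
   (202478156249514267514001105530782147745278970757633, 833022532739275690967298630284059433498412255034985775073567707889718957072761588340700416054260727537656084178856260135904871120283484481420414905592390115514240435671016),
   (228888350542909150149162580551249415880945667604993, 471348887719786463530377227580953425109536030420592407499866483191100327858138051364035577522607593),
   (155526699727887770934803723929498627463487397495297, 368782420818537131169688884389755128756610064626571707910664769732782933998763218789016542132610123838840456953402674470111675874622730567076968456877264861590829075294762960505427267499666847767563459532222414446261031286571595688145181296953608859623247793756645498648329672321176953911265616532772307880595204360357156618037860760669674918598218249614504238915525604787343889150639112224928609036659280424618839733207285408342625611803368456497555525668412175632652049970728952758837442014999134356708279174888823137302022009472000392062642317643236722116606968992428805340046899091196790759),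
   (151125000678985286851744146411700342890612983529985, 1452841570396451150320410521202348078350166837922016344061228796134),
   (227421117526628172231801723635713673607961693585921, 90802598149778196664523680824947767872433158589867966147653913514),
   (228888350542905074175767302430404906024855159374337, 354697649022571080722189444735780318971776102839237105068858554),
   (202478156249514267818158330908052761111962920878593, 4817852949246336313803370252556191183725661493893348110016445381691347944675354038240335194875482108956749350912287571558621731075918870538796008684709905788599683648395975802173376898802958195223823805633457343548839686429914830151854463252213899572602847881943445210657231270210560492088671198691233196208536016998488964577863911741135239264538205233443544483491242886442910255214554845592183),
   (228888350542905074155564120989267499938501452038657, 354697649022571080727764631035412974757160037019083014866263226),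
   (228888350542927748936227752185172963039918407483905, 354697649022571080729158427610321138703506020564045042067233975)],
  [(202478156249514267493719005412140298666400444252673, 279807108487710156666890794879897),
   (230355583558524008241616166426871347860556147261953, 1231553956613059830231169534395763545464484367508028618),
   (227421117526605585801393554108998841558364883976705, 1385537691494418287626346525577831346740184887649725584301241),
   (228888350542906398191263047370312775215065403163137, 354697649022571080733339817335045630542543971198931123670146234),
   (228888350542906403383559905905140403745561732383233, 90802598149778196668091968518111940621035245826647245802695351466),
   (203945389265815017596308605859174360381092264083969, 4986731706499019163780364714069422105591642581181150116054337512941496103763412121370475116926306548566177829972803548085149648213546595339422618308434796857206911537656105974208727673942763864879651373258973116959570453737),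
   (203945389265815012424294156927998402274543186149889, 23721424716910456497281937875992084294068079986745396324317445435690481617718426),
   (225953884510307421422074684798820447182950513181185, 408938547191613976059286497788306547039007516364386208554223485460373978447275755),
   (230355583558525337449329541739092581243669176320513, 1321351710791033062137232294954856326374125454291221706),
   (230355583558865619816250480202555955851100944531969, 1321351710791033062147595407668143959867490566251924922),
   (203945389265815017616591015462826030805039515369985, 5749310222127518819750277101110301114450252175897659471505571997010624892221068980721961732022795051152692663925217490432360541642560938598108147144080100572325901842949126905209218242187564611585923968377949733600845088790188356652417345513),
   (203945389265815095501043893485240458762484453671425, 408938547191613977100588279289877571134669445603353393205420347735164244896566167),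
   (230355583558185055102691012879280877060184659395073, 1321351710791033062163193779247530464516777937279499466),
   (230355583558865619836532889806207626275048195817985, 1321351710791033062173535336639369051147451435627498923),
   (203945389265815017636873425066477701228986766656001, 1276603316863748909213552293222962380108076070032011925702456733992000390552930689042613509253825752460151366029000412801258038519304628298046083095403140643634673095058048922360685524741887592708720630421757781098793599355545),
   (203945389265815095521326303088892129186431704957441, 408938547191613977107016031466913532236837293972718043615509159782349716305267351),
   (228888350542906413829000851785750672078396144681473, 471347785803149026564801933725739921933715039366641131871729588685280825801330830943952465375194601),
   (203945389265815022849452693204957000183430347162113, 6394609802825726105576712111079861925655595916462634691108865527661053833450487128715241),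
   (155526699727887770934804033414508448808556122276353, 17340084074755971758310030707089053096486849226006975592579494815115637641832553942074086864175912724851468973633305309718605735496999305222202511529727313201234428753502420220100615906981594963918369249723542429175037597909963139131678232976241216472419472061620750009001283130651858397209131427424593982928346709656113865004352682297520691273651406325192793268076595540222331645000744828359393310827100035619314995058310199279597503730419729781867695467555079211129302873191773509393080858182331426692825420337566333307295767184684245755504110004366138856),
   (152592233695286114879430981735976259093306512966145, 833022532739275691058952661581838674179611809355913386497009493849480286764486367461895916754725658271967217821337115684825017493079882951570747325312973234327410129946854),
   (230355583466307481593542421822351437319834374963713, 16677803307039150952082651),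
   (230355583558864285396037683884389330541275328479745, 73406520497406863584743297561231323668518595784),
   (202478156249514189609345974522259777736686499463681, 104688268081053178142274143415202440272279640337606545496933616487479733362383575529),
   (228888350537803497128103870605248265892823734354433, 132708145869800850334946607263331122370452745686567002820494999672463999780709543779630730723483555547645057627369),
   (230355583379535483220999972174018540955229810262529, 15549472542065497030995659),
   (230355583558524008221413603955753584464339889488385, 322595632517342057021234421702460664646905365380296),
   (227421117526605585781190991637881078162148626203137, 1385537691494418287757014954475471716710122322170593378360505),
   (202478156249514194801642833057087406267182828683777, 2437635682087938963640510933932606443191559172837035935428859833343279265705142696850291683121336193512165971575154643752733349435881),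
   (206879855298414004790735351840159193349825308590593, 147820565186941056424255902698962215978639176696162862721153201086945415446011565167014496054353236179371446675311470650469569624065523258359757626927227301033986793234601846719405521957555540474686175094099688752381716986756739367696855783831430858497240496519619865263659272711455873870396929016527337),
   (203945389265815017616670862595359937832770508882433, 79787707303984306830547506431142334952629292686440085756024103916748453573013618956500134122730320184238531702130239579861944367787480855937560471729450040761903781308990313074098870144101277555991184744619931458219916057064),
   (181936894021302675391250419521271964348955305902593, 54361092233089525361315861176858686916528975820744658957519911877662381321990214398265469390129336649924283313762725937188680512365672544334706525414689455108127426741054659304),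
   (179002427988701019376600643375071644156787287065089, 32822758996729163705730452816914747111759118178328795157114196640993715066182104081578727077133775813900499263486619352059983079611935651008871599220647272089576943505115679929280665549426236703564499132320171748079314059947870650199487696055172816820382424382456037637192155408613176039)],
  [(228888350537120284363428960123534306972726798254593, 35623571651474507889829168033721360805378879114082499535894259946229552011812829545438191822935888335802069573891700735433),
   (203945389265813693621536755421618003404101060329985, 6394609802825726106008071257754272162370359501707281963319447592902281446952025985318889),
   (227421117521501355510238592428061428429062934823425, 35472184544918768020403714678618713386329181859558115115703497911987923759694087363439590521536255767854146570364240444873),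
   (205412622282113187208569000044017631162628460184065, 5808166603194982725822284740935408491003491807525969534300705146101317650743875367796713),
   (202478156249514200034504510799218375645573660475905, 6394609802825726106088951097755724081754377674023041375226965974419052196570436397619688),
   (104173544157358789965765394193926041132310928228865, 741533700460056244531527180758207537546806989703178149853508923785564440696823624399948644942893201888303065109380026014844092149618698952689376070013722477445958911811990368300086114973514736292683520654380901084689169021599724851509659403952529672938326823257781590936054547845894265114884752712766231105727479176047852463068358194822615571691287457077892157511575224786735648596199525429491386612348802949050749610395568152177080859029718958488879860782896169803586373731135493381508100417783730266096101),
   (52820388586829808996726115365934369839726972830209, 1756377686261734677289866713274283494127953471301765452163929767108125848829382097853645027),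
   (27877427309715732526049894220909806304339024871937, 229494101866842317581028214872923830719716429347313232789351933796724519038979941318372476342091549246048307023175355906206535105802317710774990482356243955566189799995523362133812710568537301225981831758250573852248136641823374457498570671126334995906328924775819680005188276597816500054338769329083479515611425917286434543005758350039652562290019585171225155369159055980424772758380427951961179252328949515369856600132849658148576626111053646694678209957846942656430549831567368228807756576216944913797388824900617070787933579330626),
   (228888350542926424901638347769021882549597861249537, 90802598149778196677725885000688527078948176579349025880936340667),
   (225953884510327437727573858524222627032543061541377, 279807108487710156711970808253609),
   (252364078798616745246331754607211115188680296432129, 1523414802520029157758640192861448581083070272902056100586520195653094842),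
   (179002427988701019377630318207431931915299698442753, 65962701250313188452957299452452165580067440428359481418613936269577719570011546483009936795176840456027169780550501015580548783677023583628736228919388527916428533833266004005790113687007744326043368),
   (176067961956099363322415722853928270875237177033217, 307651169316618020100898535522858479260993511),
   (252364078803698378702361495383174940148770063712769, 218106868853445409862956248721671568794430500534884433300085915),
   (205412622282115913145325452382259755682953548726785, 4965551278625957741969776796517468184526284498939233227627199378560148945556062985512144923656575478161101543726179285679212001966404851996678692102175614101560313617255623284621532232973940799748416945517263625805717769706),
   (202478156249514267515269393305714692551778188329473, 471474045119893683465992276207177074960547901501926123646225377719638494432779533933042965871266792),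
   (202478156249514267799148540580283531246137600311809, 296477867851205405246858787003895868267409913440870759348041017484394436477954265409583437325761762587510506),
   (227421117526626926426787714140072192729254971245057, 3437018314),
   (228888350542926420013819958762471820487782371099137, 1597416199967242096743509867107615603202871462583954225869048594912814522227898),
   (252364078798275128763596642221324774712372757725697, 68642399689441796945684966828),
   (228888350542927749241815743678344724294842651443713, 24500248623832054745513217798059279010527858055618532249294345609278591980),
   (227421117526628255654783499055945096536315251589633, 307651169316618020111778868206835830582612457),
   (151125000678985286851744163327197412526138614546945, 170422680900347715276035579223076801580361320281723999105440314776719711655240444993263311464557868684081857138227547611181792834296150139894792446807685592419949456305324707267091705651221088867631294375073178551031646939191662698530277323717475910812567131600649473825491438515968284769327365663203860810009519680551047),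
   (225953884510327515916262569831937053407658255778305, 25309424597712563941495299647329052628519774253706131918145775634963702853618888549483712240881465135099516165277407564415474085385176324422058),
   (202478156249514267799143588824848756207907649028609, 895289168785569229371392425633127442272132916209485215085030737234857),
   (228888350542926425226235818820487815728808912421377, 354697649022571080777941307732106876825615444637715994101210298),
   (252364078798616745570929225658677048367891347603969, 449632687683004076243036970127012624168824133014264850014573521684152685334727664620349947578),
   (152592233695286114879430998656195695211701789196801, 170425508427162586913003034402905576921745139355552089773756756987606376960420168699966115860124618978352592754248920503826681095015992766824554418523763424794242905131598932523269535336091661033212255707183625540107902078403853518770613066464941355221870391388149581894225602577970004979412783821725478493461312706177415),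
   (275839807058725409064420504661737928453301324677633, 204),
   (201010923233213439487503639228394916374719225856513, 9053493672795291994811973654428271617903610577436338134353910876667916172966103317539753),
   (228888350542926424901638347693482465567757247382017, 90802598149778196680223568462923956870800177025887612694443121851),
   (228888350542927754129634132609355369374817527726593, 90802598149778196680580385829289089580295248059340179870229257386)],
  [(227421117526628260542601887986955741616290127872513, 279807108487710156737259575692457),
   (252364078798616745246331754531671698206839682564609, 1523414802520029157806523177485813317416452594699172503104174185409072570),
   (179002427988701019377630318131892514933459084575233, 4535330800933688337084661951701643475039063571183673696718905215961630198284263947313890429773286821006054488852935218636740112219785299079379382199477596150390645557844997873763003842570808879977925262994251240),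
   (176067961956099363322415722778388853893396563165697, 11024961422427977873487764801049554187569080369884993893439274071530018941407255955440475295770770580804535109488110775546306145400536560648744249991),
   (228888350542905146889552937898540946692934442615297, 354697649022571080786304087181555860503691345907490356313513146),
   (202478156249514262322972534695347647039441245241857, 1146089916365660802018333220173171897),
   (205412622282115907953028593771892710170616605639169, 4986731706499019164505399444046708786259924477058944457141729991194992126614503242155345042234034919256462906172031354961837337053636264472825219073920217248599807867261189927309772056883619507680386014424782248114326283497),
   (201010923233213439507944505157075115473853565043201, 1452841570396451150760002729207030379679379924900692917423274403304),
   (252364078803698378702361495307635523166929449845249, 90802598149778196682364445805392326289330307078085169501547846809),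
   (252364078798255190059622264808094433255081438806529, 900539),
   (205412622282115913145325452306720338701112934859265, 9238785324183816027242075913431768567033474496555352433018900030356737031163880339648504042899526593063746242896759291828260212704783932762188926459951443178624369443026984831751418546490676868994930933655324522738164108353088467974984178345385243533940468122330018262567583509454133059644894113638634),
   (202478156249514267515269393230175275569937574461953, 408938547191613977203432314122452948769377476831256265491657780345930868683122152),
   (228888350542909150150430868250642543705604271309313, 33952923340328781711872048449846308122571294097292552595965658059099978042135446216591432951074630562504447195556585),
   (154059466711586942907117835189397431029024493339137, 2480014979762733242639132584408023225808597970459955411744648742073032138148718790156436771047882123384495785998899006207502757630218044861237355996354306837072208765954791902680715397028677848964399805356558224743248420422075494456306359818574378031001745881588930529791610264743795063787822974970690489492455),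
   (102706311141057961938078557655982266828575054430721, 449632687683004077456879761189351947680134385513947403231106671042501189814880164291705663077),
   (77763349863943885467402336510958933076052053000705, 767528256246996754338048956507590060986206470328171265889805174016896234293408234938623224261173791655215366513516262303152694240983037623214990886629030331375802102580782709175536663145294952514988890409400294099260198438199585338418748628668411776742230776023950747486061840849475827624328309811502846536189200173234138988257854580324),
   (202478156249514267799148521237470489469664842940929, 618134040792490729972113822358071455615787848256235048059723826704883621359185240417612330033786830450788074),
   (252364078797933517168679899499175454521407951798785, 1495577356711031741622315765305167919218634476),
   (227421117526626926426787694797259150952782213874177, 16677803307039150998416586),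
   (228888350542926420013819939419658778711309613728257, 7194123002928065231620640939161123078987733424934030453853485008588706293099920059247142056426),
   (252364078798275128763596622878511732935900000354817, 1211511690206607942120791499231506098970661433068),
   (228888350542927749241815724335531682518369894072833, 353526060141392455275695570702793660010526240692212874109495733439557852524349506877212800236),
   (227421117526628255654783479713132054759842494218753, 307651169316618020151673420254118593347924713),
   (228888350542926425227503140588189262269968197812737, 15065012738729690650829566706921419837918433170284797770971825803685523411794941161408497386),
   (225953884510327438053438651343390006752913398104577, 307651169316618020154091193187239858844927977),
   (201010923233213439791739453241717370258961402626561, 12683971153448210920675615069494761286686382651657029929619637514788580798436192599756318672486044322424239680865721971362126261125484530096642729),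
   (202478156249514267799143569477331794692638955995649, 6962758122996052270480137407153087884901278320866835549730998477179817),
   (228888350542926425226235799472970854213540219388417, 25938295286113442246849231321046722888831934744476424409504954),
   (252364078798616745570929206311160086852622654571009, 449632687683004076267772424678699926484984335861631889058532007102617237141493384235872874170),
   (177535194972400191350101918576202346276054775300609, 8810792278465095546137981054437898354368053601725235870964002376958475995342573403954275533957365152136055123156051458663503351113804305736000359376628604927019982496912664487469599552989445064098687656396834044142370931473853240074295140079133017131369898474216543793675393386781823569830850184),
   (201010923233213439791739143756725995657966387397121, 404905962150886470707837024068925199997993842247022719254071384213043148109159553079953388421702336962925787834009267450288753362390090322254505),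
   (202478156249514267799143259992340420091643940766209, 895301122892229319882469414557986328118562988412496464641098152463273)],
  [(228888350542926425226235489987979479612545204158977, 3335256587312394271090951488202988926499358012991685345991866),
   (252364078798616745570928896826168712251627639341569, 449632687683004076271306117227776885783884368991325304532701024410337072764121206889311620794),
   (177535194972400191350022690413706528682534940901889, 6441144115987251161554232306409307290470536276338243251059589220305921563876601360325020070272259799374339180354486780488667241872030506527988393),
   (275839807058725409064499402782818037060001985659393, 204),
   (227421117526628250158087069038380593161998130414081, 492164608072247394582121006714260494414529149799603180399348650),
   (228888350542926424901717245814562574174457908363777, 1597416199967242094264054681629876701487732589459666910146256827689570560433338),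
   (228888350542927754129713030730435477981518188708353, 492164608257448918459747248643272222769436270407573156108491946),
   (227421117526628260542680786108035850222990788854273, 279807108487710156780140529175721),
   (177535194972400191350022999898716350027603665682945, 5359476818756212282823482221267406017189686771913927567134541777249984836060881367931785513802149263018540939264982231720),
   (227421117526628250158008150360876150169473311244801, 853719783247643288702085144039668501387390480102922875048938410),
   (275839807053280896385982327224727228879065204326913, 204),
   (227421117526628255350305008895703778699969640464897, 31357476835803685333722861738036944989856344941526014966904008204553197892397515976377),
   (228888350542926424901638327137058131181933089194497, 354697649022571080807211035805178319698881099081920764328074426),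
   (228888350542927754129634112052931034988993369539073, 90802598149778196687003000446465909045057534921867974533532409002),
   (179002427988701019377630297575468180547634926387713, 12876987341159213865077623430118821252051824778336353151806138107517433200335953554370885728028410598049098394261195441942477489457369193565992138484023434146917067313836340126000932242633071001760991248490307953522567841107976158138504707904767253062931240433090379578784755841411338782919509417593037468228280116201359061700093241252912085656),
   (203945389265815085117638905911029909457663972016641, 492352946990783423038183158320984456471747311149411759972797354),
   (203945389265815090309935764445857537988160301236737, 99838512497952630893857336366173744265086637208741156693678169416308357778617),
   (227421117526608322122744321854952114462155308466689, 90802598149778196688430248139171868926115820891318595569821998250),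
   (203945389265815095502232622980685166518656630456833, 155001096961461905203047505899442081591484463719537950304575598542476431103752807306058730283140221556375492582679028344634391252835428080119306527475430722742473869815365977560568427812731250395253192833898367892600790839241643741542558340123127777124184869532173156675193807085408438584525010487075433304040),
   (179002427988701019377709525737982444885228470338049, 1597416199967242098701991546456299061683865514876900023256008574768642775628424),
   (202478156249514262322972514138923312653617087054337, 514631536156108278932880657564337546963049302119179568926354632178527816889),
   (225953884510308818171479997929063164404176045408769, 354697649022571080818361408404443631269648967441616981935840442),
   (252364078798255184867325385716842470338760951398913, 900539),
   (205412622282115907953028573215468375784792447451649, 36089005172593031359108805720829307432065420553926555776579329181587688254026441445369123206295254326644887927667028139917417656238221902070995340401218124915422742426911351466555737578082248364108719278285756765537196061554442873028797549357678912918134949294458254560951059164690087084934664771049),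
   (225953884510307494135781071548017889127612094284289, 3437018313),
   (230355583558526739391031713404162926995391037768193, 1321351710791033062443577809608411156457424753552899274),
   (230355583558867021757952651867626301602822805979649, 1321351710791033062453940922321698789950789849737776570),
   (205412622282115913145325431750296004315288776671745, 122274305659268661281453234216391833076836051441648477717890122821171726327589934500645923142039481733323191452769129463145162110955298993746616837437978128221732709198689068075613197024468514867429082812106094137118197125682369845887870550317976805685310873501702612376976477081),
   (202478156249514267515269372673750941184113416274433, 45158241986264997379930105481172364606641029922114332602242565164303732423412003932686942890183328372329835311079261051954590714424017312122463450256616),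
   (228888350542228585416588970767291460104916576698881, 1321351710791033062469517812897303272836381338728582586),
   (225953884510310162976366358449418953802725313413633, 8106130954777351364999010606941886065287974864718380507011960441667997204645379181220821361701685090443741718410481321),
   (228888350542909150150430847694218209319780113121793, 8694852336422698540414258813325941051827013150690488321871070201934690926544684344463449898321892633948658123831205353)],
  [(206879855298416746344947178358223792941869115310593, 6394609802825726108569266191133582942864268289098095422376787591728433749944334092033769),
   (180469661005001847405396051577248539742853274993153, 4124927787619463702629278798241037403890995577011669124941618331935778048800380874761147737032564462542890025363843143742859535748278121732324374661216359066217437508264737577404505012554634982936200),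
   (179002427988701019377788753900496709222822014288385, 1452841570396451151096833266353404972634422255488381826176009850599),
   (154059466711586942907117814632973096643200335151617, 8294259116862553170541834994619095877605152460780962968113925413005833670194508855371533322971066164812834967159),
   (127649272418172038408754778796006604994716805300737, 232492516763384459940552974530947799851397291269178080738896456095339662229064133393073272250584208371829814183361231564921574023309788201320170438008475229664604942145340290676149588392276892598186724723561553139970071390115725464018193915886945652838473754006173486235430279794096680469894676666351082858961670557377491134488022960678388761725893887947716764771035393429157885321654933830902449914132890714400610656937926451480903304390030695546718994339114004792990993025118815854714589895033004980966355029634971910847849389935213700869598534787116202849664497472543790465228154861062473750883174715932042470101741235177555473289228932576556223043015789772228468285819162133171745583676561606634906589259894),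
   (127649272418172038408754778800987225894618384237057, 8623626731675440616750608495580634000000858558079721893930444787959944208328775210492835842148857855747145734147801346050855157312251875657188056780838053229150907100428493261640024628228096893231427242160017286324056277303060384852669583418303683164475825335909946491358038849496376755921050857405348675300663323079605619518386204084707603851289114403361082887794958843812549514670078478337549118186817676449311181256121849464606360385850174483826760061186372158564906578378871379195342272171318976721583386456807784404006875702334059272766453112768088977211076669686451387063112103947523308700907352107956059208255868415939720827751421675636),
   (126182039401871210381067942263063123594426034881025, 4922418709065888323355229753529931668697214565),
   (225953884510327515916262242213040009900745948332545, 817800594406625306931258239080457865857401601135628189478769619460626087682439043199035740104077653191493333965122318450909602301252688524786090),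
   (202478156249514267799143261205951712700995341582849, 28928670835166345150632271928234086772999210185856945921743378113678249),
   (228888350542926425226235491201590772221896604975617, 3194533572065245045084363672690352222332309804577252627923789308638437771302969159465606423773510094377753304187975856234123105408337732591306),
   (252364078798616745570928898039780004860979040158209, 449632687683004076317244548624873791988889038426967274272651508186319784592732871481115803322),
   (151125000678985286851744145198032556847164677095937, 170425508427162586941130491681349265805185016224118181547771519773673208050426515494837633451137857269245129727369881296332163326738166058294765253717937007675689268242357144518517593918192094384608815747306440199475812357341298584225396776342458357810537176097102463725715992545822988513797436392758436407073950205995399),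
   (275839807058725414236434934250100844783377645240833, 204),
   (227421117526628255330022600505663400885373789995521, 6689923755978534142489622468820767003224595584992387653172054954),
   (177535194972400191350023001112327642636955066499585, 120697355550692783012351040473061809153129745217404276319891042154105329611892241745013322555886119592),
   (228888350542926424901638328350669423791284490011137, 26132514666156974683919959002563114660563991280775339453504698),
   (179002427988701019377630298789079473156986327204353, 12280452099951948038283191512402562764158772700159197017547945609067452975039269428469060006514723686236765942883361897992358288970061480967399149039868316380922557859001135270184987773380933509334153863445187257787177505098477362620177879056106007592839082555088805279350261247513978296270407462311463786005372764230909264765681205688984),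
   (250896845787441420390832710884189840696317468410369, 39750319661875245984888395903854279248911686338692747043955930682490249872388434229258018203622549038125052169145528),
   (202478156249514267494907736121196299031924021854721, 78758699345054213177397495512541176091101686666),
   (179002427988701019377709526951593737494579871154689, 55306239501284818284794013689083873860708082569701768227263887551225561174321161233133089085116259628377006969600870193957053033102321440659838333810209089593963144280861436528226822830941557527095122285315569140418689332408462721294723143441316573964818994510903008226195451467361528501889658613637720997177245577438422994369253850975449352262056637162),
   (177535194972400191350102229274841906974548610449921, 307651169316618020226626821070225602179722983),
   (225953884510307494135781072761629181736963495100929, 3437018313),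
   (250896845787400214343325016258295757438989572964865, 1445467051732835421637116648679734873881610186488753626997166253211523642573910067007243563078097371824459269689035),
   (205412622282115913145325432963907296924640177488385, 432560522792482123412466312728563686585727606869620992319574217481238571475723547441688546543400848755979199954862303529743741579924432714332978147664062721399170460765860765582535577413700758275861654593783626199913157260608331808274433185349057617945758844963738),
   (202478156249514267515269373887362233793464817091073, 176399382758847646034760661602059682931763335040961556790262917652142175338705174467289227539571954202157129777775903542748281697828260583712451949288),
   (228888350542228585416588971980902752714267977515521, 115105968046849043540833457865353057445709714234987940571343825005663209928613297340750381846202),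
   (225953884510310162976366359663030246412076714230273, 483163056062302074787374305667546616923877430951761041872421843693416661214236821886388743777024819960304447145),
   (227421117526628255328754330935470869025960765882881, 853825686351994839510495078405199588286024171250991658928294826),
   (177535194972400191348754731542135110777542042386945, 25558659199475873583349251163255073280885043813524789477009260844744736157444776),
   (227421117526626936505634672692904892703840395264513, 354697649022571080851812526202239565981952572520705634759138490),
   (203945389265815085116370637554448670207602348720641, 26744529721286663585225586376710922985791808305822202421293468586),
   (203945389265815090308667496089276298738098677940737, 99838512497952630906019220978485438245018489276281173786105013367794062511289)],
  [(227421117526608322121476053498370875212093685170689, 6689942927767134393660745501451281332603356473270413196392193194),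
   (154059466711586942907117196876620086794635415060993, 32125513001067342584841799626489665317195365137929240099667340150218784601982636830379043884375599549374668935927291196652564524979130482175750155827052280301191943108894918970433780336352949735700352315730123374633534192576698793031029122021021402677156015457415091890042010630703101161063626711970129041888252216112186580618531872163209463150333367320809786321654537678413821053472145531109493292342396070551523769309898551179280853764928152615670310489898179745219403650207147953012409416841206001372891803713799347561361334170589232718557100659884035201741136557403001077469600406193761360905094855609506091543831992814217562073735),
   (228888350542906481268012473228932564546710768124417, 354697649022571080858781509076780385713682490245515770763992250),
   (177535194972400191348913187867163639452729130287617, 4594662617918335261955038390086429093294543323362704725758260707876223411056253574640517138423375327070020043157427751315917809365913720171137422425090786949956475019857810348364007719862840799005770220323996653258771692371127315996234224439312503628930575413970935841620450061356971028909522786422994186491027661463317600278158277939940718614433079545270482792053263460707887932895362280),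
   (225953884510327515915153047937895649406657461682689, 6860850336959901067310982191735626428966647928650093744569753426240668667730279353076647),
   (227421117526628250116333519122020098746704273277441, 13583900602479326721823820920542311826172270700341545079436856234),
   (227421117526608311736961564591229882488694570680833, 354697649022571080864356695376413041499066424425363879567875258),
   (227421117526608311757243974194881552912641821966849, 90802598149778196701632289296701997825904966108736840155500698794),
   (252364078797914902519418588500449526905214811177473, 900539),
   (227421117526628343922477936010995809502741471101441, 1233370355007062096832859608364231000701305914589670065180220738905263371167593894315432138838254510917714535390641865765109921671778173026608959368195674952223927394279182365288285838257974380080924703010251518880645875339925493252610433656497488467804139228735257982021404543762815553827847948451600054080092147889727305870608879322005850662189345369185506098764274688707763087316995606422193639),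
   (227421117526628338425944933421393124613036372591105, 1269727684983836866929630653899861359799586060438157473709149064),
   (227421117526269369023194947320598009597210243826177, 1321351710791033062635692793374199778713053127666154698),
   (227421117526269374215491805855425638127706573046273, 1321351710791033062646055906087487412206418213957717434),
   (227421117526628344267278899273074206709844742963713, 31711195937953038492025812536787041761486713100752671168101011743784833135695017078217484600652163902094292992579310810668997424705339669507787012072217675622424951738559416629047218597832735355990574032637345074509447715351838323534773794262361890252142925009552628656411781504097349264582235352674155543309167407682468930040267330059476271008841960051506941890676470796725110874581470422351003108762725317134995349564430774353857914218414569605674367241095),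
   (228888350542927754087959480814074983566224331571713, 13198205675833689026572266856645705898608062363678701328154811562),
   (228888350542568862569662372735694296507843141108225, 1321351710791033062666846574525408744484236107252088010),
   (228888350542927754128524300021378324414118834143745, 1385537691494418288573692635085724029022227793115114057292984),
   (228888350542929166433269821494493284709120382009857, 1051496452005835385280389646111140983607288842559986101017124146124808692876031138801582272944278812529287373281664647860117409716319613692552354780215728981865286504527418375936770293413104620133010312),
   (228888350542568857397647923804518338401294063174145, 1321351710791033062682423465101013227369827597045054666),
   (228888350542927754148806709625029994838066085429761, 90802598149778196708768511426678185026150149714008788405916064938),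
   (228888350542568867782241640874173595462286721614337, 1321351710791033062697957319351386641629031564984634795),
   (228888350542929166453552231098144955133067633295873, 1276603316863748910051318973618160213029926441324667219012024959926720801964622316159869129951067322175605905474074817510212405718314861068484894688010063325169332317813995708025826701921262207320113993914439693852228126100104),
   (228888350542566198982221173180075871635068005057025, 1321351710791033062708384949393687365512480080033332426),
   (228888350542568857438212743011821679249188565746177, 22480740579740262686901806133716344358390600497696022264265153745039715514),
   (250896844475271412727779709315461708701069157270017, 16677803307039150958832858),
   (228888350542568862630509601546649307779684894966273, 1021736859930338773530521605901264856730006810382494891),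
   (228888350542927754189371528832333335685960588001793, 33973285342669017793881781018398300105614248160320461706852722171616772208918818487671623027938519656572942184322792),
   (228888350542929172294886196949826037229876003668481, 738385919180848795945473427311147734816709857592840203957491758111915543138249981656107419349846638901502754644809924431993010316648198617204071068489225857722145529840800270539916176373933845168129633078982225914788982237749872261482513678391173044310251432797590984304938978085061867883931168263244339709281334261563923668939432370499143277127468342919486551540423695660162956476476918013587736920692924023505328485821118707332101380250765026293452683688168264845115373519471617978709567594577566510135943),
   (227421117526628344287561308876725877133791994249729, 6860850336959901087207533848800265868138729449348912412574591243251603983577574055052265),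
   (155526699727887770934803722715886181652260219716097, 873487435289618747611340147181939895390150124144580685440126934537163769149067080045752546300603552861935406011377518773653087510108724487572772786516121619393838828762272334825),
   (151125000678985286851744145198087897079385805750785, 613383736643999622936197578756573750537226699936618826774362380818388056979098018746490729884727140989283343590904149474824909273296927350648416605424324638118061621664638973334155051747449152020748636032273918221063030176283646069202491022485558149864402140637491111689131624492327382285996795171022542655523065650724569532725120182889212948280854768282309079238405981639466956918187009328343571778692723429703253560152184122007583429616986532503553974046692287634841785080025353846),
   (225953884510327354609150089066180410444305433559553, 74729866424388153639958551630702407880087043848997469167097901346965113914727401792654520)],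
  [(225953884510308828534523656008505154481297278829057, 108606822105127903873787052099465976777947903531729893460860087),
   (225953884510327515610917522853140235737586141954561, 279807108487710156879096537992072),
   (225953884505883750672385202648845623244126324720129, 3961052300223148472609635837716943897011332095790283),
   (225953884510307421442357402673869493140739311469057, 1385537691494418288677138474629689321915094754638282162494648),
   (227421117526608233811944486331531756373492579369473, 354697649022571080907564389198566123835791914319186722797968570),
   (227421117526628172231881260069625313479396784538113, 1146089916365660802594793972476595384),
   (227421117526628182616474977139280570540389442978305, 4986731706499019166210210836155463954317776504883398265259213573075596136302030204175159646294181285721780571187913301845594468082805262749297100000496882251746149741450420992578450962903403605765667976479704577845001168104),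
   (227421117526605580588814594241916918137762850472449, 3437018312),
   (227421117526605585781111452776744546668259179692545, 90802598149778196713763878352478272605639066479989769093226749115),
   (227421117521842961872214099204130205971274705076737, 1321351710791033062775884808554640124683376535802854602),
   (227421117521844291100209884120003109778334985421313, 1321351710791033062781055624200672783235618013052849594),
   (227421117526628182657039796346583911388283945550337, 147820565186941056902310721875926129754915575487819599981860585592392975928968462950671316724781252593760382004262194426151732312568138306271943115893951265359466708527045138798540786154489145639050326407836940892977310001290197105963162251807488760607451024326116757290168941789439393527147133541787880),
   (227421117526628343618242410926240395833670151373313, 45158241986264997394126174315070936687682519939097112274723248524492154717108731390251118102603753752629564342521674843976251524101752970581483710555623),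
   (227421117526608249469964700350621323660770572173825, 471347325567355757925755215241109220378707589850089708702039087023527298675706439022332154034236136),
   (155526699727887770934804341685905824342397669278209, 4654693074021623596335942517349704500303577548242853603386631992216738897897302230115205779837702585747474857865073360707143370210873681868537248495661490915800860821041173958909368038682726643671293346993677841800913090066490466551399235274447604873623758907873093584099573172600559610076914324384253580324416700138562140435626595367949180291411208884095040962221829215473567062650898977663759721138105111832561100037634765925405662225956244668539290040069261978058880624211828810066234751874660934164797957008890908228389799675260197893811587737334035945425699305),
   (227421117526628338426025090038936852985836090884609, 23650992125960078253788158258783559010419577138601301382706036916571043588197511),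
   (275839807059067108967918966370013916146226497257985, 888200),
   (228888350542926341823858935165807092491917004571137, 90802598149778196716975201990632610555711708534523402175019539592),
   (228888350542926352208452652235462349552909663011329, 2946910909100293520658117183217550464358823373498417254154465522181597230927483535605475317110580614905609982007851020847435067907269917567367056124900334472),
   (228888350542929161241053119577209384551423771083265, 597664356288264539305978612169481596985553832060541855803904583494312709137446249522639848580331301939505607323839596149592673159),
   (300782768330034746570886017524339748914480747315713, 1359383778511912544099968454411068164938204878769574222760897966046819827079),
   (250896845787421565087101608120507141777229271466497, 6239907031122039450457581097417014978199595263658638587388256466061797940092),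
   (250896845787441514500104387037806068662543673655809, 1500799028351023858869321164574135286486338350281775818673455903859260807224674960559697438126773161372563057250113401055528184165868),
   (253831311814232932525186320660420055212648239923713, 1321351710791033062838192370857058056225742494974721496),
   (253831311814232942909780037730075312273640898363905, 1123876915111254218568581010643178469159604810872057016),
   (253831310332623573784627564348576097151163325153793, 16677803307039150960405720),
   (277307038675783742391947360203200353391993835160065, 4901495430871468667516196362524652172393822696),
   (253831311814232942970627266541030323545482652221953, 471474045119893682458123378319673743397319151984620572026854772709246826927062656342421791386233992),
   (253831311820020552240883687761654726870336819888641, 28102042980187754856735752774242657655063883107197860523661600416772316442269237115082749927),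
   (228888350542929172274683943963718095178728470675969, 6920945757662788242830331761720053758784162865181588659670461497605264686706898029168411715822573290802221420920978683060990926954348230620072816690738662161095367344775841087749503165732560456257541907464307596591206016881286362318295697077913503062609823176831978),
   (225953884510327516260034167817517774986560451838465, 102464400315410458473457250408973533974905593340741446775825535727595675704767165993911378777468349815526236794725097478710867275130547086059115655081957129850452212475610723450389203479994108886820585933721623393308817022333402091963904103937651555564748361195703440392166846103660837715991895153268851354735891567983215696238839086748063011175169880209081015630545506735438717372833112538385726524139019489221084730088337345580521),
   (230355583558866938619167574760391722965777879597569, 1321351710791033062864132374145950172604699059829001658)],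
  [(230355583559228488634021071877821558486174133322241, 38280121126592679861039666396582596262327197503295981701921184594849015087064711174760701203601215753686720911864652236803308368327863354600),
   (230355583558864285396037682670776884730048150700545, 1231557050193422387574932038295782244939688926639930568),
   (252364078798616662168552342003996325130999439753729, 115105968046849043571139375337092617157798429303580347543585173948966283075394128859463657177576),
   (275839804353118974527217386087287476365996534727169, 16677803307039150960864216),
   (230355583558864290588334541205604513260544479920641, 7194123002928065243550509134399023280439481515134753510094640003252996925322091890621677489595),
   (230355583558865619816330326121477417067604760265217, 8697161047723268532164825676548777951620765259094935322261343663819581644329433622110819621518294873090717969611148728),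
   (230355583559228499059179608154780156395061294334465, 5808143870885237312015900586121738057140837519555344060321354498065539625812563255870696),
   (230355583559229994440674866185137173178004109722113, 10774896202588765285319662875232425942301435654151828514473043375352575073229585282081492027491872974227389643180497463232652504250655687024107674354827495),
   (228888350542929172315248763171021436026622973248001, 367751822182296875306488215333396394086161703694739627311155860597052598037558330755371271297873378849065566910089240087432248828557176485832508039388778647724874236246829021988597367055726112402008063963667245799920332635881781939916839971685350977573621716982761),
   (156993932744188598962491177010181740545091198714369, 32399449675244348335415145475611105610238348790833269842307187221325508532625057712545866298180739494850043625),
   (129116505434472866436441615338929774938884443144705, 114132749477375279967070465837063613529381502522519905812411614988268493193961875097431784299225641205219893903078746010524015766216311015907345913007129822394917822779129284349487029359402080270048287659700590537613667946844011103609556554211146504657667184849191264649347291030535467294559309468324038340868872542297608055505589981852539611292266934400851762600005295991689192975366505999359681341050742387322482826212897111614931303793158949601508795561020210868470959166009219363012720453230265037646753144880628861443912327859446187054015451555381788814853515854213530244110412064077214979146079385385886452375010916),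
   (127649272418172038408754778801005672638692093788673, 132708145869800850782903405747834891602495525083654567326141662108422252453370523445402081956928558745293887891045),
   (79230582880244713495089173048901554177912149836289, 1452841570396451151701986288060731962203158476125540441892173590245),
   (76296116847643057439715499973016311974191956165121, 307651169316618020334221219015927598728556515),
   (228888350542926425227498187548252429767665030201857, 58847706010662854172950887803695860423434064441871865485833131645975084574261317491427050),
   (225953884510327438053433698303453174250610230493697, 307651169316618020336638991949048864225560553),
   (127649272418172038408754777516208467269439524635137, 6317972440569148501153695070477825426789390212328593061945551974916534659654741906445776977387526220640298813395404173913290536540130606951575646223105666802253557238548892726735033656237788329938095668525629807677114769416992409734285050863130253367432),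
   (201010923233213439791734500201780537756658235015681, 6443429983799031009643552263504345732980894077195754350998653648336601837568112289399715399043254788582857172719690729448375453966790549020908201),
   (202478156249514267799138616437394962190335788384769, 53232878391805897227532329863205879598529710972611897052442238706406598897708752040324751898702350651290755481171475387577157761700405546829610172074921),
   (228888350542926425226230846433034021711237051777537, 774640333718909200433403928842856297151432155169050977413711436471652344817510292908013153914906970983689287627304186804594618212318025920202),
   (252364078798616745570924253271223254350319486960129, 449632687683004076458592765758903359468519165012232309362548162546460482054811839449831317178),
   (177535194972400191350096965536265513773751607689729, 1318241451722595175357474785757909945981234683491381126809929678696151712152069318410108713347419302285229612527453587058457580340852648541065456904916805895556962320109584490747580562036051336019202158063130010812778877069533611373114529305485524409524627241833789696952070604876124819019345544),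
   (129116505434472866436441612840484383472133054071297, 4922418709065888325521624822279348180815257223),
   (126182039401871210381067942191932551066745995198977, 307651169316618020346310477212073890475659493),
   (275839807058725409063147882882981724648861935534593, 204),
   (228888350542926424900365725914726261763317858238977, 26132540527370072844522371481274796768323176491758344565742778),
   (228888350542927754128361510830599165570378138583553, 7973537834635450391808663923921398978463428662680497854594925000391821954653745410127413758066426777179869326972838890009128135956932218109644),
   (179002427988701019376357696353136311129019695432193, 498108256942116407554681968622117265388199955197110315744081348136816880620670353930835920463870534252784923356775627587765147839397612775448419647278741679354259363790320510426919539864191530616798655697509448673851540210459572912195867820570665897759583946695266670305812581572603039473250211157014436772984313409521158124730340496095862186669454505413793946220771270476163585620164230586321426425851388225272360146179630375549592),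
   (152592233695286114879426338171603361768457002746369, 2151072333609642474486378470837534346505698817928000001758088309777815191902048705361622506188859813938934705547784115689191432944900226693799250800461060271387495601017995858555185385802685359821325787308148218118062432651124077316513302831870115906502016708519210627821511318977647391386263),
   (201010923233213439445666508936271012682083233628673, 220826823858320491084509890202739985113101138958460489631265966156828736315793990469941866430228340037927828215674726909686388395778565189797169941236649),
   (228888350542926424859801217401358561875121255154177, 1302414973524355744474526472100796812724884515495033291279913594050537335940711761095025087120838140512170862751434),
   (252364078798275133609577900860211516099711641780737, 1211541037072190834579042114890670853443391048428)],
  [(275839807053622513131358799403191566517241748062721, 1495617016568090112493972233950199641177049834),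
   (228888350542927754087797002317231465682181535498753, 449632687683004077773141713812102694361342313026975114366987658950053441797047817042225520620),
   (227421117526628260500764757694831837923654135644673, 1523414802520029162978536812832395046089226152536569075838555516258012329),
   (227421117526605653301089925866292227414478465204737, 3437018314),
   (203945389265815085136569796823771087085100347884033, 23628942268368638253209402431829638672373807929627836672592593222715229512387753),
   (205412622282115907951597826362043618650688028082689, 50957927181647892281410461254204651051941982960117633629769772600982259925445189232039895700173445710264725855453691985960029751514776738858884390891896226559240626095635333705000753082861357543342062368979660050634991779520626103711951599036572754040210425997135334639310677465255387463341228799747635687874951296328476788480264745385300584671962380126441400872201056492394161405929465202383093110918531680824393427415596379747694582820672749943012434402118604238506643941957931268419221363186273338656390252806844105),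
   (201010923233213439506513737747226023953924987486721, 10027144000949172443086404609211167376630676967513792803347986140984500559079552159467018867104342454732384098556416406079795734262893464),
   (275839807053602574772269254476053020683179296752129, 896426),
   (205412622282115918336191543431698875711680686522881, 11030253545986108124298367716251801130724049165072315821279398703241245888165987052346748081389551169268096858790275178130296815889524137733766394790849894981174318681728670386929629498577726745318924712094315840460315527228887378260651365653223184074423131971738269651133621263777764292305923335403),
   (275839807064492944934031928757581540458552489083393, 8697016753266982908295288103723942242871637913684999376866412571872412105238462200906836208394328390706160215907362283),
   (227421117526628255330017646256819195512515157230081, 858439357569830776087113933599219897757277694418342155205331882),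
   (227421117526626936506897988014253219190394786611713, 3353278734874347319482750908156090128188287331864170917059770),
   (227421117526628338427049792417712922424403676037633, 1146089916365660802914549546019900600),
   (250896845782315932815892468471397176552913270669825, 112247991095518424097918277931387660178810501083847035418452912138800570),
   (228888350542929166434374680490813082520487685456385, 23449154453341119295645632473014200942243558614397461906761107916204077386080396783019216889528252769128505205450422467722777415554672186092311989774282501959018092220740548569580634263379092077219194729287680010819873414471666749086970327976872),
   (179002427988701019377625344540235267784127694438913, 569977146423592128226176934332370233820555262714771034783486049576177310392446792770162665119732295008787232228720539122329),
   (176067961956099363322410749186731606744065173029377, 1931157688811084529184128194402366990276567654351463129861106865699232882884090907511456296452847479431),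
   (225953884510307494135776118512784976364104862335489, 3437018313),
   (230355583558526739391026760368930014231883805819393, 1321351710791033062983576682896033229824596399709076682),
   (227421117526608316950804148051057507929692542534145, 1385537691494418289112699904288490555148217566817863655546041),
   (205412622282115913145320478715063091551781544722945, 1051496383568181606627109666307186204412256537689722355448615310222497330612703857801633130625903932195453013850591556187130622819896815114146637843368835573051578907482885547216321083203055099721927577),
   (202478156249514267515264419638518028420606184325633, 45158241986264997407080052523553065883105042846209082096334564486256155096720232650862347376452520064254004824456989354056731651499889712979061868063976),
   (206879855298416746344942225322990880178361883361793, 5806330705501124853737168196568257460351949379898697674718208659118288756856442627290601),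
   (130583738450773694464128448169482666157696228721153, 1471823416864644819411852626011412970548982979712760580586465191089371073034514129044808072764375934746278364732954719984511452785939229720910590399010338401818101924302393965026112943786557682117186106917201290295372506671197627476836387909863),
   (126182039401871210381067942196654917549615640412673, 1452841570396451151953181881957032439088903382984978519302642849509),
   (201010923233213439790387622652686230115066807779841, 10732791205147996191209273067971884776300383431971553086884722068913051772420696383238716163943763199851185396284263218611378180466961634990791337),
   (202478156249514267473352413392388192103181884523009, 895289167273180056940062208379643265429352555392027956261114916686761),
   (228888350542926424900444643388027251624083147915777, 854020252075657869395799488048562250260851388516370992132316347),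
   (225953884510327437726380154143227996107028348207617, 279807108487710156979152133803177),
   (202478156249514267797712820210796211556219541979649, 158585292393425982637173882123085695018381745811851393440600009131602365801501714122775547117412165715042069208603267962275190004837975173030625625820073),
   (228888350542926425224805050206435271077120805372417, 2307719731374293661387072856673148317084138105499236660801100794450683294395940499172693483745123058017839894971169874258000844133923733417674),
   (252364078798616745569498457044624503716203240555009, 449632687683004076490396578556896966616214861882435609597540526887015389810918693101015940794)],
  [(227421117526628250156735547934340827619098550796801, 8237416813030057354559394685616067923490736250874824076339039146),
   (228888350542926424900365724710522808631558328746497, 54207926023850260645817406631805344951345128654788936107456197446187456254567103671326859239063715855930989267697433100874017045060869996236),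
   (228888350542927754128361509626395712438618609091073, 8237416810336217572312498397847943537625841959011094093372382378),
   (179002427988701019376357695148932857997260165939713, 1264985802394759125591530597057767674810947123566238885736203051996280253304544373018604263102405930817023565573205762988821729179212860271461147744110661206150826867313960145083714073707301670233646782492365717428662433383013966912054401136096148922002265490142635388507278962773866216903461909147736967110273099427428587167634160125643395280416060612750348797929634456),
   (152592233695286114879426336967399908636697473253889, 203374641782049729480569716032098709591115869677144803307814810464023993842819611686871867920301823732557605493301688394766406720754687833411595708573081266914454617831),
   (227421117526628255308546815424379379639293921395201, 902034932518880710277160779568310009720847314155730163978849194),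
   (250896845787398879901398131401282675180166006899201, 13425850),
   (203945389265815085116366303484494586907289211568641, 133074127458689402881787022193136298194183443818618480073981650346360711677674),
   (203945389265815090308663162019322215437785540788737, 992011419933952389545430804112456772752185489801746419457599357619058429113),
   (227421117526608322121471719428416791911780548018689, 858527675287829003620932393930928617799050885922780002718112938),
   (179002427988701019376436923311447122334853709890049, 60809853420226981018888810630511867852089189136985038317372185855493849075060790775883158668384249042924423331613411768101762037977584512000458575885441034456587833447658270850763221726946447310238596227279836706350388530694421952340039862160074494352568990714537671767402767947915510544835359098875717708266957890840448163481191452275130081129267045964341540862600),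
   (203945389265815085116445531647008851244882755518977, 1415847664670430952283098328800581482979452497609239470809098734488750050489),
   (228888350542927748936223107416596612583309367771649, 1946864936134571567606591750539575628710372005088240302087352),
   (202478156249514267493714360643563948209791404540417, 279807108487710156997843794840473),
   (230355583558526744561773559908803562551565355254273, 3886226745879170498434956649604965084611888745925835),
   (227421117526608322121550947590931056249374091969025, 1385537691494418289265146404669070986779809895332861642071225),
   (228888350542905146888280314915581289756735523979777, 354697649022571080981435607668698812992129042202174164449418426),
   (228888350542906476116276099831454193563795804324353, 90802598149778196731604490843527155328128971467199881917582073002),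
   (252364078798255184866052783290307147788386190950913, 900539),
   (205412622282115907951755970788933053234417687003649, 9238785324183816032252044989846174393843353289370502133561036946903111924216222152385646422341211151711242578051769577327088854604988297410837530022519414406917747329344879915670933047207279029530896788646656962193563332072313941259060508773705547715860561459990233934256817129283721894385849397940713),
   (203945389265815090329024799785488150199326336025089, 23721424716910456497352162951656722785113492880917532105872448144164086895856794),
   (300782768324909160322022745070031130305038364377601, 1321351710791033063061439506485689250088390811174415289),
   (228888350542907810536568743282154725901352413889025, 6239907031122039452836046951244578388978483361991260842986629377171703188460),
   (300782768335798196063492775900859117742854947144193, 1321351710791033063071781058616282669756198094944255386),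
   (205412622282115913144052829323760681764914016223745, 1338615599583722377795004351589981821433047094616806385154242680726479836306325572086383193611181554845297743513524450014756810512332694580248303416971415687747156321188782529665766662457587596283994836666886900422492684695434958572),
   (202478156249514267513996770247215618633738655826433, 408938547191613977585883568656092634348444762765194622583091612678347880573750168),
   (230355583558186462215135031048991858368080838328833, 1321351710791033063087422620066729782395206331662187722),
   (230355583558867026948976907975918607582944374751745, 1321351710791033063097764177458568369025879782415322539),
   (205412622282115918336349687858588310295410345443841, 1276603316863748910728522159628614654895159598542242119429482745793779605298304024044718244153823611489712992453024086426889523891548001082340886807216013295468320318960024983830082472421167445911744115911878860632706574568089),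
   (203945389265815095521321658320315778729822665245185, 408938547191613977592311320833128595450612611134559272993180424725533351982451352),
   (228888350542909150149158245267682886769405352673793, 471348398823690473835281314599050607130350268881291563259721050789737718652602932081718019863354345),
   (206879855298416746343674575931688470391494354862593, 6394609802825726113718616004559355143646758587955751968651409777501210786588668627000809)],
  [(130583738450773694464128449378408485772325403427329, 1787332077744402135278501087486041059370105676779599848508224869919958261842629808462509560026172415848640710189856135356307688171465848604605081533652865863266080072984761480087301734552538907575557125640778633355045206959817080631332525411561927426246869649911477928817989145232529580344423562266603980846780289713443117127007119448735495776958662379747475892707376580637782946832872597084715163189115115936428099869891151778710299541828160938538125486247608311278052809529750189918182956450538096134479163059542252816861929691605235921389872635636593722235048772995744546011598868845690159615211661844008245342286906723355101537278314829425545382160012477791579478735800619228954093765544534804644229087551178281805335872764526877709058620500297721886205864237184261057017230839127497710327587940786516082367819635718077822090397198248631430645713172535427588693863950391981341473742779900153042702070017412404808595736563027400118148035620957715811287925078942935174),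
   (127649272418172038408754778729856653366938344555009, 7383338161267581980347804121288802490014002285493288502023881041308248867821473611469719861922092879744622438787431775667247342439140678208177519756399836063133236287667880951851334251873550278518566481220140597221217469692493627865618763437263068695501491091274630251725453572217785288267025297694455861242867862449984415759168766568849392537485549893927952717239291170705792932952770514015033497286497158558219746751127769279093679264385818941157),
   (228888350542906481267770766574297148807944073314817, 1946795518897461588970380729333048429724115586131912169413818),
   (250896845782636266356653940872504853019366925730305, 334373064173445205633271526950763472120119299444267550873427698806345146),
   (177535194972400191348671481212528223713962435478017, 249077159609249715027568915149560642640958705865537020839682695223412351275392268277925034427358166675440860583496113544468075199277108726273288422393631712939664344833550193593772269845955184152648164106323740113990564054676917348201386676667446392899488372109193685562029112097526442600917362961983679371078616987715979369786114001441955131544495566815403248992912616),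
   (227421117526605653301010697708500329559754566468097, 3437018314),
   (202478156249514262321462539127706657664788768948737, 25972774776390132631289936506337502060462400086199362559117957215225775614488776844135812281),
   (205412622282115907951518598204251720795964129346049, 584968315738677617462206535927384912760825229440071189278340365815570586184764984814785172292388692670670451560943389858114760616189667446817009598719843804064304761871718146893670094497848740160988521460684196150323348262820936775853756039816889498068592931926431671345534705695852887441502368358691416289136583108174527851460258773136459564172871265471997889856399549620195645451430519581046321862978199050602081097146741910833553777994935173341958545280152132456403080883913),
   (227421117526609656561888628060601926572424395162113, 6790973363660711735799090018580174445064313451733788277017559406981518229027211059582674390546449203363629322210131611),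
   (151125000678985286851740123030995274353399742792193, 532016757041625418449430220528578593422967072970442329438081551636672342383094298712117926628484829808991890303672223205068193312608310262593827975962894175737690756255434209798315686174969663144581717168520956833872331779719709299929163609223431351503285642610584020233980026336417221725452502321699048965287310493069780151512134366065485045436243110888576056241140187781812088840925305468253102681773724084738641313265475722962843865374091764136154577640257447399),
   (203945389265815001999052059622810650145780515668481, 570722116291052564685626509788157671731497002947789808181562282),
   (203945389265815007191348918157638278676276844888577, 541141492878679808340488302164190530245378181621673577687685491200656854201),
   (203945389265815012383645776692465907206773174108673, 23628941868013430246052217714267551363760435320268129176893692031986821136895145),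
   (227421117526608239004157475566732855150271852118529, 570692692382258246895097053753658185405605801538702123077524650),
   (180469661005001847343197304080105402157370290930177, 731971985098835709352210090196587970834760626742563289554634043850463184356242940224556270171579052250268456112560018888012570488590836065632701768318774720173869163759828798616282207547215388241802842800454266414008156634486945875939090582836367585853460591967987673279773193323501715294722981172596433949205098203915063708101352),
   (203945389265813688368229259915072302354156474270209, 2223751166061205406330503889717003859235273543248026463427770),
   (203945389265815090288381064318532005588165363696129, 1146089916365660803220794320681094327),
   (202478156249514267473353034780259474022577683497473, 4269517646602022659872836520),
   (205412622282114505990960430918517205389247825248769, 570881005434319819843494042846626853578888674523214083433225386),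
   (205412622282114516375554147988172462450240483688961, 29817602182157765005923026573714817914042803517061819111791296451513907760399168119681030098654343010119397565781637899210457626448209073246019447713225642),
   (205412622282115918295705952391632165684249373114881, 597664356288264539608940605767155820350020995175271093004222635037831123154615503950407511952330102629390929642733835373404605351),
   (203945389265815095480677922853359634118661692916225, 1452841570396451152301430318997235112247882786309890554330658122472),
   (177535194972400191348829937537556752389149523378689, 1523414802520029163481610908879352183413399501263085921375736367833463432),
   (205412622282113176783247055606295972006134796190209, 354697649022571081019068115191219239543470597916146699869150393),
   (252364078792809265054804637608128976648255289098753, 17572454320497100017060280114635),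
   (205412622282114506011242840522168875813195076534785, 109773605391358417126150855280052878843436504046250858284900400366328203626867498385464506),
   (228888350537803497127940462444485204645217231372801, 1321351710791033063186054779375109485573589832305659322),
   (206879855298415328826270870060441407378782756733441, 189553978605213030236572622621325481977643096802118267319425909178131051381669637101875879715674284563865573833476264249652373736744078209648309284289074054033354705849),
   (180469661005001847383762123287408743005264793502209, 960409591817172175780651142571459228616363756804518656442966487608682923047286444412929738353817429216889094648025080200391031877083436816472248916771714541064710795448573907606306154623208),
   (179002427988701019376437235214308582909180784083457, 99838512497952631260677084533548897526359122971179635786535321566585385958023),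
   (227421117521502679525491701044691972034073131680257, 896426),
   (250896845776850059047272599587672022451603237962241, 17572454320497100017086050971081)],
  [(275839804348016068271518096707710816049148217983489, 13131620902836238682377900),
   (275839807048496932156085742753051700627660744098305, 84207092876220216102479211664761930730052101539704357428629299827573155654540612721721581),
   (206879855298414004810854353283047802526166056894977, 10275741055829694976211446654489650094241629017440976791168574914750099294138188810608013570393991888884558205327855753380598975706732307896280730283),
   (203945389265815017636789864038248547009111257186817, 16895704218089323340974160008437834893500428306462562850380258120429681891234641483042921829943189905567220386922178937231514042981090630900402064954151383793614557525772912898380439880227249224267608808),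
   (180469661005001847404044532891060413429212044788225, 91988963554040301240711400806946213075664436847694259238875163926120233853554003127322830554259486050734422186506900432238513202237954076104196687238972938384283773100577661552304740720075118324216493997145136843509384570182282703324064263911),
   (154059466711586942907113174709527464068649352102401, 176399382758847646176859792423995269804542533928958198035869269957535836205064628239643176412983082532909509423692323823554091769103225483209447549047),
   (203945389265815001999210515947839178820967603569153, 23650992106036690882235257959538185499220993610185454522499470231973230482803881),
   (250896845782295890508424051828549551789428156072449, 68642399689441796941859831226),
   (252364078798255101728535357987485804940523787715073, 900539),
   (228888350542907722206754459444505754522993681433089, 449632687683004077956897940638057832322734086009085586181522253796497434215847299061844821994),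
   (205412622282115824814238545486111710386555283767809, 9687568560091369081319358008697160771096273693661793535672942209309424519305248715902101240266598927336291211623690900645628164590669687228943977636540565263288861321319064636323902687374654380269419556429092632601833467109334727264065566249156351065972736462143702789746915614143208205967903735882714041257),
   (177535194972400191328705984258933610640389359993345, 960409591817172175837260578943782348899997461602784162365507149432558346031521560327881979128762524009488431644476742022528460100254714897329308913853059204908186959047860223609255633926824),
   (227421117526608239004315931891761383825458940019201, 19781636329239357264735168609899608624428764600317615667944414378),
   (230355583558866943811459482673097264735081971515905, 471474045119893682600774913358500692595054734449096597609564000400373692076093021447289990006361514),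
   (205412622282115835198832262555766967447547942208001, 122274305659268661398210135937962531053372220126381956202647739024604221262628117717141092732741146643612362566855346544836702241787820776525846510681786617409402952459463702827605179646087790875878170134508055702705520827680727174241246807755981616935797583430436572692237634201),
   (180469661005001847343355760405133930832557378830849, 6860850336959901092033363858062686159080598230628463251531029313644583351526224018294504),
   (227421117526608244196612790426589012355955269239297, 7950785247677838227792303060182942061069635440136015977569818290528742458325405242841813515944265762135225),
   (227421117526269291057687636878998541555583781372417, 1231556964557253822303066047109227294703535531284610250),
   (228888350542228502277798943037934794706679413015041, 1321351710791033063263939242775617806708701923609857466),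
   (228888350542568784644719881501398169314111181226497, 1321351710791033063274302270648752508395916657644457387),
   (227421117526609573424608575342461916163015549583873, 1354111202799215693818944694181080439862878898684400719150941753833),
   (228888350542909067011640819964861543921542949437953, 33972721692449152098736863588814678408832197993248174634070245831873160127594953510612320619793398407342476453237481),
   (181936894021302675350680648478234090928641388249601, 11711551761581371387142599402199383813231956851118822800340144688487501622587316034008910978157678070938136101800156946388455603164902109153072552414303414749139297885054880963793194533075792536147180474506393868347384401882805071432970490678600434737576720919721849918707024364043746130624447447477850516860312878390329916599323368),
   (205412622282111842342830458876972297919818023240193, 354697649022571081052519232989015174255774202995237551698926778),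
   (201010923233213361581733725009773414644235823677953, 1146089916365660803400938305775914168),
   (227421117526628172252238256698678982824814067253761, 7001328813065843864100710581357748890294972149810069887120728971252087042889436306004882037684852968),
   (252364078798255106941114626125965103894967368221185, 900539),
   (250896845787396148733126900706188386964663747936769, 3437014216),
   (201010923233213366774030583544601043174732152898049, 31427385295422601840187096235700858133602362002699667952300887565934781102304168312398000930268402357519986195156138),
   (228888350537460556284904000870652880674904739086849, 17572454320497100017180541304266),
   (228888350537800838651824939334116255282336507298305, 1321351710791033063315883681842262198050548181959032010),
   (228888350542906403383634801201939778200873310814721, 39522871674157144715366238566771741435170430739578111949299047594)],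
  [(228888350537803497107816509165862062896457067987457, 1321351710791033063321032942112505632770640679968624043),
   (228888350542929000259563144771779142920898076672513, 69204804477293868412788501206960447574546049650305187319046522975582242598963928332294472557977024651456120913428025416636621101811442080843433476941260937636564066627046706069711982242859970393467438090888),
   (180469661005001847363638170008785601256504630116865, 43066255556359288622305080523412615091529986081286458933645460539442040704040794237334955290162354901034319178738809609035270226027769125597895913),
   (250896845776847400550874666873651402664775262601729, 68642399689441796942178598330),
   (252364078792806611770985973032587655815870894244353, 900539),
   (205412622282111852727424175946627554980810681680385, 449632687683004078006369658451852593551066860326385053219178936829237760716239457718423020522),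
   (206879855298411346314456420569027182739338081534465, 2758373236059565620476664892389280944682452838403808152683168718323087156774818430434011268253432562089230012266233658224498618138744461605975312689833761706),
   (228888350537460561477200859405480509205401068306945, 900539),
   (205412622282113181955419960862500458787870962024961, 39167878870754481950625014919797849103837808107483903364271553153643674709430258705116004421757022711503189620592819014969883023367097),
   (206879855298412675542452205484900086546398361879041, 1161063952953326322269064605601093620942809755936828833103182732022788966051379586538280954133483288883933431484823301120844954520663247203308132018326480799016941641631313449852323748203648978647793517773762513849),
   (228888350537461890705196644321353413012461348651521, 896426),
   (252364078792809270226977542864333463429991454933505, 17572454320497100017236358049209),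
   (205412622282114511183415745778373362594931242369537, 1723514499521420491277998948355562592809471502905246774739515888492584022868033055624346700606438339764069542788122045164),
   (230355583553761384292228888943753040770988748505601, 1225271423951589637531401829721494508542762178066181291),
   (206879855298414004770447990400772990353458642223617, 27684461709550292926325989261459035172268076974879691367105603238054766263622502777124070514615405635614311581557915505671935146569946098723392912342305076342251046449388880466514646623086220240954417161051354392472305964091988438987698187418479178562360363868503725376446697504551979616619355991533),
   (203945389265815017596383501155973734836403842515457, 6860850336959901092896082595569050864814742737646824026697871698682140223511347602939112),
   (206879855298415333998443775316645894160518922568193, 1161063952953326322328357332182236224736542833307776665582024403029344590463783388056482410117746781757553956694662218288359890955270821267331893775319380476972583778237091113771101218857958182263825128854517504937),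
   (181936894021302675370963058081885761352588639535617, 261176331714428629263773541744511270892094591278054855679031097235317633508352626190361268793613609816501098591076511994451950422492236554493512557626818159999538878866728435786805359034058067272553846891527467190959421711483017014202850773458208222476316788177897296792851481562903793358172682263886224096527932169948458140679225795039085283582117951957771526468694549298824),
   (177535194972400191348988393862585281064336611279361, 26230886480745077387758586330214309990413576660492693730423435614789571123896522488429907014894543615776237878938685357351599893987986120234122144819723703999469667753850081437264769178743041479186934513456662899540097060625862570371499289966259471905820607623166925155113773008509880424011105592367222717183386266468296784945628115830065857080515765892581141329195507454687098594622217467484303702836760493793522962898366797315328999),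
   (228888350537461890745761463528656753860355851223553, 896426),
   (205412622282114511223980564985676703442825744941569, 29467127819993355257962292885061972338695515853418926971568349602640119810000485550569536856185497),
   (206879855298414004811012809608076331201353144795649, 2758373236059565620709204943753122887879810426060280373458466550930311782146234404068203484040495595743966437590770832000571605002452841027329722253807770265),
   (227421117521844291120566880749056779123752268136961, 1321351710791033063450840363838936647765953532873592233),
   (206879855298415334039008594523949235008413425140225, 18467596298538909712581607583979271357402804823657382785070078764583994077557278008784670132482254980332839075345836492630544883466243438315),
   (181936894021302675411527877289189102200483142107649, 155001096961461905807259203272833605650944377398950062038162071837895214677348587528191336832283774744655354570694012792995422869669046607118001168182152562784400547767928066874344436726511961095735828640392147849512111723551756821431065592037705639457419098851539783366980979729893558696294955509638566802152),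
   (180469661005001847404202989216088942104399132688897, 6860850336959901093165682038136486598876501665485004884149623044782899421390308402024423),
   (228888350537803507553257455046472331229291480285697, 1021736859930338773530700344307069214140438710023613353),
   (205412622282115845664555618040028906204329605792257, 208413093611612760442881767685682414593935325784384516854657585250726382747799548844078803013195140667855273084906919495986728678625979422264173400593679913217993433655672439075048),
   (181936894021302675431810286892840772624430393393665, 257807986726216481701027426193318041822395815541462351345852176009268223728302123197158506263709385812818756501557873642476449089258277825482095154553778144855712948178620533204639776108958357673703),
   (132050971467074522491815287120536041204277282275841, 434405598281517276222959175873311858737242057703438250623375783596871654744612944122208447442822270766898421037471029220054900226914367262617277621267250283172003821701182408400827401557213184128608065930466427746164494666507515220358873199841498896033215651523046),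
   (130583738450773694464128451796260125001583752839681, 6860850336959901093300481795482152498638183914470901796559311027935305530303877031917541),
   (105640777173659617993452230731830616107097782419969, 6860850336959901093327441742149303138432856638548692251072472406710649720380155347859685)],
  [(102706311141057961938078557655982411506713083707905, 133305316356217689922844424656495202425805280429794543284116236150961016179989309778674171605452282963206504546365202328426807656850850909291383938224515842277293306558515887625332045289738652076229872715444038536994240404154604225825702275777270437958265685508598584446406911483881429549938397845512612563367023070311319734842089823546535120730902578430723245690579921084066447322312614300782679401563104325521037217740285383813866489550089024827869488063670046597090155118813597974128962900806864083754281871082692590613809681309376488826299845168425957510347859552762487901228598671781128023297567673215041285605117796430842337852085476083797313144628969229620511925719293374684183948542210804794373384802426874330696912902068625707162951810858118223758340927853631546461477218666222725803854553742654160545998308),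
   (228888350542903739390228807621925788429493937046017, 22216673347189089137656688459184783072805324969730232423190092748),
   (201010923233213361236616159796332861017473339818497, 1146089916365660803590089490125475001),
   (252364078803698295238736291412065640180052895400449, 19807829819564782372526653083407151671086152186526015708814171289),
   (179002427988701019011195716722244887533658136838657, 2365129042991056905037207394351456752792881293489462129246890109194307039413964984496928302406790747140827593845219109666274882304568721906362412061422031494949752894691675213842363935610367654485879551287533433464086947490928560806606104056747196577930737656563132260719063373080838520755408074787029736),
   (228888350542564796635897371143990574690115107619329, 324154567597161685518581233401192314261414988760042),
   (228888350542905079002818309607453949297546875830785, 31057754873741555577315047405082110760750190258898848933409662902925968062408418920645062391913732889529),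
   (300782768335795464529742342226158341139049409085953, 1321351710791033063502741697609657878986759518107385242),
   (275839807064488873787850137524242037570423671161345, 1452841570396451152775271802693895881116542132823824469399511009004),
   (202478156249514194436237906404260649644053678457345, 2448033203356731555046188720680600263016360268071561547575730328891411821201696179442730585297801672243553921993082723511150412334828),
   (252364078803700964079321578313466704855166114529793, 395842642209236839050924451883291781192709335051392173805164740763965270817216940536751018978084844),
   (181936894021302675025845492868445207725826155676161, 23850519338727802786410112115716277343764073055876592293257605969075016182974049723710518736654481355672481033274215679456744677003324152345025102845915679840305369037655299063941099928412591943470347215796631346300868600785620704704679782531514108553558444688690351115617502792591828535490245100009843204279344158507304880049878878840700165424488602384629428996660049101504612108597496992680722304507835971060046366252696),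
   (152592233695286114879347731406442005804145967301121, 54592964705601171776980213654168039868033671787616421086987680752323242577449798856787196875137105967507784161535229877971185157549376239019482976502643310313338912238559472615),
   (253831311814214333474128581090550370706578508808705, 2123330333916813607486727566279097099924003758626673431488487525068404989542834029370451057153219180135059720272365),
   (252364078798595404620938213395077492162914645377537, 815025320355797882014737511273849152688711891709546908662333592662819667661870107457363096698842789396246024190445),
   (252364078803699640124752290347028111274391168549377, 6856738291124855378719547886476209599264012940148683760220695083389896027755328590610669),
   (205412622282115845339720462430240023001514373218817, 9772146719288259316947927076313460450732853807555002052078654638917003860802745502683587903910017028378889584731223211022806047485607279904023249479536348),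
   (158461165760489426989776922113449327884271010120193, 1216732847027840047761040737346780397902514445643834633830853446729901418290277345619894645666624963213925721598228648834959687866074273640614854519974083787921616363622224943067682563200029764622112274331826827229957095),
   (151125000678985286851740433729690175284114706596353, 32399449675244348361005407630405072522156509419792755889427593809936245719204931359909244360075379814707793126),
   (277307040080426796611203088656067250448110295646721, 7299141512489539909829372233699086878502515645459657),
   (179002427988701008646963637418755565234206273634817, 104688268081053178312585445300060005416613379347480605735182537475823479428701998251),
   (275839807059429811287066951338825568538552158061057, 2123325362756463175690672366272131851910096752125936351305548188747222792534939865127305242320724702093103077823467),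
   (176067961956099363016907578342210502103030913237505, 19474204199117601257538670795495750271075426308589537347052772342320738474327202400238576942775806383852635157123972204750747041929458345766130022670950522220442615553072016389804594338531639061032297923967230673064072426),
   (202478156249495574880064838278550674045757890429441, 26541994701450579556292056548721848274516915517033302639566009),
   (202478156249514184072005827100771327344601815253505, 1321351710791033067713759274238126911621772060869825767),
   (202478156249495580072361696813378302576254219649537, 29467127819993355168801958841656071137716269939648728517628540293524997433794358885503850070727851),
   (275839807047457475498219648210891492468592411345409, 506633184673584459265771696781809612223398136970807602098437714117804725396535983847346028415045031851092165948001707),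
   (202478156249514267148755563658013383832543082775041, 34375740384030539260353260532319331589013275558425683261228094299402542819766080100529975274480072067977061667395253766015135160074008449136244942670920816076573983862238467047839274699586402986539805462097538160887590340901348647758567154140687689992961700291215055530772431032387914758919399),
   (253831311814214317836470004837626738180841311240705, 129875499312035082499913253082034567144546295477392353136010938665904557495),
   (228888350542907727094577800135710434612215573316097, 322595632517342057553637500561575764481953270893802),
   (252364078803720985596369726374968253210552382456321, 1321000950398073651044522150821630433010949100465281911),
   (252364078798595388983279637142153859637177447809537, 24374636840320466548370981732711732589161825931719484450880049389468831159)],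
  [(230355583559207220681610044758110062370742973170177, 1354109790452762297579610859932483341202059355457511420942019235050),
   (252364078803722314824365511290841157017612662800897, 33964266939151166309395801284315144499714930348833432495478340697208906199269154156974018870682123918871203110232042),
   (205412622282115923163405339804213704024711101612545, 32822758996729163759772296415318447498897676462592144274932631158938382174290766639903774749915118443330393682043498460097872427996414535773617607009061007807652250786689171531081980379722320379133320727851149011515197990708224343970221624432384052317890384535778490956567118450159556329),
   (154059466711586942907034257245708100661770771956225, 32399449675244348363169760653168478535651879443624487578028066757045081288973464572882552093530860114776725224),
   (225953884510287467100566303305768760075647210160641, 90802598149778196829370941461661022971360230005490073032683478203),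
   (300782768324887804060084794338444419996387960357377, 272416628346795010603076913897905510096718555622328),
   (230355583559185947861663037172967643351229409722881, 39680280822134247768620107926615099185639226455208497868210870850389719039952925630274128922405460121498459739193573421606473099643842221200342942148414028014325268365226634370787801255256321037394179151262591981632532963496414402195780542441684424032409744310686870601938881307968919817993679321404457642347691),
   (181936894021302659489598964633779927319825214538241, 500835555980364437262225210551640488195264470206287407828519964651655090292903723573867523755747352749430057747308581239437357453879658667786576975427301539318944152535557187211850572105506076153810501263990811193765922734724846315720410773371719190514077209458033415686634619553001),
   (177535194972400191044514876018962332623062173942273, 1107276871636701894913526017570396990260529769493832284595452098054139567087456665892308942717771979261026132399326077690443714579325292181240046967897179963617355234857114308733085236045885194323006232761575),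
   (228888350537102998841861199192046436664911218278913, 8697161047723268537017720902012438970472111160306372079459038801475439461040738527812765098896369195404194103045311929),
   (203945389265796408099968994490130133096285480354305, 6394609802825726117466048591293294075106267234480390357292268493223518283569054375782633),
   (205412622282095901687001239112529760854812880208385, 11024961422427977855683630763295304715503100949800505902454616478757065142182194755795052572151474270876365062424829177065961762499164915554045962986),
   (155526699727887770934641554922459931181802032660993, 70108987700169910891854726063625033936527106680611116388409160259579908556077688119471220372493269091679429461536866011802233272438024723652509489901218421742888566779308930433659822295312668381908129883009064797444594003123097084287335021414460280010398169872625526357657063921872766170652960389034668333939368422298961759818383481043720119313112939264411886424804730757753110567911),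
   (253831311819658840960349107598823371702087685702145, 88660151962812515709531300089439798448503960152839163616450602453613975),
   (252364078803742253305149513839889725395358621827585, 3103250759613795923102887920550896980597518946682545246783732816573238856615883533784138874611170309926295315661518146045421568728779171013659288584668788084211178),
   (206879855298394055702008800956704568593181843849729, 2225138784031787034647088622401667363889217115492234641978422700453474438299054199122987880681638744753626146103489768682),
   (252364078793130932753455076799601320084206705115649, 1575744012066562696188917393971496924693468011837569674102974089232189728755285937906727101524889),
   (206879855298416652577937144526543933313206609707521, 57244872559140454305541790915725172126262063869423678583365637589275488750219872663814573171785699346762179532486798321089273675302274231153547243236014953482033085216391853634791143),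
   (252364078803742258497446372374717353925854951047681, 4030208978983012959171922679498347769621984217851739043787047811945031548263470105247976823845709558306673338541470523183842376063930561900206994888234356122672914101888482584423956728863336388651177521642),
   (158461165760489426989856150275963592221864554070529, 741535436560631096232672874274445732205030593292658335659783062493140408137670773576958145550110395622532182219022468717785854659139874501804606563842245365394617930660156244499099676292967739901188804499286773822315315252778472888601263563566689279494747458852712898471586463747040401686431824589119322431986300463002979539768461906261162068600734091665275208213881816196983602206370065211152034137891895933242735472815239741793052126130500577281883881266644746872456689958314897043130117003226500214072040),
   (152592233695286114879426959568956270141739511251457, 32399449675244348365334111378023870002312561306652793435021761361624462382554097731414592739450798225551035622),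
   (205412622282095901748165380573541829477028809867777, 517768046705537630329170735987931090360388430820650447864136699443311595876171050148669473229443567200050123240),
   (181936894021302675127653681699274881533530131857921, 257807986726216481759785149389085525701457894436394447586899913521521356080412684540294179931417812021584006113836155363132413579499207117823002872771400349728243408073142509777183634755861166207975),
   (159928398776790255017780360602772480092269990576641, 142604563856842666495230603551675556656527859218076583946580879377668592151724526817147945755814298153918037249774632479620071732455),
   (132050971467074522491815288334221120789923521298945, 45748249068677231998643165830254620407644315284998868455076914047235545427536970194436051753765777698499978745003585597646391685257071572107572462010829883416108599608025322760628748402159292789343046514252798809440903152739513828310620975986128530250856618577258637675318361222703669746117781374838023846744535226212787205471717),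
   (107108010189960446021139067269791611895437550879233, 32399449675244348365970686925789790695951930034116571608572503818738291154732250574457174114007138674231509221),
   (29344660326016560553736730758852427688777905013249, 525164143947666620205884422104010383369424938132069941771224297899191577977926853063082688423186153518099498046335708493600571678979268267436705428521224474443461889670939531448897791369986808199625714028078932581393261023618098151579001152866021974170951102258961173196205162791396640482),
   (26410194293414904498363057682967184919900144730625, 307651169316618020621945564084209342308616161),
   (252364078803698378702361495383174935642975708119809, 132189890764549011423420981067764526745613403688518904909192347),
   (253831311813874118912812632579106724274791560512257, 449632687683004076718327565551030357855635575998309674790106655717530920424229128725219864249),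
   (205412622282115913145325452382259751177159193133825, 269183074193721887283357457483680453522926472044561919937469292232396938018632760559362997707961382545361255022866057954637126813816358684889976756544709300852996166806148408585617381399559815656863218922),
   (202478156249514267515269393305714688045983832736513, 471474045119893684266347197015506617728439639309973921441103338306133729587594105785939988110949096)],
  [(252364078803718322618756684534316630397682905776897, 535527989218026057320871365123748776454151467963592401192705252422394813461073329399792521203897089726612270879128300),
   (225953884510327438052176281331123330744189708403457, 307651169316618020629199020619262787429120746),
   (252364078803379364267247311092812085604637886120705, 2615034949808569920667698426401714917322570476),
   (252364078803740914282100808210241921125034139845377, 75292527668647238795789152572874559367177305721191359370345700437684148123970438856753899),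
   (202478156249514267799143588824848751702113293435649, 23245465126343218449885046974390637184972023960860552896788543355626),
   (252364078798275128763591690465889995168348450849537, 78306737575752839717614794973551865859836962284),
   (228888350542927749241810791922909944750818344567553, 8546510797135495665903990384962386748379704624991125132321309019571104772076012019072157164),
   (250896845782315917543638840631982270692439907107585, 1163779063314591498091328899543756668646508645818),
   (152592233695286114879430998656195690705907433603841, 134442020850602654780102243146113362537872316680988271279059215189819788741237562913352420214061957385604685394498789265651508507578326249610027535203508727170880540983888815514318773992099122616260359782403107070794304557310925895058741013195893074202364991210911824025160449208219395734248),
   (277307039987572339585633241916181246974460770386689, 719667663703548531289820),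
   (277307040080492105991681257019887321946561043497729, 256898336241943000149769332041560021592794949614524322702407103728108),
   (250896845787441503792021792280157396900499614335745, 104688268081053178335210603616725439807521269529879711141185173595809128289430916251),
   (277307040075047593313243100139300956758149081334529, 95213425157501822463180133042369028340018904349704542575381750118739143),
   (202478156249514267819347080959921798748164900258561, 8402626303162665923921476833862907515880314480891486731441488739703933462080221631518937742482339346323467507734579052489826005000698069515216567955905578351008127370035128810721260632968270440623356319024494054843160084076626268004931660295083571733411562640444142312732660247206334610154),
   (176067961956099363322415722778388849387602207572737, 307651169316618020644915154344638301423844072),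
   (252364078803698378702361495307635518661135094252289, 352768904896281740480403511047917932222322260518017630225620121),
   (203945389265815090330297422768447802629730899067649, 1321351710791033068004547249009538866863951516300725402),
   (203945389265815090350579832372099473053678150353665, 37842064687856910486691661815201517771765803103539005052911793121313940620998145112238895547124383845185952951437929502254181662548437101139160336761297339134289636673086607061096099394771961930686283367988098090435076909170110614993242424709368076220411444751780720152295617054010738272880795989111525354),
   (228888350542906481350568856881573344047778287059713, 1229925618392427529365403079337726770742800755433332104417862013417),
   (252364078803698378743084770839967388184216684724993, 28554828100589021253257205675010663866648116559199116077312247345705944697909623853311975726657553986533755683394028),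
   (102706311141057961938078557655982262322780698837761, 19314722630774030142846638906298458313378475509163207687603585535626905966095784790331451288863833303186615235801132647426059496622256458229763621089500915117776072100759288809360344578502192570711585057161809001984148929611644406638199881751947269739231525685920468172696172116790613931767917483938092247548289806730114702556153716806747220835826082197709542101763937496739256840744632004794096000166512599460740679191989194828906353713960849250471901254162093548527973757747992391959740428820700200522885518316113090236331912794378682817938480423141359253067845156197957968013306653901278990722786982682931914971793595858281511851980014552402147256293862948441847591257707275786715092725343486635731092538251289041262152575570490649469149280101),
   (201010923233213439791739453241717365753167047033601, 4412889883336165682761272185520993446713456023712266236246817172570086916054116376395384613529),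
   (252364078803379364267247291745295124089369193087745, 2615034949808569920667698426401714917322570476),
   (202478156249514267799143569477331790186844600402689, 626696500059323278286351321343742679831499698691732887810190692170640898163908802635231964279530148461101322418007457165344617902947050),
   (252364078803718322618751713431364893844184261460737, 535527989218026057320871097870860908876004424075462387116109494127676079834544938280471030044097930911744048797891308),
   (225953884510327438052171310228171594190691064087297, 307651169316618020658213258736757957036653290),
   (152592233695286114879430979308678729190638740570881, 170380267998124634354018330583721849013137362338893004854461660430546926487111034074068185609022434194267949775821094880874993752983260327006524592219637298660050367956602030404904333177171154883597326087674719451150611646838419269752917931953557959135914212325456682101582051120628255788074568117491788439124624620215943),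
   (250896845787418828707121997681959915924605196567297, 3437018313),
   (277307039987572349929662120431016201672290233221889, 714945297221778397703900),
   (250896845787441503467503219274213708602074900726529, 44133974845803582660396821814930063074566402092945403709682402149837147176141532960034094904661930702148737390282257366089195663613936404096253240733971307499),
   (252364078803740919170082585874198908403157362279169, 370193478157726330431533780032814099902109781684970790142450716700839728228228235178962799809619664300961753913409228),
   (277307040075047592988724527133357268459724367725313, 24374636840320466550957213286891122545882832178186842142725044679320902856)],
  [(179002427988701019377630298784375548912396035949313, 8402626303162665924548850265241159064928011098509339566724838848284984818484616299135263722616747474950617747913473555191560134058972929125737304110293512408294358484958152085765365896370752472382331771578273329204288334679821608643223298042757955245119304651699774497335738693505781119722),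
   (176067961956099363322415703430871887872333514539777, 1471823416864644820765114074213190711421606362529654669238138582891588831077906681248220145360852970838627542593974624010600701662345344711558862449470292231231125345323050527305314157906164571619739003816266869009440712326341431410273556277895),
   (300782766849446146582101956044154427203087549858561, 11922695083221609508064923),
   (300782768335840731360630496844234730483919788180225, 75789850904702894513894720136273718707719630855669840826221688495481823250599889810547437),
   (275839807064534140618738292142318426915294050255617, 115105968046849044027074364333749095272485715574517731350372333892062666434877987866536973683436),
   (252364078803742243226222378183924382778855652590337, 434405598281517276398781381965675241691202815344875372673094839868622382673067685826829969395857714619905007941423115143202470542944874195277080797153258137386484088689018438342391896694928616388204038532104942174709187231303875321555368404813231171977720726076140),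
   (202478156249514267515269373882658309548874525836033, 35623571651474508048712113011016205798608866748816575857076690223121099312300927042106823880196615306242615928761796578186),
   (275839807064535646384827267242330700759229524083457, 471473556111839863181547155104816808516779046757165853830869870951212523033065513003659107890423019),
   (129116505434472866436441615329189889562171444298497, 884664930282984563575799825801142446716093953925954569313516994299263930159952325919936866950139789179096821471556372258284138172962161607689678170329233901465871491594712211987601342054559420918579252870052985953008493645347181369733813114080455457860240545529185903431250232213981547663039061069666130296167863059953997894878440113846111286900994398950),
   (126182039401871210381067942262786417927526036013825, 23245465126343218453264778523928419625760867227245760406120738655845),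
   (252364078803379280844428943753042813187825590338305, 1116465601607851976351331555012436335738010348),
   (227421117526628172231801723635712515900291561030401, 310435229306137333089453611050907983876058580877788113195446746219002490567697092424896523946),
   (179002427988701019335876748872718974235898114474753, 20162227032333878603360683981646461638317871774633),
   (176067961956099363321226972726518654043730095637249, 95213425157501822786062874770318392705825350335011384973725830944107175),
   (277307039982446758507680159028676202800808208892673, 795225527431455719534300),
   (202478156249514189609186899227210448663691829445377, 8912785241052666658056180577360946843723426218946900666476890807528487209038547271666882380587141410335501241814441144181821525163),
   (228888350542926341783214270039581132719848553710337, 361889648791166401185545893419678688386193269820906631408892979694314032258234),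
   (225953884510327354609149780794781877202793754002177, 279807108487710157248532482608297),
   (228888350542906403383559905905139246037891599827713, 352768904896258356811018117263917464922552972749419560311774378),
   (203945389265815012404011747324345574142925802308353, 1146089916365660804098996042145189033),
   (203945389265815017596308605859173202673422131528449, 434405598281517274959764277180595101334331130000873758523184031274552789807610300629749096518307031271357558849053207285208904847989818965819538588013751441549895156758354630478845811853454212103097905619593713139993043617864647524925346335078146564777188574687977),
   (203945389265815095480761483881587630630867069829889, 35623571651474508050811878548934683561670615949830360537250447683082568197353928224501172286673456723514600943722808789911),
   (300782768324907758401875585435146619819968382108417, 7194123002928065227973530845142751810761756356140938360426867298061393539806111831040634174189),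
   (228888350542906408616421583647270215416282431619841, 115105968046849044035667910917028077883372266027033148968047020973827349886914603202375435157148),
   (300782768341581594381001570144851975584125024469761, 1113631076857920471147253465955919789109261904527984414141637261036),
   (203945389265815017636873425066476543521316634100481, 6860850336959901096616541139039683364704467800766236918182124976220527095450556615161836),
   (252364077491569504374378050629371072250266186416897, 14340529428364279062060730),
   (275839807053601172872562648871709615205786224689921, 1193022453443875875230147755305160944472080183095837309969532764432547241),
   (228888350542906413829000851785749514370726012125953, 97269129342088478291380548426417698331993171931579281270599375505160944140656887137152806870428),
   (155526699727887770934804033414507291100885989720833, 6487588045382161921270119566062851816447217749807630760378331688175952990001853925602373123321865754454164405260598247703381266826372450854038635924895058018552474830694798703522226251305930453533349978039718706078658931341539100928597146806016411612918381098064920411559017374464610838309477385139938058027609404532136944232003716306164818999547849565577875032736086294536488881878119155458007296132635817972064933648986234461002819808007401165236330376622078617305701895478909750114538687819940487542544739989592568550164354241697455002439687230388699649278514312503351046214411001947672077352775581617784),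
   (152592233695286114879430981735975101385636380410625, 440081248358940004513244752163823463605661596069511925072168642971526427197701872476760600132343598533315435473379634412453785482122436216151873525114498032118578917470940492008572142325572288265964270793568098104258437772093486790655816563853859432095604383629860081613500213383687442342934260557736536028154196439625153760431614977622397664731540965307896625438993708890415937943960494789120163999638394647192076762195898111645708978546918),
   (228888350362895712499908466830285350259991341433601, 880838019598840129892060)],
  [(252364078792467663885209858666513199682586771981057, 7194123002928065228058574080838402247376024535885572108677560488266283563252215092562266226665),
   (205412622282113187208569000044016473454958327628545, 41071181827887810254253495687909486730703628642502435367663839365035043374238628899421643769134006133047511400121832199818760583755342348522),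
   (202478156249514200034504510799217217937903527920385, 3844611436072756035155137291281617822253356630699579151696117603277404013148094880426918262962439125719925530375260071692682591662151171822912174947033371882007157902538707325987918820665366066543336),
   (79230582880244713495089173048901549672117794243329, 264588059677885362501281980839190372883665207653658769723808899940324520537350465489906771125053303816461864830637150898612263482223857735439358604620505777276099412597353163205442416170843039871784468200418090489662370927974022972240637911855387209393087145616486158882318390435499581123452862716278107943120820610184010421672902494097270093513359102971551451764482126744445033406055044460478627338123776931390518292144041087437683621693188970810081117967500702641248499687676273943944698392552675206845450732025016702933766457278295983558457079157988),
   (52820388586829808996726115365934369838636051202817, 273863233203788714517085385313836734190466254963619133502658319531345872214050603160842625831860272328223179947644803887647157558065377283647751413741303637141980800537326970494243043028211345832582906324569641955165564567676307259212252689972253275436675600559748325472105622992629683442608061803841262333574547829335739961744170121007260498841567813249934516763200759755447631843),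
   (201010923233213439791739453166122681159649295860481, 3856643260515809500167073672522911997934261686139851163678742671277756891211549464965320272537),
   (252364078803379364267247291669700439495851441914625, 2615034949808569920667698426401714917322570476),
   (202478156249514267799143569401737105593326849229569, 626696500059323278404557339932926117468336818992163729225429910313321062813700744644837410981864992739108128118251267389877376820493034),
   (275839807059065702140532611898750259668196616569601, 1712490111688784645932595237112884041472781113149494615399603700715),
   (252364078803718322618751713355770209250666510287617, 109773605391358417552750342138095032875743626990505428976487349940947988247870207807503084),
   (225953884510327438052171310152576909597173312914177, 307651169316618020717450623897874786597255914),
   (252364078803379364267246983393616437765411891839745, 2637335693677872548024318271770556218548206316),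
   (202478156249514267799143261125653103862887299154689, 626696500059323278416870466869299392222174019023458608539517328869850246631387405270837978348242238080657015806941834211532784082926314),
   (275839807059065702140532303622666257937757066494721, 3397077002907311855192339715882274538903793061987658242911384175595),
   (252364078803718322618751405079686207520226960212737, 109773605391358417554907137869960579642824184814146409968808481560931297837760274217876204),
   (225953884510327438052171001876492907866733762839297, 307651169316618020723495254148869432782666474),
   (151125000678985286851744145117733948009056634667777, 1175921392221253900227690772734659051567660730294124802857835497974793115026667268119693049270332271475075768601701467122885260518584347173534294121823962485985372970603586935938252991852617228975049547229255988262553474810602077180179605734791056385329350977966218323034647243095859735677841059125316437059279506551599059732076028789786344761392575427563937984472366288969871545749163645319),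
   (202478156249514267474546098274731755432275184190209, 2231879445167190995500498958465610974211695705586611356858009478511693786259788473528780923008273665789906328337742376252008178223675881237405460136107603547427078716329),
   (177535194972400191350023001032029033798847024071425, 24374636840320466636772806901729747913696606856331218810000036382082050728),
   (228888350542926424901638328270370814953176447582977, 537990614605264876355763959859876461657522992609953524986112269491778861586524673977060728270958896029570546028296940),
   (179002427988701019377630298708780864318878284776193, 14833738267542864249787487069172598891110482207631080846628151257193608623924804340057703157572813148656049862327043703900198832796060218299659785802026709213720989614359334155625376542591509608888646989207032435980831763436285428222613048348254711490126367916244939785443222118517535017958213856157889189677175272),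
   (250896845787420152742900152149924770945244940468993, 3437018312),
   (277307039987553730353206642626059871056529442734849, 714945297221778397703900),
   (250896845787441420390832710803891231858209425982209, 44133974845803582671188923193271234185442770919483523906389465605292473727627473089269337989131516915785859863597295837030075448255100410320626916524678232811),
   (202478156249514267494907736040897690193815979426561, 307651169316618020734375654623794284115295978),
   (252364078803740919170161813961118488147233155056385, 1573262694082154744960399746478340283681901431004544619424707189957243974769803),
   (252364078803741002246911550518360544635174422577921, 1315739544503682401182855324898528524828840794610523272),
   (179002427988701019377709526871295128656471828726529, 1543318711162261807930421779032850118196005937236131663097274549239387924415293961401694628262227301302249588879362938407168540669700145838905163749197372279697256159276061074061480099160313178436669280790973094745082045757927006204878904451892844778),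
   (177535194972400191350102229194543298136440568021761, 307651169316618020739211368586828372255249127),
   (225953884510307494135781072681330572898855452672769, 3437018313),
   (205412622282115913145325432883608688086532135060225, 432560522776963312887648005395118102458003204598796144580390091960306078409183339618221297580242208697416575967669665043924548030935275472451644891994691907650309766295558054532984983767645914633601000548547868153377794517533220579679995933676779797471086341114778),
   (202478156249514267515269373807063624955356774662913, 794432194461131756666941155940558646778800701902493567913203042296142628330407940007906308947274937697855038491567905616862928916712351801251460545658983864591522024)],
  [(252364078797575964938369870443584194293690041369345, 5000044599135119256020966241692620267148876992930751689065892326715628),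
   (225953884510310162976366359582731637573968671802113, 1354111296957178791119453989958220209668230731668647018775566400234),
   (252364078803701047542946762785924937227461869175553, 5806344934011901183873848587703979549716894630235391569306134465889234917231552054501609),
   (129116505434472866436441615253595204968653693125377, 66861140918893729138029784959725856293441980415966429740758975893321118788320893646515110084163025560057369181050775128164620952639279005041359445015002912054162203843424634255927225537817064638743531474769486538952757759846830650770317238089831462233841698129836126381192685877040498701082100005541676373633425243430233147113404872035313254986713087145525966663699254640709862),
   (102706311141057961938078557655963960256845018563329, 19065624066807633420060636885037522070249500562210985902096813285358103719385558196248938900588901645172620812741973760406532126738563718046729284017032010378467365494203622528922046559365992122017393335531838161048489260098057547012383477481861216115372651020034287740531665774984747417862614262593603099591788825964589551305134722686486385149442870999784627051481849506473890669204806986661521590016265425172908871212476574031572681726953640090824338775959164223780796977961026236776494132730712036245367357633480248539190517730355648636575929834920003895738118641381),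
   (252364078803379364267247290465496986364091912422145, 2615034949808569920667698426401714917322570476),
   (202478156249514267799143568197533652461567319737089, 626696500059323278480898726938440420942127459186191980972771905363802002483358040526040928644723204074484844667611327121172525683620586),
   (275839807059065702140532610694546806536437087077121, 1719070522980025211110939571881021102330109534409035152060162835435),
   (252364078803718322618751712151566756118906980795137, 109773605391358417566124160681568013501119446269888731886757153270873583705219747330439916),
   (225953884510327438052171308948373456465413783421697, 307651169316618020754927324305928291013147370),
   (152592233695286114879430978028880591465361459905281, 1175921392221253900347864082731699119623303884121382206153419837294627770833429244301695830549174690439037708626872216904813311373213389654268185122095475010258049579211427439838258589948152070708344585003866155837579997330548426716062229991781589971924059434695546395166359651427645252626052315857745376487766577387999463836744524263433493656109640797402636229954163735610187996818997680519),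
   (202478156249514267473357366356730335506172945367809, 2231879445167190995500498958465610974211695705586611396106101588201507064115863573281208736661920205159771495247076081114900652000350877561926726697119416549742966782889),
   (228888350542926424880246414911231988940720501424897, 537990614605264876355763959859845499927411522381591555635459687225842682071057630488417070470053032420432959199558380),
   (177535194972400191348913497276541878210338329199361, 191600016563680056648197351880402119946880052231090393237183011563800917168165076010601232212878487334075653118737616073365520056993274729348883336297419389221208174802490414555137299862012118273283999407515521979092289636517057899907452940221255584447373193421081629853789605223463677482584824364924876300690467816),
   (177535194972400191350101919714255843274241488454401, 1841695488749584704968726357425703831252911081478184579789676894296039554544620151593420573026950),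
   (225953884510307494094028140526045454814996160840449, 3437018313),
   (205412622282115913103572500728323570002672843227905, 432560491097726610338880891946764960162937001394363567320909367968638332325722176268213681854117519276882216981061103341006825906786644516569451058802743822505523325007405202319803168466161132209884064947800227868036090287200628598515905280745598366719335446989722),
   (202478156249514267473516441651778506871497482830593, 794432194461131756723121197836012707713751101384459904304983667073263789898562433205703448385933252692501761441776693040043941832549168379837400745256106410843123176),
   (129116505434472866436441615258317571451523338339073, 884898906818856846619203562932217224298522322374755264176894944992300465153042178303641384476194820564417172835464035262873431846614416300913962791874322979225691648021173648153044855658099410594961430350716411573006664250425666561829795720888131684149483360229164787691597059543599281122963983037487163293907648730376947798667183265574141441782383454951),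
   (201010923233213439486235351453405946248872738423553, 2246621485888935616480813461688333486999499522617724448592149101986172723976778122428103713551835489597759711100003229142734373143298347192902115766579670056242588203945),
   (228888350542926424900370059918493495441910759949057, 232982447067857915736631497507062777514138755422481971535676470050413569957050),
   (252364078798275133650146743377346449666501146575617, 78329038320951045822202671949655448029221912300),
   (228888350542927754128365844834366399248971040293633, 21286440979009624460802741050090553734740735635543764183817759325355012574699847349438854636),
   (227421117526628260541333600211966771490443640439553, 279807108487710157325498296552617),
   (179002427988701019376362030356903544807612597142273, 434398387092512252513552879950860733003064272245802227169571450478845485715499594395107206029074329833035923045328529962579871352813209918820723281353734116685248061358480603418523327852936805079943803381649211591452622806261725938496760436206487635145465721598952),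
   (152592233695286114879430672175370595447049904456449, 27150349892594829783990530080995809760021915291273917986734026365808623024665966902000351117970485838557760166440717930523920795781880578705637213207388690596892851493092057374830671965047770776841527498870338302811801114856887192096843748588911515281370333266663),
   (203945389265815085116370638692465273717641642771201, 453701595916114009747681626564963006407847012703290530259074070205966007646480089775777982594457247870312821835795598216041882790424252968106),
   (201010923233213439486314579615920210586466282373889, 20162227032333878609619708820273344308207843851176),
   (203945389265815090308667497227292902248137971991297, 77946497447051739612467700102002978718971395450763539869842192717082602720574777740574688430362910288070495162),
   (252364078797914912863368259338303782290758717145857, 78351339066144384148485672841452223580638314220),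
   (227421117526608322121476054636387478722132979221249, 21286471947911434317720672000925776775776734590693203576095424720189335038738209622649552364),
   (250896845782636266377098830106294278354526621926145, 1163755526348555239032364029635791093337676500410)],
  [(179002427988701019376441258519417809145206141092609, 116609864863651906504141145556486914199855367575032288994783821720266842637722054296007963620525897141466839725797189295212938177950694796483639287371920844970528425956049416345691820498005292991387627621614473648119839075052096266633931939105533729209966926273529120111592),
   (154059466711586942907117198014636690304674709111553, 27150349892594829784845841839358964879262329836101597984239051904985812773854168712958908312351348640318769603955661796489887332864002117243760500499059049281295028430201813824818111119888791039410580902675146553473178746673769633068785941828144655059900769675911),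
   (228888350542905146888284650123551976567087955182337, 26127345468156054957793136913838761985408020869138121369640122),
   (202478156249514262321704246920358676913594757808897, 1146089916365660804459284218207980729),
   (228888350542906476116280435039424880374148235526913, 352768904896258356811018117263917464922552972749419560311774378),
   (203945389265815085136732276458631208479182438007553, 1146089916365660804468291211589569705),
   (205412622282115907951760305996903740044770118206209, 4986731706499019170168508551166596643371639834868183925781919670333184691787938438667156428354749393620368358893260186447585945696872994134830157809174638616818138120558513719010033361266211237341896603148331087493630084329),
   (201010923233213439506676217382086145348007077610241, 1452841570396451153865693790202967141888099081278570476087542105064),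
   (252364078803698378701093207532646553041082962412289, 352769297215138740646313897284962829901232930383925642720500889),
   (203945389265815090329029134993458837009678767227649, 1146089916365660804486305541379574938),
   (205412622282115913144057164531731368575266447426305, 4986731706499019170227295150894484752615014042724198608203314211945515897594363187117835825813976256996618566503144713606368071280142374900642361601454455015842115623049428428642818195280932689937671222588866387129766594794),
   (202478156249514267514001105455186305444091087028993, 1452841570396451153888529753286262499985036492493040856786364875752),
   (205412622282115918336354023066558997105762776646401, 4986731706499019170286081451618264545370202401708187288759754462590781283339753107919988156147715481957100614495162393949787605586867314872266933922951572495396934082326523663173355838702134304028807919067985125108838910443),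
   (203945389265815095521325993528286465540175096447745, 1452841570396451153899947734827910179033502780248636817877426849256),
   (228888350542909150149162580475653573579757783876353, 33952923167774237216215091092181139846791619807346413479576660490673127775551651166767306215840289026596492440587497),
   (155526699727887770934803723853902785162299513766657, 32814011838444000383251525584839942994405459082322496281803883425043116223033853871826632403414315414084138034663698590409785457164667125079677484286310789671367753364783787558533753793877222765646248346661700452008898877552378325991097957143554084553560836880187675254226481790250729703),
   (151125000678985286851744146336104500589425099801345, 1452841570396451153917074707140381697606192540475473842480622156262),
   (202478156249514189588904489547964093646226826986241, 450724464501442526887962231517409265855481436602859333530990285955768717996711777317505813965373905768208702243540388251625506257787667803306),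
   (227421117526605580588735057732409435965139875791617, 3437018314),
   (277307039982446758507680158953081518207290457719553, 795225527431455719534300),
   (202478156249514189609186899151615764070174078272257, 44133974845803582682539282139291699863691680225601036824856942030405938624340594882059938567472653230581117179636848479202019488845712023882848558182683726571),
   (202478156249514267493639777174030192027619016573697, 20162227032333878611679641045644217085639986559911),
   (300782765449860711058791494479112708890787188048641, 875505757638109367611098),
   (227421117526605585801314325870888734919583456297729, 6322481401151076559503188347172695906847757057518937393685733215445538927449046870470372840567175416639545642700),
   (277307040074663285155833750690135335775743223530241, 19139051600604256748961827101165576336660262959869611431013742616561478612573286589845034732),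
   (202478156249514267818158330832456918810775037149953, 550674517404068474293064673326178467215338817027330607152558756576151516848663264172877069812381417897259517815710306653485466198797229033308153430534107747846991356450582026999309465309499762662636725069025628355209040193003082477979733590797680012418861196225914483369688247966369418211736183),
   (154059466711586942907117507499646511649743433892609, 27150349892594829787513047606126668228523029457786186978595599577451695002739173873905280568000272265721476109839925705611521861689640017186334059567268605748282739850598485529103111909479263164800306565579124793523590175033941735515744605530451367510973278235256),
   (228888350542906398191263047294716932913877519434497, 26026934828197125463304774697918107602072812307290835901013178),
   (228888350542906403383559905829544561444373848654593, 352768904896258356811018117263917464922552972749419560311774378),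
   (203945389265815017596308605783578518079904380355329, 27292300501416573634830845160801113693763483612733577164385140570813958068804826614509436641970268590755506714173755107409476466166762621352347829867993439753001835824834690186125579980481551867971513548697575169067408617),
   (203945389265815012424294156852402559973355302421249, 92659695055196755968555835896418557417960802760455562138654152937460535643290),
   (275839807053601167639700971053983961233877641724673, 324154567597161685524047647045498898284474784279993)],
  [(300782765537314608565265283063935480721458191401729, 14340546722450867857587897),
   (300782768324907758381593175755900264802503379649281, 109773605391358417590713313717121790107156100619927727764456284845338515753560002369207021),
   (228888350542906408596139173968023860398817429160705, 1452841570396451154019836541015210809042425397615484257407235030764),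
   (203945389265815017616591015387230188503851631641345, 3822085640751628411776198521592810763672557494272564513722581614335628951527314322720731428530754440503150771610064787084329031471630847844412001625831470466584932152085604549478892873438963747213878287187841446985559817120601684140780),
   (203945389265815095501043893409644616461296569942785, 408938547191613978117780061305818415552946508511203353710883741091968419122432919),
   (203945389265815017636873424990881858927798882927361, 434405598281517275002439543504094790251511425542963298215521092814121375125441896071346725375285866400807029278166275084591955144335529684176596553879048589760303598300870353012538653322892441638925913859045951003438009449097579617838898877359149338430554187850987),
   (203945389265815095521326303013296286885243821228801, 408938547191613978120993937394336396104030432695885678915928147151588304860531351),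
   (228888350542906413829000851710154829777208260952833, 471347785793794962626303855287588298121262117776429757198079913642398262987689405534184584292689385),
   (155526699727887770934804033338912606507368238547713, 927636241531993772439983037779717985494732543602468154971024767206416033482260612685017041778215000764815046777541859193774870559202213069103719209125478366231950833859990148544475862583009418817486339191968916958483109630155558052958544736139885908912996805674412646922672656794766862632386862673163299817566034912913603376503023611947035606707728935244093928),
   (152592233695286114879430981660380416792118629237505, 1452841570396451154059799476410977685712051360565913721848264473062),
   (227421117526608233811944487469548359883531873420033, 1922496359770297228104853589979661225991172629077667294796986),
   (227421117526608239004241346004375988414028202640129, 352869338524001159677042195448017811037486079212157567549365418),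
   (227421117526628182616474978277297174050428737028865, 27209564455037427434144739257222708347807088682931784840309526150921621502148168631999605342764161542060504266785182721383931870152385922957974384937760296708044134376298062513216158802067632945494193572205092111714184168),
   (252364078803719568444291097530566558262792707900161, 352869755362832119534307749486821950644239568860963914354842760),
   (300782765536975655426340439001354831266155428315905, 14340546722450867857620664),
   (300782768324568805242668331693319615347200616563457, 109773605391358417596752348764052057029448306084451118240031595918296996185344021797059309),
   (227421117526608244237103023746506957792419034432257, 115105968046849044090398163135406389644751313511308072176113959218712118714768192338259432734444),
   (227421117526628182657039797484600514898323239600897, 269261750016038788023439802045566713768703134732051297323208549447753795228401771214349278926967863448104419347795713889637565517560625421259450525503418566008792750061537030590922672233731584597916753469434161894884678401322202484996445204625372206174900519792876),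
   (227421117526628343618242412064256999343709445423873, 115105968046849044091302671042768603862699311721875927399359851374554603564318544715393193003911),
   (250896845787420080069838121046646229458708888552193, 121314797088543829670286246255594747397117091081455342601190938195565616591801949335344781488972758732),
   (227421117526628182677322207088252185322270490886913, 4986731706499019170560418917015075721839282037356527358118488917756657888412453815195777362847578110755891705582675398405515587255900958412683199937098198453158996465971223304857602494118304264247640308098410963043979981547),
   (227421117526628343638524821667908669767656696709889, 115105968046849044092659609588518403027819284195145050616944569470322991513891931709903738817159),
   (227421117526608249469964701488637927170809866224385, 471347294987950539795903703833655825283790692129237983004166174000707759305718139272309665213805800),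
   (155526699727887770934804342823922427852436963328769, 927635275601310390604466792704920709831715034289166225325309922436888208806164386427582429022692870485588741484018327554518710453677194781837230423881001990720516948349050261504370518353661583951369895386660899362377363995588834635447019816710153551914530247752851568164458070116551304903896197892549769327571548881459983015446220935517875625956561665334270697),
   (154059466711586942907117816984656332994812158673665, 1452841570396451154145434337973335278575548518732883430031229272550),
   (228888350537460556305191362234443241370083521725185, 4248723807682893998797540809),
   (205412622282113176783410463691463190952553415443201, 336618580313324304941522649434578308923830577355058633881),
   (202478156249514189609345974446663935435498615735041, 1452841570396451154162561105941916456399716902013011074218640887784),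
   (228888350537803497128103870529652423591635850625793, 139154576763572296622359307412682202579462520568312633766836740588713346326199323292513359107767100977277598354841988553),
   (228888350542564797001302297721221489012056374117121, 17572454320497100017687344287179),
   (230355583379535483220999972098422698654041926533889, 15549472542065497032351435),
   (230355583558524008221413603880157742163152005759745, 65164173946835582881067062181031162203703051695641244337047227893603814611084482600861421)],
  [(227421117526605585781190991562285235860960742474497, 322595632517342057841404360050125087415619157810361),
   (230355583466647769152760218745046598156574588666625, 14340546722450867857649340),
   (230355583558864290588334542343621116770583773971201, 92762949015717235593956982347299250653026907125122102530219127721912932819258596473012717),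
   (228888350542905079368223236184684863619488142328577, 322595632517342057845207311850809775620109266312137),
   (202478156249514194801642832981491563965994944955137, 2448033203356731557460799113359884592603845162710448299128487049744825174375778857838452563963772094917117246052554777623524774596585),
   (253831311808768481467376210387060077276265869214465, 5601391166632388065270120973538809243443161629766458726919387122101841287486324733602896473497),
   (253831311819997799575767179681351439321514220192513, 29467127819993355177832275098212963932689617319958556109453229366785336163272052910386567343067112),
   (181936894021302675391250419445676122047767422173953, 884899832020557096875453417592504122707083257778417706935413692984120936873963067112251014315866580066464248534781614215176442003529196962530370557956475340582026521116855149832852066587740978165672458273131961706378454108804289208667246003017551766839605151521021094864206641657224685250529775748970793574530303000071717412661920487354245306251911464170),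
   (179002427988701019376600643299475801855599403336449, 32822758996729163789437276719974067718886321968818118261526286717327934276457924263917712824417687670249629209872894994562184946163625093833299628359988565194839754641069631895394244060446289871205192017004016350533751811780689958584108199887991021649535095483427578710961169040170907623),
   (228888350537120284363428960047938464671538914525953, 2123330333916813608179324096032366090669911662603516627287266087858840249651641775891758246345031591914287557608169),
   (205412622282113187208568999968421788861440576455425, 10027144000949172421532862822312499511452584706050713067866409622415542422576761708310038039962316660659766627660782185058826253378095338),
   (202478156249514200034504510723622533344385776747265, 10774896202588765305852856836583320600324181299937363422610861502881730512630639780939197026786929454689554439451980592190702516420329323100202646484897768),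
   (225953884505885085113039794488738515198331748352769, 1815006482023142209792207209300289341746031189663011118629991970952152767327688330251832242029441542837554031815849),
   (205412622282115845664560569800167596475561137144577, 9786714346857195778189184469031355663619462977850276182867327722630228713477458536060080002379986563823049142935335917037088707751971582677880921447026664),
   (181936894021302675431815238652979462895661924745985, 257807986726216481978607310599711585275390165158018119922694543745965373330132110041358177837094802201337703987909211870287038995513816647622416999794724610627477566857497275044762793733531677063143),
   (105640777173659617993452230731812164857229717275393, 155001096961461905977193116312452502563251317168829324357260371529263223821573792321688774758770558092999057406711543686849626479084537921837973925331639029627585094065048110950563557010483712972086371281083042310155252392200892651624207655139208047297160346487184309423618669639223628906803772105177517339365),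
   (101239078124757133910391721118039857956652669207297, 41607790143350241157780459024723370496891189263762989081565740905886568733260142088519640002482075409045391350250215967758271301945143361679386919016934443909359670166654883118223022686041098765808078069621822372894559287623728060456405713282565554104971808110064469717321772452626516901796652517241143853733128774884),
   (201010923233213439486309934922939697925250770797313, 2246621485888935616480813461688333486999499522617724485531529911105996985488378216312741655814091056063515162308787892543103760227227755498333896059296670529010482854825),
   (228888350542926424900444643388027247118288792322817, 117218517386995772481446375670868025849085940620667341332468999313330830892218),
   (252364078798275133650221326846880201342879178949377, 78329038320951045822202671931204481835156668140),
   (228888350542927754128440428303900150925349072667393, 21285941834522980885967378739973646402611799208662202099956317484222804844000899085214520300),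
   (227421117526628260541408183681500523166821672813313, 279807108487710157428852389563561),
   (179002427988701019376436613826437296483990629516033, 434398389298887076647650982869124436273082224888895792808452496694974879849448768832319377785439649510789241199115142020300518139675626010736709183182045942163664650913197863187499002793510620613075936862379889704842403676562716206332779407209387418775848682361320),
   (154059466711586942907112553321656177643459197534977, 27150349892594829794019223788047110588238012384518689713639742882571748897967204887450787464735181072947161541477795986108299575576683421436005167606991963242998630877359061533130025897309353649319035823312928802377960254581987699422243684218541179048507796083175),
   (228888350542905146888201396238076842258416349217537, 538144528691967302545444751395256716374817844058666037041430365441228659559314938765776285760930051395604485794795500),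
   (202478156249514262321620993034883542604923151844097, 1146089916365660804846593786161843385),
   (205412622282115907951677052111428605736098512241409, 234412753250459213698001001381160460599703304122016620931869606691628883773046064758066707597896969566848759476868318186729879443147390627107288940235693345601941560288322061833502824681),
   (201010923233213439506592963496611011039335471645441, 1452841570396451154345248933281753489094337841207179961303132641768),
   (252364078803698378701009953647171418732411356447489, 352768904896281740480403511047917932222322260518017630225620121),
   (205412622282115913143973910646256234266594841461505, 727312616630034929672144458850174584997187036904688812608825996458403241367701616807600895102415123001503494760585122938353185879194624677679363401979750291090964723909723746292456655670648197318357693140815514861173054698),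
   (202478156249514267513917851569711171135419481064193, 408938547191613978210982467872839851534401406055591566628134056701209126854040040),
   (228888350542909150149079326590178439271086177911553, 33952923340326805067867016962715377206053096915257319724863988486603176124706704120132567741923059001596902751182313)],
  [(154059466711586942907113172291675820333596647097089, 32794373293984876434627770680983621585755336281795129007808712157560778866006742464332746961018447954768162367106683296548271498017913021321874982072849795537307105888027225263638519550266912354486326745281768722912514611263859601426904181354717048145477625286195562400847932938229487335),
   (227421117526628172231797080076063138260187472986881, 453701595916114009747681626564963006407847012694946457907702124662392938735255287898031819467696690733576253561735744147788599608750454271146),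
   (176067961956099363321222329166869276403626007593729, 471474045119893684686873187234975834171109775690214307996242236809651574301848511594196523069188775),
   (277307039982446758507675515469026825160704120849153, 795225527431455719534300),
   (202478156249514189609182255667561071023587741401857, 8912785241052666664857559897073967871691367653217932583468256851928663734322868342138186155899474459812890647267473101098251439275),
   (277307040074663285155829107206080642729156886659841, 19139051600604256748961798660672982365533789861648430465024031660626049688387158084285735916),
   (225953884510327515610833652344587881863445555184385, 170731166521099125669186919475177317648856507994996868016995349268219155528334845569970274842800887580046391366663136435030921),
   (250896845787398801996663154469152213252677361206017, 3437018313),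
   (250896845782294576897725204190508521626140747760385, 78376427404487214204879468975642595774786011372),
   (250896845787398812401539281142459140737617270932225, 18636106375563978072990887717975520939115738025249682659860977694578491809600187785732794604),
   (250896845787441425581857276472806490520991180260097, 1260139189520867413650940229228476468185958557671),
   (275839807064532899638155171610842218903898245300993, 30272678676873302144481735612663365071598477617866160007717147474202086772959589212100841428819978332137),
   (277307039987574925307710888926527162674830744224513, 623961565796084745830105),
   (277307040080491949897063863190121987609607671120641, 54376551262059857725039218610891857302437816732),
   (277307040080492032973813599747364044097548938642177, 75292527668083234709987947512013909985446064181142238161439452440340571100246791554444781),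
   (250896845787441591735356749587290603496873715303169, 2480017551383390495946939909910737404405653720888141038998970898689695713351058741120373804301717197343707252097399030502114603769117615106605417747435022587770133692490968977325024827136999968913361778898487501016640633825780327583897621952792021409515244322171965085962293961123579518586328806568995675486955),
   (179002427988701019376437234005382758788757253784321, 1452841570396451154465137821139470291932696454250265267394856648426),
   (250896845787418745608896786742073398889077895594753, 3437018312),
   (250896845787421565066655790360779031796479164678913, 6721884888246902529990584398459292746647059963654412815186318386323287407006217321372855),
   (250896845787441514499940978881729629105740818154241, 101740599105449171817139765372102780727571096269409405369098758785328854139833598844491926473736592033551422198470059660801618926513779258246581211784238038108754467339049601486423572974829022335079997888564623397221649232569496815235398283695235533478325954884256581846844606308599802431859130527874779549294824236548511540653175531),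
   (250896845787441592384393856904144057063185756455681, 873487435289618749447673353232828068402681915678244954061244543843050846003811416930006472573354018510192365196005237518085994846142700585603906289789587712333876365826114501497),
   (252364078803740919189171930698857788703465831400193, 538305273131596612736247099936311081628419633030651035004992350083607312059310747131517972967),
   (252364078803741002265921667256099845191407098921729, 3253994268512795664401342072344371473480000401333287686325834022490749234151074387172828527012966570698222545981281456111613279122791028338270594685358528550785526379751),
   (277307040080833805550215347310008477381374444307201, 919444573492629771002924726836058753075953077756527785637717534165033382827497953486429227536974045391253027110075881115982818399002397625154255336669847067133316158778282326097507698636069194135),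
   (252364078803742414570667188729214805486408646787841, 6860850336959901101765883957464147469456780765052181358318123249093137850855493065881067),
   (252364078803358028793665036232571351995261980508929, 19122092537986562081447545019531136097397481775032816140738434062911933940105891217067522797),
   (252364078803740919148607111491554447855571328828161, 1452841570396451154522226422163419710771349954318739410818297082343),
   (252364078803742414895185742387641532269564667364097, 12070587297290410764474222896279464947535624806302487315130857750220684428472883275752888921744383150359209944652699840244210255998838032999257698721365494184679),
   (277307040080833806199252454626861930947686485459713, 535271357170649368862344607320520028688348352399867209805881369619046136447598120468907536923998328474301903077720837013450214782902639624136528813851571661249047875016542501100),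
   (154059466711586942907113173500601639948225821803265, 93190829207206169193527738455819925379796006418391854641945116036488545208831620866347165385754845609639225383053732005337223720888818462015586431888128967871508015219865579269519828812402768551977064591878620671790306831202529458066003591039526534724322028227291203425929016267421311721672241589863467033928635017170593306885669599444053590608711991808961272110705975457317232312675938951023113904764630381888159461610),
   (154059466711586942907117815775748960124256693519105, 70108987700169910967615923434236419757622823963984991991341759404196598798230309531625563952387569628717072810013633705567214213230667710796191283019323307270186786576674856221471437647547531867883134529113534481375174909744393175071537666641247219267033302810170146604176178170181024616750911988314180104238734878819791008158859277087036408557071926715295383257746585519666755901413),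
   (202478156249514189609182877055432352942983540376321, 437574079166967032285653217958707218347990985499370576994950968924483520303618806161516921508056216)],
  [(203945389265813688388511980212659609232007269450497, 352976049253479348867018186161975912468306781768822216106761369),
   (202478156249514194801479735590259981473479869596417, 432560547206517882257513509847264101719996794676154696408333997707815614104151210606026427489646559740465934544783579585912731722333207533620648022288678736660062307899747817184982437951077867837403004216832240074962099153768015337620394692641354144583007219862424),
   (253831311808425540644300604700619312562198464955137, 56218139661127309717479743113768356586649801177538011),
   (253831310240747334695528673356598303738162875466497, 16677803307039150975151321),
   (253831311809108763834134051459291869391182562067201, 1224897279532432926384493799524586353173594043243752603),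
   (253831311819997799575604082290119856828999144833793, 132708145869800851046772778620480254191031677617403023758282451745937853756759390097585581967791945511633397596904),
   (181936894021302675391087322054444539555252346815233, 2589441834955068259929209316340390006291220800627806041385721768107311708070420201107053886083404207761193843314463949658585344363485613265570752179265057304681214041598657197570738818794418949287759414215726171514854918005407285964461345860212011494746102912353591280923837151397483789614630417765078936226334360042),
   (179002427988701019376437545908244219363084327977729, 14158397312328913553622196708494326498512420268362184796759236473469858881334476627024596747082050990384973474159694628426032979207497872591168443278739783265971875844078145330821023851162152424628167773675632428456185461600205837026846640876403119951563502786752497861224905032872936795700673854684017932198072153842582178428659392007738543132702633472231),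
   (225953884505542144289964188802297750484264344093441, 82584481924439566501375910847370786252845869885484489),
   (275839805654699033232505590323611340188424994030337, 735155318873080641997037),
   (252364078803696981993437730493978294641802296427265, 1179772871654906102083616001772750155576172461832959659935538795855594552140600673868816183936281619588723456572212748510464912963149850690341949577013369571250015779530749900238177961954196887032476718907341287312363529377329983638133692),
   (202478156249514200034341413332390950851870701388545, 4031367281191426235735112810140359668359290465335659430901832500698122898625395887583096083545219896970494979970647143926503295104402747971278636006264635771404060061598355546798807476201543035624625815178),
   (252364078803742175745294417633657024081851828142849, 46202087138840231508398807751426363077405231406625350434470488084265713031455042282500870516651221641544137027242692006690979173947838025201160552961991914756384274107313467016),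
   (154059466711586942907117836327487893572952663524097, 2078222780884428356079606968763385295352687984626972402093291384908039563442641810229158449703822526961870278437959119436610752810567634641650111715548022973292598646234598302384522409610267911019104924968623127169447913238942731741558025758404005609414091094405132203115331407027390637816984277708473615361919126155492927817522078931462386055505002430951083759224367584378711651571038553125325491953210783285389835008426042924075733280298649936526744213364768341),
   (105640777173659617993452230731830611601303426827009, 6860850336959901102359023875624659250764476456681887639847731022747100088323283513320678),
   (102706311141057961938078557655982407000918728114945, 1452841570396451154642116535032361205379551109741685821681674036452),
   (152592233695286114879426338181084983716549356684033, 1452754209638198463756136452779465535906431045597397890865075377641),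
   (202478156249514267820768216716132208875792714957569, 6852538612753988535588219863552590574104668958064834488388815805886332744876177489247977),
   (130583738450773694464128450592093560852177286857473, 6860850336959901102466863657453613763141323647314032889921486430060843239871705654874344),
   (277307039987532379282371863129105582214229363262209, 719667663703548531289820),
   (250896845787441336967930489960903403928873832022785, 8912785241052666666661222252655343870138397356825210592635631558689528714978394524387893019540819886119263769815384626314339465963),
   (179002427988701019031557042585549357215077502288641, 307651169316618020962862636968101431705183978),
   (277307040075047426489151797820046963786523299021569, 4097777242221755516405391233533551783863552376178755754215249523454736039616035052890020376012),
   (154059466711586942907033945342846635581649342169857, 108719427307289597481635755316867942647464574758722064984376022726553071030708498668624578971384378345885180950091897297476370038284211167427503680757255157975472742922164958689365234465950984435032007660915769827591328001440026303744673793823680775824741879001765354),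
   (228888350542883795838921320419612413322407270679297, 1924038134091388126454862653024096245187231455565591893302458),
   (179002427988701013879825003258025069532475675640577, 1146089916365660805134824162313555129),
   (225953884510286137892852616090686061612412751315713, 3437018314),
   (300782765450522650699199691164109316364067699688193, 13308075246142135073500858),
   (300782768330332321951101907454648619059122073240321, 32836108978452560322612451523326937660984194642807012493919523430532952824182894668143597),
   (300782766844319225607363637510091708404590293811969, 12094722203727626531233451),
   (300782768335776839821836922870062612778030364623617, 84306511327865877487509180750241121777175337301896739756459291923663988511034027675082221),
   (181936894021302659509881062334570132663651036037889, 1956388890548298585454128765318501724086283339725039272644825976574578036869509388903472921213620671672393950686876915164910071602173643579694850752719882169909742929569154947646956944285990875317883067841115531438662646319326850446101058464334897069884586623546969225268374584044)],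
  [(177535194972400191064796973719752537966887995441921, 176399382758847646461751794496002819815071602868246958612733256634808289838398299339036880331140647926339061439801150198960204062400687660160856218087),
   (300782765537294659456335857882097469789664922829569, 13383338033740084321963705),
   (300782768324887809272663750574062253870710111077121, 109773605391358417646356964401115420229416620635718242073968072041368073862914171938847469),
   (228888350542886459487209748786185849467024160588545, 115105968046849044142412741760417363144024569188502923647903624043597652387912794923027238533356),
   (181936894021302664702177920869397761194147365257985, 2446652282563199947823450509886979905315314208625107598043631195178295494141558211975158004513085604490479414547575797624133969634284),
   (252364077491550889645176449615335568214617273664257, 13385554009055643853188794),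
   (252364078798235178621580149314694060752607205655297, 5950839072343863929950865022505624903914371964115475453685870355565033),
   (228888350542887799099799250771714010335077099373313, 2169174246591524975937678881911444272913484893452432493952286489616869830606408218238796894369948557952068870426444454008584993522124711660),
   (183404127037603497901799667477325549820727703896833, 2069468478884185324077715147211161646459074978708541365955644435649503701947199435406075342455795449338534534582611623563719701030892),
   (152592233695286114879426647666094805061618081465089, 6950489572504276429508982949007609357896345982079122475381551884111917383211289620656784360172906913255239053798644045990625641321805051007637191241160398667881818757403385126833101293612012273001736549948461739956712601272407808284300066041395567485086719663247334),
   (228888350537101659249633023069822745478277644944129, 17572454320497100017786113863100),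
   (203945389265795068507740818367906441909651907019521, 177251828229653932195626957329476244200604142256874302747597756668094660165437286445039520027510498280906671986254975578850705377827250905269257235180),
   (203945389265815006927677592105999999015556112188161, 1201762380143039144494778343715077983292583),
   (203945389265815006947960001709651669439503363474177, 21592415973981211908768369279373226341036944366869706328844275703198643669973762700829141867213996971599630026298971607771753229579733701714184571731744194431969748525458064005994704377326354776947611732850870841410165927491780916261233167961659334209662881585988850765384572488650985385160912325387807427099943020199534284374483340838848009997564557771741061678085157971655140697210811153727573852002546211047),
   (225953884510307421442273532170076399237615789015809, 2311974196484199990290877002367020152939251158101904777013224054577178586181735740903217230210881599215222433290704694341273322),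
   (203945389265815017636789862834081982859704791204609, 157026236580863903195847441324128706364696138357065588187378559432896528331175438374262164436854196118550001790399457931820268687385329225656387266130582496274860696878683956554473199752759845715262804718968701829476232023148475721041221940115875217110374032672304492357470507342030787825247029018304259237414404041538825974560914612097830690187995215371549564898070894147789864027905245249887811550689715228300955219721883088015487490647570952143375853492360455761792230809266473529065),
   (203945389265796408140612729957086273201652097090305, 34719871042371751647119379332420715660680420242171545816197896330688161453337617046475169466488002261293202517907192828305969994252538885868),
   (203945389265815022849369130972561281814148371710721, 78996791571834974789412333254115772955143647995141800135284568271262274529876288789973270343576235432529518978625972534906062014433034049494644690203941149887885140452909399990031424154215122494822107572266362551397042396325011520865009637312900257472461080343970675047600744998766292492796980568355444423557160310039862937034566327964535947970182375521635633207207053401155826042715287657251805020544859814),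
   (203945389265815095541525150460148081241096980792065, 32399449675244348405820203228923867428527631413534101711098009628323782914192622782069538209668030275011307751),
   (203945389265815095845761294514923137600305750082305, 155001096961461906038101328917871083866863876927428000680385049879771324617537682191613778639600947825196169817155484398828361663219151700648235473043838638776289709913655919943937783570239518238708395275660654090445041609827110604086454526608055713441143584650263565786747185846158664081287311724064717246439),
   (225953884510307405540943631069681051200564324729601, 3437018311),
   (252364078803698305684414609877357236445546509763329, 26571313723684931168913952372956521720371205563033969587918492317643026846859758753090709120243003270722263832259285290658487239),
   (252364078803742248092728390123577490035980699435777, 455458693285337573849803320739947291894886546064932931758339632706516329427064799765187457748347923559518520141423522067782675358594995388108569674260750332372460148369055925526822196509214954592020725480722319502335351325674485669621532313032899861378898608857835042428761661766103348719274923296078806024311185733100),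
   (203945389265815095196803415360583948371587252880129, 960409591817172177452516368713269393792327854994678379662509022988380591584046580324355373791899492633146455036088937192050076573416513460383133376078744297532667492978049296390641220446698),
   (250896845787441425297982770188956628894340270523137, 8690760459210994473980479304518284676900830647783036071085254272799753707236213499484729360271901832097041116873798692769986229204419564992066663842380917051766333416577538181344470428124214587012310385440941631790624502526301692155437900512206561480231351441148727154869435949615955842890169979),
   (253831311808409574047585791918950259085008129229569, 88307412735640713989081777446449024345219051129268869621173040400693481),
   (253831311819997783714838688498925649036532173243137, 33973285342669017875049318938932528253904041273459928278797684461420895675901782083746449702210609983957291297535975),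
   (253831311819997794099432405568580906097524831683329, 29467127819993355182348166863562484394537347980278544169665358346297413866536851033338899630258151),
   (203945389265815095217085824964235618795534504166145, 45965573354217026293476864555628663210021321971487967160425811403944108103134244240551948344934864323938577682554628111167464905025033797599583566732108844805928605748255123946),
   (203945389265815095845840522677437401937899294032641, 6860850336959901103626141369095005503094469793640236625645589026611447081819934470541286),
   (203945389265796402948474327747287173346342855770881, 2959490546811862863988069179461210467223591516617489328944692635237628101475835218665753137665278593846448362948184024953506120547205368937829060846686100121),
   (203945389265796408140771186282114801876839184990977, 72566497059582895185442500820078628906136397721339321394888467238101269812799183130799079770403892248243706709229065604862760576345300149913304032689030989138996354074512638416184578218766526777175402792156458651)],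
  [(203945389265815095217165053126749883133128048116481, 155001096961461906046019396552133583119652934789931824332067512871483705444752970646376095618907213046464295643898192571422548562783110233740654042397760137919466931708056388122771793587242258864841864850524146392349318355718104786892101500139557589035454394093956945493800356226280481096499712535906206744039),
   (203945389265815095845919750839951666275492837982977, 6860850336959901103733981155763608062273137853988315148340137604301590929503874829357030),
   (203945389265815017353073812870501389937223905051393, 5799942476786360139119271205323897893397726690301480730777486009989282341222453106572519),
   (132050971467074522491815285916369477054870816293633, 16323249842508821325863714949625487299188514936247050645091718275604204946331474868824724568239554427476755024727621353060286560713158805140339788113942556623310437549061469877794964500685674545584430573189974501714798299725962673238824073217805398433607667147931488234843952156695847883629192579627519311491653979681663735893234296066268068738514376964925782126610734246376),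
   (129116505434472866436441615267817644649483757421313, 6860850336959901103814860995765059981656927666590852307260538977874686141002821047521253),
   (202478156249495574880064838278550669539963534836481, 52264794430987452547164245358112688984871953108456792512060601),
   (253831311808408249950881492304782904435742410539777, 1037041634628876100874421878711730143380645174765778748662191837998803691),
   (181936894021302664661613413564955880920579936879361, 5206758191409758109151749258773537069224863183976846195112907318048008130482556851201500383854031211712788871638771555325746989359290385025948727318742615583934219766774676509111777312282135515846108290225280584874591790242858474),
   (179002427988701019031557354488410817789404576482049, 915917960946247270123156770919923085020631230152079949927763744555589321114923199836851268465272380962510381197941954733843753298457441348605640978096268414267099020886746515066181095),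
   (202478156249496914492654340264078830408016473621249, 141396857782631991548142295526169895146697225313027207322442711484957916244860533509465976712086200537250307713722066439022200119608608364489706),
   (225953884505184566057609689011822009643827443532545, 1321351710791033064177804960359043584386610617169853913),
   (203945389265796397755940096627778212377392968893185, 6328291406041215115271031436718966250166897500101711922048865694851925043742411730586346),
   (183404127037603487537488671914183423758009370936065, 20148487106365736442213728694678135740650750606597322059140811670528733921871558708288224570606188366546557789366235065195158257707454762633293845420284520607459588806226936720769965895315558944671638677575176319167918866737217236975995094088424),
   (179002427988701019092404583299365829061246330340097, 32399449675244348409257666465194094070024606582855774889661036944681858851841780434889257993545515572805362919),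
   (158461165760489426989856150275963587716070198477569, 1029305777523201473402651047222743571821603098864677998566024845283653759425933348112418703525323848755756497573133217478003267657010292147198235205129718197950611406686051600686836887004123903251225023039037320601142503),
   (152592233695286114879426959568956265635945155658497, 16323520732151789355541391755548942145623285736024357394844013567415667447548154384365265618705059218115169876396594285230215732939590523693300823541237021243070490805468155968886267385200375228859215161862922611154274748385197256083719030436503074459941047177254481178559024248442585405281421555633866361934961382021527101041692247836163309436455481021000699672243936268262),
   (159928398776790255017780360602772475586475634983681, 129342880687514721412514119591268429826482775637297664841713575963413713280115958206031538579203021930837040921940336081630646371559),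
   (132050971467074522491815288334221116284129165705985, 45748249068677232060663445258607716113521507795426067297397903131837825821006603731649212767949077483212776426515716067817946638459764460447338919989531018145775089003910865547122977660648252053963225051887439506693757303023616310698567996047769589781530389043076331461724561162190939766799419702289605140338088628661012336578533),
   (55754854619431465052099788441819612605306198295297, 155001096961461906056982874814542588678211539688733944471063685003007565804710070907293937243832287372312733082043424380708970632673280611066955030591100911506306670392242579235752800054616275086710630079390329784357192860334118608415787748951376706839159733563047268001256870816820942062435991022035311835875),
   (51353155570528980969039278827991748455300977656577, 1452841570396451155030327907451024831055983110807159551609725584610),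
   (51353155570528980969039278827991748455361107198721, 1452841570396451155036036898221853597853919419141235291142678054625),
   (177535194972400191044513943936860041441691925021697, 2247542863418156407319243186084582612078100021407028655264363024913904906571850275356398869122834322169183580329088920177478259831626043689834034930493149169819878996905),
   (227421117526605569920261880200618619474729876390913, 1455727980064907440234463001461840279019743084235483008517099740451533361970835095668812581849916497879885146042058),
   (227421117526628255328908143709999384724506505708545, 1523414802520029166360873481824392534919895838733883615057853617009380518),
   (202478156249514267819421027259158710380522373448705, 376256702621268042083520207736832251501797387522275233532045203986926980139114801468329651265895561465346957848707429507017188782481116929094044395246171404323684659088897496175629915784442000358433047190665517852462938347614768299238057528661481),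
   (228888350542906397886942720903901174385325839287297, 232183943053878782265824637809340440632415518525751192322847928742773491817658),
   (228888350542906397907225130507552844809273090573313, 412049084767180310605756355360879166675806820935307436445529356645137923712865772287830109399966230515334497479634636),
   (203945389265815006927676971926759172914307293053953, 1146089916365660805432061531846855849),
   (203945389265815006947959381530410843338254544339969, 3341422324626687306715722293832526162200792562171708601667757275372194308187194053379181255665927016581310139021571902869244723294722479077174628599673550437338564539868249337899653865),
   (203945389265815095500959711073603914291953659085825, 408938547191613978415063599493731616528273808961666492547085886433532565051460502),
   (203945389265815006948117837855439372013441632240641, 3529183978459503759546039336264115587426742512380345931096343512239377838748706367630351012776479250855747068790653421612702857886577689157126457623872346399176957795054729563523652587),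
   (203945389265815095501118167398632442967140746986497, 1452841570396451155098835791592683918322650602225089647483950603238)],
  [(179002427988701019377783492593643686397615746122753, 4177697881735971451940003205560232389889420337358551714839164518940702408119456656997658457917137029319965124009105624419037581187646896202524299779605900022648051723479364356110401207642859807849018118613178728655974668581893056237727567008332546760627242067001307984998914761067138741828815967396859114232914758569558005351055889257567765346300645329957361251242643846207720),
   (129116505434472866436441614058596461238372387849217, 57244872559140454388321812070006536510819228284243525074067967973866401438961796190533668502546719612657184637029276407377598103246182161922626454544018586841089840719191197076558567),
   (252364078803698300471676884204628225404804471784449, 352769321735065932998898300115597065573107013994347861969263769),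
   (205412622282115834914640841203713040938987956798465, 47056194321257210252075396847485114972461299338661928999386452278302757390898974516364273495617847989690085693083665477822973909356931231632666856568705648663754370026592947707497887512749356369805162145154285617537229546),
   (225953884510306086697383105689213692368198245352449, 3437018313),
   (202478156249514189304867191730819648231759847687169, 2346563960745415323660743710852149795570620595078166402456654735385233824220697181186805783862591756886124136785915296247850218),
   (202478156249514189325149601334471318655707098973185, 4344278063084201814227064043028796630435550388806881197528969660597654962925833472449031865212191552410524944933213278641364192340461035175985803581691107620474983900362875846913456781285627139641750648602733144141374057954350804095606963013992858204419084110746),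
   (253831311819660170188344579402613627017915166688257, 1123129997521807494384177917040769357078329782090919069),
   (180469661005001847099729158260383345171891895993345, 96299052584852494290922535654975705705477033548371121430822231094793048528921472482176278838848673409850448882257240509139279409220214487498048705933531695255164261410293270280958401986171402540128552992025254104867361739028435833086291455780900023691593248286248908196032363534942911128162799626869053801974435553265695029274544326278956127084275642681765984006983289078643096747369550154363327642643109090194727915596681960),
   (180469661005001847403965302315158401531100665283585, 31711195937953038575384501351303553573555309291290917123046354970304185092683232433357059116169682356305410568077222166154763531694192054563516477686508239102325020545444314717601373734041429579679881105225811742644337585283186844544018987557702907925003738320043172925022812786460260519415344634000705408152200690540820338343468230904858395794391105849913555344644969434345965001719799213122357311942995989842307727208754129290754584824883097704335041503718),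
   (275839807047815032718235169998456078592241876403201, 285655173883506093359262887033788594203158665831216764767676396662172),
   (203945389265813682932781168210579674188555925914625, 36506768347351722680035074763364670109426236542000212972521757445104740184525247496879278036956882581228481303154908873160092253154459),
   (205412622282113176519813412832979301947083325768705, 2226473228217156746447616095444304291267563963985346716018659173968900179361932798009762542289958060244729657422743219178),
   (202478156249514267819580102554206881745846910911489, 434405598281517276958681212655326078910356529127074316376008491879414162172143773770288628413562987893751917240870042110318271877338085592660659087417892945826158088570627020268343579285130965745432363957806720307682040760302787332498391859781805963052835274107366),
   (205412622282114505747809197748852205754143606113281, 1620837374265397842869641951709607887456054034026647625584871534896772941856857553895507492527491452944719563756959601755548958087494615713899227883),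
   (203945389265815095847187400230958712265878171616257, 434405598281517276958681186608419540762902582345615642542910621976676179259943340522837518495933578529988857213013627001225205528902502785867723631972219424054044050773519486981685442114822027734980118680265091903892936554181910201544709140066605970964461620963814),
   (206879855298416746343833341746190712080490681402369, 5799756493470577906715891152833934916763842063426373838080206972682193270785652382116070),
   (132050971467074522491815284707148293643759446721537, 16313737029635898659887349182889026318079762233131784604072065214081645127025488673692955225455227675175887881188928147184108677651902075300437887221711283711110279839449215409329858119891607509089288615643552890303105774800548459484163787579834608670561162727121668803456925533284373913049501425413733223561000333319258498905003206564880841859383444391995171260389597254375),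
   (127649272418172038408754778734320545035678858413057, 6860850336959901105055018540615091902756135286834073021269758398539571183253978348917477),
   (206879855297373213793701300425875233674293405877249, 1321351710791033064219278764625622757777240050762698139),
   (206879855297374543021697085341748137481353686221825, 224849833867584245438798866206989274794309396655259),
   (202478156249514267209761248793701555477295374074881, 927884726260787679047706386525911824122930758481600909587742301164958394445655333996814006853123658399558210032588225842311894697733114342502661500311821455506139774813083008587946059939100869987896007236342365359482814516120363195170583800223828424754106118155730001444633721269389876249773240060106765197984858872375848483667391007310090404357575002676400872),
   (253831311819977855679495943733053445769465505842177, 5766350666695818277767080536805307107938890964237441379588559442179219677485926556512748),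
   (253831311819979184907491728648926349576525786186753, 465972084264393293313163549544106236977549076564546883369689562415001124535675983669052575503676670905943547286086138218585522655596254408331),
   (253831311819979190099788587183753978107022115406849, 23936057583938602954075893877218049155561855439887112234048280244276816506588091802751785140635153792707181588918764),
   (158461165760489426990014606600696752594775091512321, 5824426825450385577387726518327081267275987651981059361499469953071402124900118856013961896630175353492101730658894636159733445497312445638135206426679232837845147764304505144371927323158271423384109420401532850825718463189077998291669434731687520970041871236198814786338802995608601848345362894423391374543563745899641243009176657903151739543638224066382350556219856507618230209099123412102449901341299324200773104106),
   (155526699727887770934800011247193091554712570102785, 32399449675244348414986860977056950365049967401434273870663293966835489167826257143706748092955167495993823974),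
   (179002427988701019113003905552779193039085562561537, 27419549850502585591283412988882401411312697145198110050796919281245434025861828005656105865855596111911588583),
   (82165048912846369550462846124786504489891061367809, 108845455669571473304787421534946584565257156095927518462201491227830720225898976335067901735259071527638658070621603721132124175160415263246907750248837412923410508252998967709249043777377613718660640337068837323856382142044370967881197496874415614037684833943416600383370162515268428974359336446036589078600748050267088514658687789120961932955941691020424483368067996089400574433112264286103122651660032245995517748878366996423812818780561587224833967315090653503822962619057540338047059778613932713865429765523953706557681486624569122697779024208831397319239513689789912745643275491373785579873200506826677074660),
   (76296116847643057439715499973016308312826825737217, 6860850336959901105351577955785854268878899204723690479664973278281744462380162043221219),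
   (202478156245070502209352025021630123909522615632385, 337049260992604407049199809331928661565639212852856353161946665122316561957769221063725362101664488),
   (180469661005001769173840555710659577428224604570113, 177784867565724233491887129722131191471110024525301512204675468963053546852639975027688605101854152581030500390716581642466029626949813107183311256724538758514224865207589049554288514830263783931111)],
  [(158461165760489426948420112636571603944409401590273, 129526444105785542068693104605487165694515213713540597539739750201293648071087315308320793036350331809380903739363842940429018742247),
   (155526699727887770933770336490371283752241382752769, 142604563856842666732114002620575471354422592143527800558176601949773116400651924800515247327903446234420828968184303457866973756134),
   (1467233016300828027686836537942621384438896984321, 1882280353448436997802418628856180573444543679505956807532009224885933019430689869105962965468310942676891367932980936621136838224429271879884833706752645569653197317380594312529346814985261674041226088498424123874974210987925434564419063426840810314400485220362951063427143815272257018093808769988889641767647460780544663218200212537394149593358041934397668984066739457662547224131143633726056133744501398744424811022672945127335611755234651978209476364448652558455773017453654239371740692913332867391728866581345969591096872530471171968045996504031740885559887725390222044387917459527385404000875658159929184989291978091581662023488730465950257618479447510610567091996729410008237735887134954836610358237566683051394736347367334871807471581127406047775860663118351751390608160257716848314249896598439243080456248448395381296616919465547087655004756732727937179359362960939583783446245356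99089886126269167975985217234493045747224808936001404675329324467828031920162492811229993520569553898589849375119594194691864062808155542928482560)]]

/-- The keys of the patterns in `uncolorable`. -/
def uncolorableKeys : List ℕ := [
  390439075948761504120006043631616, 306139701732019670584675738976256,
  299484826223756052508019153043456, 267317967381839941416702939103232,
  239588103247370168367476260864000, 259553491398378883635597950976000,
  153071334218359481515406539751424, 249570858978275794914274903195648,
  230714462002929080611161850380288, 277300708605635732587951484960768,
  177473376159364461863291096530944, 221840994843806021865048224956416,
  179691764709763863315910327140352, 195220593366621310815644630515712,
  161944736094934878749307674689536, 211858253620010230693799679098880,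
  219622526503933588713603689218048, 139760908619011270843841563459584,
  170818203254057937495421300113408, 239587929162052139357275475804160,
  201875497889104604147001036767232, 292829181837933269498009209143296,
  275082066180445270426306164162560, 235151282625241857083787696537600,
  195220484562928608365719132438528, 170817622969848978655155468238848,
  217404166967753858012084651556864, 177473383412550444669566183931904,
  137542585350237195951497619832832, 257334950522957271354603119181824,
  177473368905440609294016087457792, 125340635924705223727950657617920,
  137541664149131566471167945080832, 119794599266896926095390198595584,
  97611787287923947233429055733760, 79863866486209003937596921479168]

theorem all_checkFrom : ((List.range 33).all fun c => checkFrom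
    (lookup (colorable ++ uncolorable) lemmas) (576 + 32 * c) (lemmas.getD c [])) = true := by
  decide +kernel

theorem all_edge_lookup : (offsets.all fun k => Nat.beq
    (edge (lookup (colorable ++ uncolorable) lemmas 1602) k) 1) = true := by
  decide +kernel

theorem length_lemmas : lemmas.length = 33 := by
  decide +kernel

theorem all_isFull : ((colorable ++ uncolorable).flatten.all isFull) = true := by
  decide +kernel

theorem all_isColored : (colorable.flatten.all isColored) = true := by
  decide +kernel

theorem map_key_uncolorable : uncolorable.flatten.map key = uncolorableKeys := by
  decide +kernel

theorem nodup_uncolorableKeys : uncolorableKeys.Nodup := by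
  decide +kernel

theorem key_colorable_ne : (colorable.flatten.all fun q =>
    uncolorableKeys.all fun y => !Nat.beq y (key q)) = true := by
  decide +kernel

theorem exists_models_mem {G : SimpleGraph (Fin 14)} (hG : ∀ v, (G.neighborSet v).ncard = 3) :
    ∃ q ∈ colorable.flatten ++ uncolorable.flatten, isFull q = true ∧ ∃ e, Models q G e := by
  have hlemmas : ∀ c, checkFrom (lookup (colorable ++ uncolorable) lemmas) (576 + 32 * c)
      (lemmas.getD c []) = true := by
    intro c
    by_cases hc : c < 33
    · exact List.all_eq_true.mp all_checkFrom c (List.mem_range.mpr hc)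
    · rw [List.getD_eq_default _ _ (le_of_eq_of_le length_lemmas (not_lt.mp hc))]
      rfl
  obtain ⟨q, hq, σ, hσ, hemb⟩ := exists_embeds hG hlemmas (r := 1602)
    fun k hk => Nat.eq_of_beq_eq_true (List.all_eq_true.mp all_edge_lookup k hk)
  have hfull := List.all_eq_true.mp all_isFull q hq
  rw [List.flatten_append] at hq
  exact ⟨q, hq, hfull, exists_models hG hfull hσ hemb⟩

theorem not_mem_uncolorableKeys {q : ℕ} (hq : q ∈ colorable.flatten) :
    key q ∉ uncolorableKeys := fun h => by
  have := List.all_eq_true.mp (List.all_eq_true.mp key_colorable_ne q hq) _ h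
  simp at this

end CubicFourteen

/-- Every cubic graph on 14 vertices that is cospectral with some non-isomorphic cubic
graph on 14 vertices has chromatic index 3. -/
theorem cubic_order_fourteen_cospectral_pair_chromaticIndex_eq_three
    (G : SimpleGraph (Fin 14))
    (hG : ∀ v, (G.neighborSet v).ncard = 3)
    (hpair : ∃ H : SimpleGraph (Fin 14),
      (∀ v, (H.neighborSet v).ncard = 3) ∧
      (adjMat G).charpoly = (adjMat H).charpoly ∧
      ¬ Nonempty (G ≃g H)) :
    chromaticIndex G = 3 := by
  classical
  obtain ⟨H, hH, hchar, hiso⟩ := hpair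
  obtain ⟨q, hq, hqfull, e, he⟩ := CubicFourteen.exists_models_mem hG
  obtain ⟨r, hr, hrfull, f, hf⟩ := CubicFourteen.exists_models_mem hH
  rcases List.mem_append.mp hq with hq | hq
  · have hcol := he.colorable hqfull (List.all_eq_true.mp CubicFourteen.all_isColored q hq)
    exact le_antisymm hcol.chromaticNumber_le
      (CubicFourteen.three_le_chromaticNumber_lineGraph (hG 0))
  · have hkey := he.key_eq hG hH hqfull hrfull hf (he.trace_pow_eq hG hH hf hchar)
    have hmem : CubicFourteen.key q ∈ CubicFourteen.uncolorableKeys :=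
      CubicFourteen.map_key_uncolorable ▸ List.mem_map_of_mem hq
    have hr' : r ∈ CubicFourteen.uncolorable.flatten := (List.mem_append.mp hr).resolve_left
      fun h => CubicFourteen.not_mem_uncolorableKeys h (hkey ▸ hmem)
    have hnodup := CubicFourteen.nodup_uncolorableKeys
    rw [← CubicFourteen.map_key_uncolorable] at hnodup
    have hqr := List.inj_on_of_nodup_map hnodup hq hr' hkey
    exact absurd (he.iso (hqr ▸ hf)) hiso
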